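/- arXiv:1711.01706 — 2 statements merged into one kernel-verified Lean document; each statement's English description precedes it below -/
import Mathlib

section
/- For every ε with 0 < ε ≤ 1/2 there exists a bound p₀(ε) such that for every prime p > p₀(ε), the number of primes q < p^{1/2+ε} that are quadratic residues modulo p exceeds p^{ε/25}. -/
section
open Finset

/-- Dirichlet hyperbola method. -/
lemma hyp_sum (F : ℕ → ℕ → ℝ) (x u : ℕ) (hu : 1 ≤ u) :
    ∑ n ∈ Ioc 0 x, ∑ z ∈ n.divisorsAntidiagonal, F z.1 z.2 =
      ∑ d ∈ Ioc 0 u, ∑ e ∈ Ioc 0 (x / d), F d e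
        + ∑ e ∈ Ioc 0 (x / u), ∑ d ∈ Ioc u (x / e), F d e := by
  have hP : ∑ n ∈ Ioc 0 x, ∑ z ∈ n.divisorsAntidiagonal, F z.1 z.2 =
      ∑ z ∈ ((Ioc 0 x) ×ˢ (Ioc 0 x)).filter (fun z => z.1 * z.2 ≤ x), F z.1 z.2 := by
    rw [Finset.sum_sigma']
    refine Finset.sum_nbij' (fun z => z.2) (fun z => ⟨z.1 * z.2, z⟩) ?_ ?_ ?_ ?_ ?_
    · rintro ⟨n, d, e⟩ h
      simp only [mem_sigma, mem_Ioc, Nat.mem_divisorsAntidiagonal, mem_filter, mem_product] at h ⊢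
      obtain ⟨⟨h1, h2⟩, h3, h4⟩ := h
      subst h3
      have hd : 0 < d := Nat.pos_of_ne_zero (by rintro rfl; simp at h4)
      have he : 0 < e := Nat.pos_of_ne_zero (by rintro rfl; simp at h4)
      refine ⟨⟨⟨hd, ?_⟩, he, ?_⟩, h2⟩ <;> nlinarith
    · rintro ⟨d, e⟩ h
      simp only [mem_sigma, mem_Ioc, Nat.mem_divisorsAntidiagonal, mem_filter, mem_product] at h ⊢
      obtain ⟨⟨⟨h1, h2⟩, h3, h4⟩, h5⟩ := h
      have : 0 < d * e := Nat.mul_pos h1 h3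
      exact ⟨⟨this, h5⟩, trivial, this.ne'⟩
    · rintro ⟨n, d, e⟩ h
      simp only [mem_sigma, mem_Ioc, Nat.mem_divisorsAntidiagonal] at h ⊢
      obtain ⟨⟨h1, h2⟩, h3, h4⟩ := h
      subst h3; rfl
    · rintro ⟨d, e⟩ h; rfl
    · rintro ⟨n, d, e⟩ h; rfl
  rw [hP, ← Finset.sum_filter_add_sum_filter_not _ (fun z : ℕ × ℕ => z.1 ≤ u)]
  congr 1
  · rw [Finset.sum_sigma']
    refine Finset.sum_nbij' (fun z => ⟨z.1, z.2⟩) (fun z => (z.1, z.2)) ?_ ?_ ?_ ?_ ?_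
    · rintro ⟨d, e⟩ h
      simp only [mem_sigma, mem_Ioc, mem_filter, mem_product] at h ⊢
      obtain ⟨⟨⟨⟨h1, h2⟩, h3, h4⟩, h5⟩, h6⟩ := h
      exact ⟨⟨h1, h6⟩, h3, (Nat.le_div_iff_mul_le h1).2 (by rw [mul_comm]; exact h5)⟩
    · rintro ⟨d, e⟩ h
      simp only [mem_sigma, mem_Ioc, mem_filter, mem_product] at h ⊢
      obtain ⟨⟨h1, h6⟩, h3, h4⟩ := h
      rw [Nat.le_div_iff_mul_le h1] at h4
      refine ⟨⟨⟨⟨h1, ?_⟩, h3, ?_⟩, ?_⟩, h6⟩ <;> nlinarith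
    · rintro ⟨d, e⟩ h; rfl
    · rintro ⟨d, e⟩ h; rfl
    · rintro ⟨d, e⟩ h; rfl
  · rw [Finset.sum_sigma']
    refine Finset.sum_nbij' (fun z => ⟨z.2, z.1⟩) (fun z => (z.2, z.1)) ?_ ?_ ?_ ?_ ?_
    · rintro ⟨d, e⟩ h
      simp only [mem_sigma, mem_Ioc, mem_filter, mem_product] at h ⊢
      obtain ⟨⟨⟨⟨h1, h2⟩, h3, h4⟩, h5⟩, h6⟩ := h
      push Not at h6
      refine ⟨⟨h3, (Nat.le_div_iff_mul_le hu).2 ?_⟩, h6, (Nat.le_div_iff_mul_le h3).2 h5⟩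
      nlinarith
    · rintro ⟨e, d⟩ h
      simp only [mem_sigma, mem_Ioc, mem_filter, mem_product] at h ⊢
      obtain ⟨⟨h1, h6⟩, h3, h4⟩ := h
      rw [Nat.le_div_iff_mul_le h1] at h4
      refine ⟨⟨⟨⟨by omega, ?_⟩, h1, ?_⟩, h4⟩, by omega⟩ <;> nlinarith
    · rintro ⟨d, e⟩ h; rfl
    · rintro ⟨d, e⟩ h; rfl
    · rintro ⟨d, e⟩ h; rfl

lemma sum_Ioc_succ (f : ℕ → ℝ) {a b : ℕ} (h : a ≤ b) :
    ∑ n ∈ Ioc a (b+1), f n = ∑ n ∈ Ioc a b, f n + f (b+1) := by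
  rw [Finset.sum_Ioc_succ_top (by omega)]

lemma abel_identity (g w : ℕ → ℝ) (N N' : ℕ) (h : N ≤ N') :
    ∑ n ∈ Ioc N N', g n * w n =
      (∑ n ∈ Ioc 0 N', g n) * w N' - (∑ n ∈ Ioc 0 N, g n) * w N
        + ∑ n ∈ Ico N N', (∑ m ∈ Ioc 0 n, g m) * (w n - w (n+1)) := by
  induction N', h using Nat.le_induction with
  | base => simp
  | succ k hk ih =>
    rw [sum_Ioc_succ _ hk, ih, Finset.sum_Ico_succ_top hk, sum_Ioc_succ g (Nat.zero_le k)]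
    ring

lemma pow_diff_bound (θ σ : ℝ) (k : ℕ) (hθσ : θ ≤ σ) (hσ : 0 ≤ σ) (hk : σ ≤ k * (σ - θ))
    (n : ℕ) (hn : 1 ≤ n) :
    (n:ℝ) ^ θ * ((n:ℝ) ^ (-σ) - ((n+1 : ℕ):ℝ) ^ (-σ)) ≤
      k * ((n:ℝ) ^ (θ - σ) - ((n+1 : ℕ):ℝ) ^ (θ - σ)) := by
  have hn0 : (0:ℝ) < n := by exact_mod_cast hn
  have hn1 : (0:ℝ) < ((n+1:ℕ):ℝ) := by positivity
  set v : ℝ := (n:ℝ) / ((n+1:ℕ):ℝ) with hv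
  have hv0 : 0 < v := by positivity
  have hv1 : v ≤ 1 := by rw [hv, div_le_one hn1]; push_cast; linarith
  have e1 : ∀ s : ℝ, ((n+1:ℕ):ℝ) ^ (-s) = (n:ℝ) ^ (-s) * v ^ s := by
    intro s
    rw [hv, Real.div_rpow hn0.le hn1.le, Real.rpow_neg hn0.le, Real.rpow_neg hn1.le]
    field_simp
  have e2 : θ - σ = -(σ - θ) := by ring
  rw [e2, e1 σ, e1 (σ - θ)]
  have e3 : (n:ℝ) ^ θ * (n:ℝ) ^ (-σ) = (n:ℝ) ^ (-(σ - θ)) := by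
    rw [← Real.rpow_add hn0]; ring_nf
  have hv2 : v ^ ((k:ℝ) * (σ - θ)) ≤ v ^ σ :=
    Real.rpow_le_rpow_of_exponent_ge hv0 hv1 hk
  have hv3 : v ^ ((k:ℝ) * (σ - θ)) = (v ^ (σ - θ)) ^ k := by
    rw [mul_comm, Real.rpow_mul hv0.le, Real.rpow_natCast]
  have ht1 : v ^ (σ - θ) ≤ 1 := Real.rpow_le_one hv0.le hv1 (by linarith)
  have ht0 : 0 ≤ v ^ (σ - θ) := Real.rpow_nonneg hv0.le _
  have hb := one_add_mul_le_pow (a := v ^ (σ - θ) - 1) (by linarith) k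
  have hb' : 1 - v ^ σ ≤ k * (1 - v ^ (σ - θ)) := by
    have : 1 + (v ^ (σ - θ) - 1) = v ^ (σ - θ) := by ring
    rw [this] at hb
    linarith
  have hpos : 0 ≤ (n:ℝ) ^ (-(σ - θ)) := Real.rpow_nonneg hn0.le _
  calc (n:ℝ) ^ θ * ((n:ℝ) ^ (-σ) - (n:ℝ) ^ (-σ) * v ^ σ)
      = (n:ℝ) ^ (-(σ - θ)) * (1 - v ^ σ) := by rw [← e3]; ring
    _ ≤ (n:ℝ) ^ (-(σ - θ)) * (k * (1 - v ^ (σ - θ))) := by gcongr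
    _ = _ := by ring

lemma abel_bound (g : ℕ → ℝ) (M θ σ : ℝ) (k : ℕ) (hM : 0 ≤ M) (hθσ : θ ≤ σ) (hσ : 0 ≤ σ)
    (hk1 : 1 ≤ k) (hk : σ ≤ k * (σ - θ))
    (hg : ∀ N : ℕ, 1 ≤ N → |∑ n ∈ Ioc 0 N, g n| ≤ M * (N:ℝ) ^ θ)
    (N N' : ℕ) (hN : 1 ≤ N) (h : N ≤ N') :
    |∑ n ∈ Ioc N N', g n * (n:ℝ) ^ (-σ)| ≤ (1 + k) * M * (N:ℝ) ^ (θ - σ) := by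
  rw [abel_identity g (fun n => (n:ℝ) ^ (-σ)) N N' h]
  have hb : ∀ n : ℕ, 1 ≤ n → |(∑ n ∈ Ioc 0 n, g n) * (n:ℝ) ^ (-σ)| ≤ M * (n:ℝ) ^ (θ - σ) := by
    intro n hn
    have hn0 : (0:ℝ) < n := by exact_mod_cast hn
    rw [abs_mul, abs_of_nonneg (Real.rpow_nonneg hn0.le (-σ))]
    calc _ ≤ M * (n:ℝ) ^ θ * (n:ℝ) ^ (-σ) := by gcongr; exact hg n hn
      _ = _ := by rw [mul_assoc, ← Real.rpow_add hn0]; ring_nf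
  have hs : |∑ n ∈ Ico N N', (∑ m ∈ Ioc 0 n, g m) * ((n:ℝ) ^ (-σ) - ((n+1:ℕ):ℝ) ^ (-σ))|
      ≤ M * k * ((N:ℝ) ^ (θ - σ) - (N':ℝ) ^ (θ - σ)) := by
    refine (Finset.abs_sum_le_sum_abs _ _).trans ?_
    have htel : ∑ n ∈ Ico N N', ((n:ℝ) ^ (θ - σ) - ((n+1:ℕ):ℝ) ^ (θ - σ))
        = (N:ℝ) ^ (θ - σ) - (N':ℝ) ^ (θ - σ) := by
      have := Finset.sum_Ico_sub (fun n : ℕ => -((n:ℝ) ^ (θ - σ))) h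
      rw [show (N:ℝ) ^ (θ - σ) - (N':ℝ) ^ (θ - σ) = -((N':ℝ) ^ (θ - σ)) - -((N:ℝ) ^ (θ - σ)) by ring,
        ← this]
      refine Finset.sum_congr rfl fun n _ => by ring
    rw [← htel, Finset.mul_sum]
    refine Finset.sum_le_sum fun n hn => ?_
    rw [Finset.mem_Ico] at hn
    have hn1 : 1 ≤ n := by omega
    have hn0 : (0:ℝ) < n := by exact_mod_cast hn1
    have hd : 0 ≤ (n:ℝ) ^ (-σ) - ((n+1:ℕ):ℝ) ^ (-σ) := by
      have := Real.rpow_le_rpow_of_nonpos hn0 (show (n:ℝ) ≤ ((n+1:ℕ):ℝ) by push_cast; linarith)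
        (show -σ ≤ 0 by linarith)
      linarith
    rw [abs_mul, abs_of_nonneg hd]
    calc _ ≤ M * (n:ℝ) ^ θ * ((n:ℝ) ^ (-σ) - ((n+1:ℕ):ℝ) ^ (-σ)) := by gcongr; exact hg n hn1
      _ = M * ((n:ℝ) ^ θ * ((n:ℝ) ^ (-σ) - ((n+1:ℕ):ℝ) ^ (-σ))) := by ring
      _ ≤ M * (k * ((n:ℝ) ^ (θ - σ) - ((n+1 : ℕ):ℝ) ^ (θ - σ))) := by
        exact mul_le_mul_of_nonneg_left (pow_diff_bound θ σ k hθσ hσ hk n hn1) hM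
      _ = _ := by ring
  have h1 := abs_le.1 (hb N hN)
  have h2 := abs_le.1 (hb N' (hN.trans h))
  have h3 := abs_le.1 hs
  have hk1' : (1:ℝ) ≤ k := by exact_mod_cast hk1
  have hx : 0 ≤ M * (N':ℝ) ^ (θ - σ) := by positivity
  have hy : M * (N':ℝ) ^ (θ - σ) ≤ k * (M * (N':ℝ) ^ (θ - σ)) := le_mul_of_one_le_left hx hk1'
  rw [abs_le]
  constructor <;> nlinarith

/-- bounded partial sums -/
def BP (χ : ℕ → ℝ) (M : ℝ) : Prop := ∀ N : ℕ, |∑ n ∈ Ioc 0 N, χ n| ≤ M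

/-- partial sums of the Dirichlet series -/
noncomputable def PS (χ : ℕ → ℝ) (σ : ℝ) (N : ℕ) : ℝ := ∑ n ∈ Ioc 0 N, χ n * (n:ℝ) ^ (-σ)

/-- value of the Dirichlet series -/
noncomputable def Lv (χ : ℕ → ℝ) (σ : ℝ) : ℝ := Filter.atTop.limUnder (PS χ σ)

lemma BP.nonneg {χ : ℕ → ℝ} {M : ℝ} (h : BP χ M) : 0 ≤ M := (abs_nonneg _).trans (h 0)

lemma BP.abel {χ : ℕ → ℝ} {M : ℝ} (h : BP χ M) {σ : ℝ} (hσ : 0 ≤ σ) {N N' : ℕ} (hN : 1 ≤ N)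
    (hNN : N ≤ N') : |∑ n ∈ Ioc N N', χ n * (n:ℝ) ^ (-σ)| ≤ 2 * M * (N:ℝ) ^ (-σ) := by
  have := abel_bound χ M 0 σ 1 h.nonneg hσ hσ le_rfl (by simp) (fun N _ => by simpa using h N)
    N N' hN hNN
  convert this using 1
  push_cast
  rw [zero_sub]; ring

lemma PS_sub (χ : ℕ → ℝ) (σ : ℝ) {N N' : ℕ} (h : N ≤ N') :
    PS χ σ N' - PS χ σ N = ∑ n ∈ Ioc N N', χ n * (n:ℝ) ^ (-σ) := by
  unfold PS
  rw [← Finset.sum_Ioc_consecutive _ (Nat.zero_le N) h]; ring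

lemma BP.tendsto {χ : ℕ → ℝ} {M : ℝ} (h : BP χ M) {σ : ℝ} (hσ : 0 < σ) :
    Filter.Tendsto (PS χ σ) Filter.atTop (nhds (Lv χ σ)) := by
  have hc : CauchySeq (PS χ σ) := by
    have hb : Filter.Tendsto (fun N : ℕ => 2 * (2 * M * (N:ℝ) ^ (-σ))) Filter.atTop (nhds 0) := by
      have := ((tendsto_rpow_neg_atTop hσ).comp tendsto_natCast_atTop_atTop).const_mul (2 * (2 * M))
      simp only [mul_zero] at this
      refine this.congr fun N => ?_
      simp only [Function.comp]; ring
    rw [Metric.cauchySeq_iff']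
    intro ε hε
    obtain ⟨N, hN, hN1⟩ := ((hb.eventually (gt_mem_nhds hε)).and (Filter.eventually_ge_atTop 1)).exists
    refine ⟨N, fun n hn => ?_⟩
    rw [Real.dist_eq, PS_sub _ _ hn]
    have h1 := h.abel hσ.le hN1 hn
    have : 0 ≤ 2 * M * (N:ℝ) ^ (-σ) := (abs_nonneg _).trans h1
    linarith
  exact hc.tendsto_limUnder

lemma BP.tail {χ : ℕ → ℝ} {M : ℝ} (h : BP χ M) {σ : ℝ} (hσ : 0 < σ) {N : ℕ} (hN : 1 ≤ N) :
    |PS χ σ N - Lv χ σ| ≤ 2 * M * (N:ℝ) ^ (-σ) := by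
  have h1 : Filter.Tendsto (fun n => |PS χ σ N - PS χ σ n|) Filter.atTop
      (nhds |PS χ σ N - Lv χ σ|) := ((h.tendsto hσ).const_sub _).abs
  refine le_of_tendsto h1 ?_
  filter_upwards [Filter.eventually_ge_atTop N] with n hn
  rw [abs_sub_comm, PS_sub _ _ hn]
  exact h.abel hσ.le hN hn

/-- continuity -/
lemma BP.continuousOn {χ : ℕ → ℝ} {M : ℝ} (h : BP χ M) {a : ℝ} (ha : 0 < a) :
    ContinuousOn (Lv χ) (Set.Ici a) := by
  have hu : TendstoUniformlyOn (fun N σ => PS χ σ N) (Lv χ) Filter.atTop (Set.Ici a) := by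
    have hb : Filter.Tendsto (fun N : ℕ => 2 * M * (N:ℝ) ^ (-a)) Filter.atTop (nhds 0) := by
      have := ((tendsto_rpow_neg_atTop ha).comp tendsto_natCast_atTop_atTop).const_mul (2 * M)
      simpa using this
    rw [Metric.tendstoUniformlyOn_iff]
    intro ε hε
    filter_upwards [hb.eventually (gt_mem_nhds hε), Filter.eventually_ge_atTop 1] with N hN hN1 σ hσ
    rw [Set.mem_Ici] at hσ
    rw [dist_comm, Real.dist_eq]
    refine (h.tail (ha.trans_le hσ) hN1).trans_lt (lt_of_le_of_lt ?_ hN)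
    have := h.nonneg
    gcongr
    exact_mod_cast hN1
  refine hu.continuousOn (Filter.Eventually.frequently (Filter.Eventually.of_forall fun N => ?_))
  unfold PS
  refine continuousOn_finsetSum _ fun n hn => ?_
  have : (0:ℝ) < n := by exact_mod_cast (Finset.mem_Ioc.1 hn).1
  refine Continuous.continuousOn ?_
  exact continuous_const.mul (Continuous.rpow continuous_const continuous_neg (fun _ => Or.inl this.ne'))

lemma rpow_concave_bounds {η a b : ℝ} (hη : 0 < η) (hη1 : η < 1) (ha : 0 < a) (hb : 0 < b) :
    b ^ η ≤ a ^ η + η * a ^ (η - 1) * (b - a) := by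
  have h := rpow_one_add_le_one_add_mul_self (s := (b - a) / a)
    (by rw [le_div_iff₀ ha]; linarith) hη.le hη1.le
  have e : 1 + (b - a) / a = b / a := by field_simp; ring
  rw [e, Real.div_rpow hb.le ha.le, div_le_iff₀ (by positivity)] at h
  have e2 : a ^ (η - 1) = a ^ η / a := by rw [Real.rpow_sub ha, Real.rpow_one]
  rw [e2]
  calc b ^ η ≤ _ := h
    _ = _ := by field_simp

/-- Partial sums of zeta at `β`. -/
noncomputable def ZS (β : ℝ) (N : ℕ) : ℝ := ∑ m ∈ Ioc 0 N, (m:ℝ) ^ (-β)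

lemma ZS_step {β : ℝ} (h0 : 0 < β) (h1 : β < 1) (N : ℕ) (hN : 1 ≤ N) :
    ZS β (N+1) - ((N+1:ℕ):ℝ) ^ (1-β) / (1-β) ≤ ZS β N - (N:ℝ) ^ (1-β) / (1-β) ∧
    ZS β N - (N:ℝ) ^ (1-β) / (1-β) - (N:ℝ) ^ (-β) ≤
      ZS β (N+1) - ((N+1:ℕ):ℝ) ^ (1-β) / (1-β) - ((N+1:ℕ):ℝ) ^ (-β) := by
  have hn0 : (0:ℝ) < N := by exact_mod_cast hN
  have hn1 : (0:ℝ) < ((N+1:ℕ):ℝ) := by positivity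
  have hη : 0 < 1 - β := by linarith
  have k1 := rpow_concave_bounds hη (by linarith) hn0 hn1
  have k2 := rpow_concave_bounds hη (by linarith) hn1 hn0
  have e : (1 - β - 1) = -β := by ring
  rw [e] at k1 k2
  have hs : ZS β (N+1) = ZS β N + ((N+1:ℕ):ℝ) ^ (-β) := by
    unfold ZS; rw [sum_Ioc_succ _ (Nat.zero_le _)]
  rw [hs]
  have d1 : ((N+1:ℕ):ℝ) - N = 1 := by push_cast; ring
  have d2 : (N:ℝ) - ((N+1:ℕ):ℝ) = -1 := by push_cast; ring
  rw [d1] at k1; rw [d2] at k2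
  have k1' : (((N+1:ℕ):ℝ) ^ (1-β)) / (1-β) ≤ (N:ℝ) ^ (1-β) / (1-β) + (N:ℝ) ^ (-β) := by
    rw [div_add' _ _ _ hη.ne', div_le_div_iff_of_pos_right hη]; linarith
  have k2' : (N:ℝ) ^ (1-β) / (1-β) ≤ (((N+1:ℕ):ℝ) ^ (1-β)) / (1-β) - ((N+1:ℕ):ℝ) ^ (-β) := by
    rw [div_sub' hη.ne', div_le_div_iff_of_pos_right hη]; linarith
  constructor <;> linarith

lemma ZS_anti {β : ℝ} (h0 : 0 < β) (h1 : β < 1) {N N' : ℕ} (hN : 1 ≤ N) (h : N ≤ N') :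
    ZS β N' - (N':ℝ) ^ (1-β) / (1-β) ≤ ZS β N - (N:ℝ) ^ (1-β) / (1-β) ∧
    ZS β N - (N:ℝ) ^ (1-β) / (1-β) - (N:ℝ) ^ (-β) ≤
      ZS β N' - (N':ℝ) ^ (1-β) / (1-β) - (N':ℝ) ^ (-β) := by
  induction N', h using Nat.le_induction with
  | base => simp
  | succ k hk ih =>
    have := ZS_step h0 h1 k (hN.trans hk)
    exact ⟨this.1.trans ih.1, ih.2.trans this.2⟩

lemma ZS_one (β : ℝ) : ZS β 1 = 1 := by simp [ZS]

lemma ZS_le {β : ℝ} (h0 : 0 < β) (h1 : β < 1) (N : ℕ) : ZS β N ≤ (N:ℝ) ^ (1-β) / (1-β) := by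
  have hη : 0 < 1 - β := by linarith
  rcases Nat.eq_zero_or_pos N with rfl | hN
  · simp only [ZS, Ioc_self, sum_empty]; positivity
  · have := (ZS_anti h0 h1 le_rfl hN).1
    rw [ZS_one] at this
    simp only [Nat.cast_one, Real.one_rpow] at this
    have h2 : 1 ≤ 1 / (1-β) := by rw [le_div_iff₀ hη]; linarith
    linarith

lemma floor_half {y : ℝ} (hy : 1 ≤ y) : 1 ≤ ⌊y⌋₊ ∧ (⌊y⌋₊:ℝ) ≤ y ∧ y ≤ 2 * (⌊y⌋₊:ℝ) := by
  have h1 : 1 ≤ ⌊y⌋₊ := (Nat.one_le_floor_iff y).2 hy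
  have h2 := Nat.floor_le (show 0 ≤ y by linarith)
  have h3 := Nat.lt_floor_add_one y
  have h4 : (1:ℝ) ≤ (⌊y⌋₊:ℝ) := by exact_mod_cast h1
  exact ⟨h1, h2, by linarith⟩

/-- negative powers, halving -/
lemma rpow_neg_half {a y β : ℝ} (ha : 0 < a) (hy : 0 < y) (h : y ≤ 2 * a) (h0 : 0 ≤ β) (h1 : β ≤ 1) :
    a ^ (-β) ≤ 2 * y ^ (-β) := by
  have h2 : a ^ (-β) ≤ (y/2) ^ (-β) :=
    Real.rpow_le_rpow_of_nonpos (by positivity) (by linarith) (by linarith)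
  refine h2.trans ?_
  rw [Real.div_rpow hy.le (by norm_num), Real.rpow_neg (show (0:ℝ) ≤ 2 by norm_num), div_inv_eq_mul,
    mul_comm]
  have : (2:ℝ) ^ β ≤ 2 ^ (1:ℝ) := Real.rpow_le_rpow_of_exponent_le (by norm_num) h1
  rw [Real.rpow_one] at this
  gcongr

lemma zeta_sum {β : ℝ} (h0 : 0 < β) (h1 : β < 1) : ∃ Z : ℝ, Z < 0 ∧ |Z| ≤ 1 / (1-β) ∧
    ∀ y : ℝ, 1 ≤ y → |ZS β ⌊y⌋₊ - y ^ (1-β) / (1-β) - Z| ≤ 2 * y ^ (-β) := by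
  have hη : 0 < 1 - β := by linarith
  set a : ℕ → ℝ := fun n => ZS β (n+1) - ((n+1:ℕ):ℝ) ^ (1-β) / (1-β) with ha
  have hlow : ∀ N M : ℕ, ZS β (N+1) - ((N+1:ℕ):ℝ) ^ (1-β) / (1-β) - ((N+1:ℕ):ℝ) ^ (-β) ≤ a M := by
    intro N M
    have hp : ∀ k : ℕ, (0:ℝ) ≤ ((k+1:ℕ):ℝ) ^ (-β) := fun k => by positivity
    rcases le_total N M with h | h
    · have := (ZS_anti h0 h1 (show 1 ≤ N+1 by omega) (show N+1 ≤ M+1 by omega)).2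
      have := hp M
      simp only [ha]; linarith
    · have := (ZS_anti h0 h1 (show 1 ≤ M+1 by omega) (show M+1 ≤ N+1 by omega)).1
      have := hp N
      simp only [ha]; linarith
  have hbdd : BddBelow (Set.range a) := ⟨_, by rintro _ ⟨M, rfl⟩; exact hlow 0 M⟩
  set Z := ⨅ n, a n with hZ
  have hZle : ∀ N, Z ≤ a N := fun N => ciInf_le hbdd N
  have hZge : ∀ N : ℕ, ZS β (N+1) - ((N+1:ℕ):ℝ) ^ (1-β) / (1-β) - ((N+1:ℕ):ℝ) ^ (-β) ≤ Z :=
    fun N => le_ciInf (hlow N)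
  have h3 : Z ≤ 1 - 1/(1-β) := by
    have := hZle 0
    simpa [ha, ZS_one] using this
  have h4 : -(1/(1-β)) ≤ Z := by
    have := hZge 0
    simpa [ha, ZS_one] using this
  have h5 : 1 < 1 / (1-β) := by rw [lt_div_iff₀ hη]; linarith
  refine ⟨Z, by linarith, ?_, ?_⟩
  · rw [abs_le]; constructor <;> linarith
  · intro y hy
    obtain ⟨f1, f2, f3⟩ := floor_half hy
    set N := ⌊y⌋₊ with hN
    obtain ⟨k, hk⟩ : ∃ k, N = k + 1 := ⟨N - 1, by omega⟩
    have hn0 : (0:ℝ) < N := by exact_mod_cast f1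
    have hy0 : 0 < y := by linarith
    have g1 := hZle k
    have g2 := hZge k
    simp only [ha] at g1
    rw [← hk] at g1 g2
    have hc := rpow_concave_bounds hη (by linarith) hn0 hy0
    have e : (1 - β - 1) = -β := by ring
    rw [e] at hc
    have hlt : y - N ≤ 1 := by have := Nat.lt_floor_add_one y; linarith
    have hnb : 0 ≤ (N:ℝ) ^ (-β) := by positivity
    have hc' : y ^ (1-β) / (1-β) ≤ (N:ℝ) ^ (1-β) / (1-β) + (N:ℝ) ^ (-β) := by
      rw [div_add' _ _ _ hη.ne', div_le_div_iff_of_pos_right hη]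
      have : (1-β) * (N:ℝ) ^ (-β) * (y - N) ≤ (1-β) * (N:ℝ) ^ (-β) * 1 := by gcongr
      linarith
    have hm : (N:ℝ) ^ (1-β) / (1-β) ≤ y ^ (1-β) / (1-β) := by gcongr
    have hh := rpow_neg_half hn0 hy0 f3 h0.le h1.le
    rw [abs_le]; constructor <;> linarith

/-- The convolution `1 * χ`. -/
noncomputable def rr (χ : ℕ → ℝ) (n : ℕ) : ℝ := ∑ z ∈ n.divisorsAntidiagonal, χ z.1

lemma rr_weighted (χ : ℕ → ℝ) (β : ℝ) (n : ℕ) :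
    rr χ n * (n:ℝ) ^ (-β) = ∑ z ∈ n.divisorsAntidiagonal, (χ z.1 * (z.1:ℝ) ^ (-β)) * (z.2:ℝ) ^ (-β) := by
  unfold rr
  rw [Finset.sum_mul]
  refine Finset.sum_congr rfl fun z hz => ?_
  rw [Nat.mem_divisorsAntidiagonal] at hz
  rw [← hz.1]; push_cast
  rw [Real.mul_rpow (by positivity) (by positivity)]; ring

lemma sum_rr_weighted {χ : ℕ → ℝ} {M : ℝ} (h : BP χ M) (hM : 1 ≤ M) (hχ : ∀ n, |χ n| ≤ 1)
    {β : ℝ} (h0 : 1/2 ≤ β) (h1 : β < 1) : ∃ Z : ℝ, Z < 0 ∧ ∀ y : ℝ, 1 ≤ y →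
    |∑ n ∈ Ioc 0 ⌊y⌋₊, rr χ n * (n:ℝ) ^ (-β) - (Lv χ 1 / (1-β) * y ^ (1-β) + Z * Lv χ β)|
      ≤ 20 * (M / (1-β)) * y ^ (1/2-β) := by
  have hβ0 : 0 < β := by linarith
  have hη : 0 < 1 - β := by linarith
  obtain ⟨Z, hZ0, hZ1, hZ⟩ := zeta_sum hβ0 h1
  refine ⟨Z, hZ0, fun y hy => ?_⟩
  have hy0 : 0 < y := by linarith
  set x := ⌊y⌋₊ with hx
  set s : ℝ := y ^ (1/2:ℝ) with hs
  have hs1 : 1 ≤ s := Real.one_le_rpow hy (by norm_num)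
  have hs0 : 0 < s := by linarith
  have hss : s * s = y := by rw [hs, ← Real.rpow_add hy0]; norm_num
  set u := ⌊s⌋₊ with hu
  obtain ⟨u1, u2, u3⟩ := floor_half hs1
  rw [← hu] at u1 u2 u3
  have hu0 : (0:ℝ) < u := by exact_mod_cast u1
  set E : ℝ := y ^ (1/2-β) with hE
  have hE0 : 0 < E := by positivity
  have hyb : ∀ t : ℝ, s ^ t = y ^ (t/2) := by
    intro t; rw [hs, ← Real.rpow_mul hy0.le]; ring_nf
  have key : ∑ n ∈ Ioc 0 x, rr χ n * (n:ℝ) ^ (-β) =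
      ∑ d ∈ Ioc 0 u, ∑ e ∈ Ioc 0 (x / d), (χ d * (d:ℝ) ^ (-β)) * (e:ℝ) ^ (-β)
        + ∑ e ∈ Ioc 0 (x / u), ∑ d ∈ Ioc u (x / e), (χ d * (d:ℝ) ^ (-β)) * (e:ℝ) ^ (-β) := by
    rw [← hyp_sum (fun d e => (χ d * (d:ℝ) ^ (-β)) * (e:ℝ) ^ (-β)) x u u1]
    exact Finset.sum_congr rfl fun n _ => rr_weighted χ β n
  -- the negative power of u
  have hub : (u:ℝ) ^ (-β) ≤ 2 * y ^ (-β/2) := by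
    have := rpow_neg_half hu0 hs0 u3 hβ0.le h1.le
    rwa [hyb] at this
  have hub1 : (u:ℝ) ^ (-(1:ℝ)) ≤ 2 * y ^ (-(1:ℝ)/2) := by
    have := rpow_neg_half hu0 hs0 u3 zero_le_one le_rfl
    rwa [hyb] at this
  have hM0 : 0 < M := by linarith
  -- second sum
  have hsec : |∑ e ∈ Ioc 0 (x / u), ∑ d ∈ Ioc u (x / e), (χ d * (d:ℝ) ^ (-β)) * (e:ℝ) ^ (-β)|
      ≤ 8 * (M / (1-β)) * E := by
    have hin : ∀ e ∈ Ioc 0 (x/u), |∑ d ∈ Ioc u (x / e), (χ d * (d:ℝ) ^ (-β)) * (e:ℝ) ^ (-β)|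
        ≤ 4 * M * y ^ (-β/2) * (e:ℝ) ^ (-β) := by
      intro e he
      rw [← Finset.sum_mul, abs_mul, abs_of_nonneg (show (0:ℝ) ≤ (e:ℝ) ^ (-β) by positivity)]
      gcongr
      rcases le_total u (x/e) with hle | hle
      · refine (h.abel hβ0.le u1 hle).trans ?_
        calc 2 * M * (u:ℝ) ^ (-β) ≤ 2 * M * (2 * y ^ (-β/2)) := by gcongr
          _ = _ := by ring
      · rw [Finset.Ioc_eq_empty_of_le hle]; simp only [sum_empty, abs_zero]; positivity
    refine (Finset.abs_sum_le_sum_abs _ _).trans ((Finset.sum_le_sum hin).trans ?_)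
    rw [← Finset.mul_sum]
    have hz : ∑ e ∈ Ioc 0 (x/u), (e:ℝ) ^ (-β) ≤ 2 * y ^ ((1-β)/2) / (1-β) := by
      refine (ZS_le hβ0 h1 (x/u)).trans ?_
      gcongr
      have hxu : ((x/u:ℕ):ℝ) ≤ 2 * s := by
        refine Nat.cast_div_le.trans ?_
        rw [div_le_iff₀ hu0]
        have : (x:ℝ) ≤ y := Nat.floor_le hy0.le
        nlinarith
      calc ((x/u:ℕ):ℝ) ^ (1-β) ≤ (2*s) ^ (1-β) := by gcongr
        _ = 2 ^ (1-β) * s ^ (1-β) := by rw [Real.mul_rpow (by norm_num) hs0.le]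
        _ ≤ 2 ^ (1:ℝ) * s ^ (1-β) := by gcongr; norm_num; linarith
        _ = 2 * y ^ ((1-β)/2) := by rw [hyb, Real.rpow_one]
    calc 4 * M * y ^ (-β/2) * ∑ e ∈ Ioc 0 (x/u), (e:ℝ) ^ (-β)
        ≤ 4 * M * y ^ (-β/2) * (2 * y ^ ((1-β)/2) / (1-β)) := by gcongr
      _ = 8 * (M/(1-β)) * (y ^ (-β/2) * y ^ ((1-β)/2)) := by ring
      _ = _ := by rw [← Real.rpow_add hy0, hE]; ring_nf
  -- first sum
  have hfirst : ∑ d ∈ Ioc 0 u, ∑ e ∈ Ioc 0 (x / d), (χ d * (d:ℝ) ^ (-β)) * (e:ℝ) ^ (-β)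
      = ∑ d ∈ Ioc 0 u, (χ d * (d:ℝ) ^ (-β)) * (ZS β (x/d) - (y/d) ^ (1-β)/(1-β) - Z)
        + y ^ (1-β) / (1-β) * PS χ 1 u + Z * PS χ β u := by
    unfold PS ZS
    rw [Finset.mul_sum, Finset.mul_sum, ← Finset.sum_add_distrib, ← Finset.sum_add_distrib]
    refine Finset.sum_congr rfl fun d hd => ?_
    have hd0 : (0:ℝ) < d := by exact_mod_cast (Finset.mem_Ioc.1 hd).1
    rw [← Finset.mul_sum, Real.div_rpow hy0.le hd0.le]
    have : (d:ℝ) ^ (-β) / (d:ℝ) ^ (1-β) = (d:ℝ) ^ (-(1:ℝ)) := by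
      rw [← Real.rpow_sub hd0]; ring_nf
    rw [← this]
    ring
  have herr : |∑ d ∈ Ioc 0 u, (χ d * (d:ℝ) ^ (-β)) * (ZS β (x/d) - (y/d) ^ (1-β)/(1-β) - Z)|
      ≤ 2 * E := by
    have hin : ∀ d ∈ Ioc 0 u, |(χ d * (d:ℝ) ^ (-β)) * (ZS β (x/d) - (y/d) ^ (1-β)/(1-β) - Z)|
        ≤ 2 * y ^ (-β) := by
      intro d hd
      rw [Finset.mem_Ioc] at hd
      have hd0 : (0:ℝ) < d := by exact_mod_cast hd.1
      have hdu : (d:ℝ) ≤ u := by exact_mod_cast hd.2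
      have hdy : 1 ≤ y / d := by
        rw [le_div_iff₀ hd0]
        nlinarith
      have h3 := hZ (y/d) hdy
      rw [Nat.floor_div_natCast] at h3
      rw [abs_mul, abs_mul, abs_of_nonneg (show (0:ℝ) ≤ (d:ℝ) ^ (-β) by positivity)]
      calc |χ d| * (d:ℝ) ^ (-β) * |ZS β (x/d) - (y/d) ^ (1-β)/(1-β) - Z|
          ≤ 1 * (d:ℝ) ^ (-β) * (2 * (y/d) ^ (-β)) := by gcongr; exact hχ d
        _ = 2 * y ^ (-β) := by
          rw [Real.div_rpow hy0.le hd0.le]; field_simp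
    refine (Finset.abs_sum_le_sum_abs _ _).trans ((Finset.sum_le_sum hin).trans ?_)
    rw [Finset.sum_const, Nat.card_Ioc, nsmul_eq_mul, Nat.sub_zero]
    calc (u:ℝ) * (2 * y ^ (-β)) ≤ s * (2 * y ^ (-β)) := by gcongr
      _ = 2 * (y ^ (1/2:ℝ) * y ^ (-β)) := by rw [hs]; ring
      _ = _ := by rw [← Real.rpow_add hy0, hE]; ring_nf
  have hA : |y ^ (1-β) / (1-β) * PS χ 1 u - Lv χ 1 / (1-β) * y ^ (1-β)| ≤ 4 * (M/(1-β)) * E := by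
    have e1 : y ^ (1-β) / (1-β) * PS χ 1 u - Lv χ 1 / (1-β) * y ^ (1-β)
      = y ^ (1-β) / (1-β) * (PS χ 1 u - Lv χ 1) := by ring
    rw [e1, abs_mul, abs_of_nonneg (show (0:ℝ) ≤ y ^ (1-β) / (1-β) by positivity)]
    calc y ^ (1-β) / (1-β) * |PS χ 1 u - Lv χ 1|
        ≤ y ^ (1-β) / (1-β) * (2 * M * (2 * y ^ (-(1:ℝ)/2))) := by
          gcongr; exact (h.tail one_pos u1).trans (by gcongr)
      _ = 4 * (M/(1-β)) * (y ^ (1-β) * y ^ (-(1:ℝ)/2)) := by ring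
      _ = _ := by rw [← Real.rpow_add hy0, hE]; ring_nf
  have hB : |Z * PS χ β u - Z * Lv χ β| ≤ 4 * (M/(1-β)) * E := by
    rw [← mul_sub, abs_mul]
    calc |Z| * |PS χ β u - Lv χ β| ≤ 1/(1-β) * (2 * M * (2 * y ^ (-β/2))) := by
          gcongr; exact (h.tail hβ0 u1).trans (by gcongr)
      _ = 4 * (M/(1-β)) * y ^ (-β/2) := by ring
      _ ≤ _ := by
        refine mul_le_mul_of_nonneg_left ?_ (by positivity)
        exact Real.rpow_le_rpow_of_exponent_le hy (by linarith)
  have hE2 : 2 * E ≤ 4 * (M/(1-β)) * E := by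
    gcongr
    have : 1 ≤ M/(1-β) := by rw [le_div_iff₀ hη]; linarith
    linarith
  rw [key, hfirst]
  have k1 := abs_le.1 hsec
  have k2 := abs_le.1 herr
  have k3 := abs_le.1 hA
  have k4 := abs_le.1 hB
  rw [abs_le]
  constructor <;> linarith

/-- Dirichlet convolution. -/
noncomputable def cv (χ ψ : ℕ → ℝ) (n : ℕ) : ℝ := ∑ z ∈ n.divisorsAntidiagonal, χ z.1 * ψ z.2

lemma BP.Ioc_bound {χ : ℕ → ℝ} {M : ℝ} (h : BP χ M) (a b : ℕ) : |∑ n ∈ Ioc a b, χ n| ≤ 2 * M := by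
  rcases le_total a b with hab | hab
  · have h1 := Finset.sum_Ioc_consecutive χ (Nat.zero_le a) hab
    have h2 := abs_le.1 (h a)
    have h3 := abs_le.1 (h b)
    rw [abs_le]; constructor <;> linarith
  · rw [Finset.Ioc_eq_empty_of_le hab]; simpa using h.nonneg

lemma sqrt_facts {N : ℕ} (hN : 1 ≤ N) : 1 ≤ N.sqrt ∧ (N.sqrt : ℝ) ≤ √N ∧ √N ≤ 2 * (N.sqrt : ℝ) ∧
    ((N / N.sqrt : ℕ) : ℝ) ≤ 2 * √N := by
  have h1 : 1 ≤ N.sqrt := Nat.le_sqrt.2 (by simpa using hN)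
  have h1' : (1:ℝ) ≤ N.sqrt := by exact_mod_cast h1
  have h2 : (N.sqrt : ℝ) ≤ √N := by
    apply Real.le_sqrt_of_sq_le
    exact_mod_cast Nat.sqrt_le' N
  have h3 : √N ≤ 2 * (N.sqrt : ℝ) := by
    have : √(N:ℝ) ≤ N.sqrt + 1 := by
      rw [Real.sqrt_le_left (by positivity)]
      exact_mod_cast (Nat.lt_succ_sqrt' N).le
    linarith
  refine ⟨h1, h2, h3, Nat.cast_div_le.trans ?_⟩
  rw [div_le_iff₀ (by linarith)]
  have := Real.mul_self_sqrt (show (0:ℝ) ≤ N by positivity)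
  nlinarith [Real.sqrt_nonneg (N:ℝ)]

lemma cv_partial {χ ψ : ℕ → ℝ} {M : ℝ} (h : BP χ M) (h' : BP ψ M) (hχ : ∀ n, |χ n| ≤ 1)
    (hψ : ∀ n, |ψ n| ≤ 1) (N : ℕ) (hN : 1 ≤ N) :
    |∑ n ∈ Ioc 0 N, cv χ ψ n| ≤ 5 * M * (N:ℝ) ^ (1/2:ℝ) := by
  obtain ⟨u1, u2, u3, u4⟩ := sqrt_facts hN
  have hM := h.nonneg
  unfold cv
  rw [hyp_sum (fun d e => χ d * ψ e) N N.sqrt u1, ← Real.sqrt_eq_rpow]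
  have k1 : |∑ d ∈ Ioc 0 N.sqrt, ∑ e ∈ Ioc 0 (N / d), χ d * ψ e| ≤ M * √N := by
    refine (Finset.abs_sum_le_sum_abs _ _).trans ?_
    have : ∀ d ∈ Ioc 0 N.sqrt, |∑ e ∈ Ioc 0 (N / d), χ d * ψ e| ≤ M := by
      intro d _
      rw [← Finset.mul_sum, abs_mul]
      calc _ ≤ 1 * M := by gcongr; exacts [hχ d, h' _]
        _ = M := one_mul M
    refine (Finset.sum_le_sum this).trans ?_
    rw [Finset.sum_const, Nat.card_Ioc, nsmul_eq_mul, Nat.sub_zero, mul_comm]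
    gcongr
  have k2 : |∑ e ∈ Ioc 0 (N / N.sqrt), ∑ d ∈ Ioc N.sqrt (N / e), χ d * ψ e| ≤ 4 * M * √N := by
    refine (Finset.abs_sum_le_sum_abs _ _).trans ?_
    have : ∀ e ∈ Ioc 0 (N / N.sqrt), |∑ d ∈ Ioc N.sqrt (N / e), χ d * ψ e| ≤ 2 * M := by
      intro e _
      rw [← Finset.sum_mul, abs_mul]
      calc _ ≤ 2 * M * 1 := by gcongr; exacts [h.Ioc_bound _ _, hψ e]
        _ = 2 * M := mul_one _
    refine (Finset.sum_le_sum this).trans ?_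
    rw [Finset.sum_const, Nat.card_Ioc, nsmul_eq_mul, Nat.sub_zero]
    calc _ ≤ 2 * √N * (2 * M) := by gcongr
      _ = _ := by ring
  refine (abs_add_le _ _).trans ?_
  linarith

lemma Lv_one_crude {χ : ℕ → ℝ} {M : ℝ} (h : BP χ M) (hM : 1 ≤ M) (hχ : ∀ n, |χ n| ≤ 1) :
    |Lv χ 1| ≤ 3 * M := by
  have h1 := h.tail one_pos (le_refl 1)
  have h2 : PS χ 1 1 = χ 1 := by simp [PS]
  rw [h2] at h1
  simp only [Nat.cast_one, Real.one_rpow] at h1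
  have h3 := abs_le.1 h1
  have h4 := abs_le.1 (hχ 1)
  rw [abs_le]; constructor <;> linarith

lemma sum_inv_le (N : ℕ) : ∑ n ∈ Ioc 0 N, (n:ℝ)⁻¹ ≤ 1 + Real.log N := by
  have h1 := harmonic_le_one_add_log N
  rw [harmonic_eq_sum_Icc] at h1
  push_cast at h1
  have e : Ioc 0 N = Icc 1 N := by
    ext x; simp only [mem_Ioc, mem_Icc]; omega
  rw [e]; exact h1

lemma Lv_one_log {χ : ℕ → ℝ} {M : ℝ} (h : BP χ M) (hM : 1 ≤ M) (hχ : ∀ n, |χ n| ≤ 1) :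
    |Lv χ 1| ≤ 5 + Real.log M := by
  obtain ⟨f1, f2, f3⟩ := floor_half hM
  have h1 := h.tail one_pos f1
  have hN0 : (0:ℝ) < ⌊M⌋₊ := by exact_mod_cast f1
  have h2 : 2 * M * (⌊M⌋₊:ℝ) ^ (-(1:ℝ)) ≤ 4 := by
    rw [Real.rpow_neg_one, ← div_eq_mul_inv, div_le_iff₀ hN0]; linarith
  have h3 : |PS χ 1 ⌊M⌋₊| ≤ 1 + Real.log M := by
    unfold PS
    refine (Finset.abs_sum_le_sum_abs _ _).trans ?_
    have : ∀ n ∈ Ioc 0 ⌊M⌋₊, |χ n * (n:ℝ) ^ (-(1:ℝ))| ≤ (n:ℝ)⁻¹ := by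
      intro n _
      rw [Real.rpow_neg_one, abs_mul, abs_of_nonneg (show (0:ℝ) ≤ (n:ℝ)⁻¹ by positivity)]
      calc _ ≤ 1 * (n:ℝ)⁻¹ := by gcongr; exact hχ n
        _ = _ := one_mul _
    refine (Finset.sum_le_sum this).trans ((sum_inv_le _).trans ?_)
    have := Real.log_le_log hN0 f2
    linarith
  have h4 := abs_le.1 h1
  have h5 := abs_le.1 h3
  rw [abs_le]; constructor <;> linarith

lemma cv_weighted (χ ψ : ℕ → ℝ) (β : ℝ) (n : ℕ) : cv χ ψ n * (n:ℝ) ^ (-β) =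
    ∑ z ∈ n.divisorsAntidiagonal, (χ z.1 * (z.1:ℝ) ^ (-β)) * (ψ z.2 * (z.2:ℝ) ^ (-β)) := by
  unfold cv
  rw [Finset.sum_mul]
  refine Finset.sum_congr rfl fun z hz => ?_
  rw [Nat.mem_divisorsAntidiagonal] at hz
  rw [← hz.1]; push_cast
  rw [Real.mul_rpow (by positivity) (by positivity)]; ring

lemma cv_one {χ ψ : ℕ → ℝ} {M : ℝ} (h : BP χ M) (h' : BP ψ M) (hM : 1 ≤ M) (hχ : ∀ n, |χ n| ≤ 1)
    (hψ : ∀ n, |ψ n| ≤ 1) (N : ℕ) (hN : 1 ≤ N) :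
    |PS (cv χ ψ) 1 N - Lv χ 1 * Lv ψ 1| ≤ 32 * M ^ 2 * (N:ℝ) ^ (-(1/4:ℝ)) := by
  obtain ⟨u1, u2, u3, u4⟩ := sqrt_facts hN
  set w := N.sqrt with hw
  have hN0 : (0:ℝ) < N := by exact_mod_cast hN
  have hN1 : (1:ℝ) ≤ N := by exact_mod_cast hN
  have hw0 : (0:ℝ) < w := by exact_mod_cast u1
  have hs0 : 0 < √(N:ℝ) := Real.sqrt_pos.2 hN0
  have hss := Real.mul_self_sqrt hN0.le
  set q : ℝ := (N:ℝ) ^ (-(1/4:ℝ)) with hq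
  have hq0 : 0 < q := by positivity
  -- inverse sqrt
  have hinv : (√(N:ℝ))⁻¹ ≤ q := by
    rw [Real.sqrt_eq_rpow, ← Real.rpow_neg hN0.le]
    exact Real.rpow_le_rpow_of_exponent_le hN1 (by norm_num)
  have hwinv : (w:ℝ)⁻¹ ≤ 2 * (√(N:ℝ))⁻¹ := by
    rw [← div_eq_mul_inv, inv_eq_one_div, div_le_div_iff₀ hw0 hs0]; linarith
  have key : PS (cv χ ψ) 1 N =
      ∑ d ∈ Ioc 0 w, ∑ e ∈ Ioc 0 (N / d), (χ d * (d:ℝ) ^ (-(1:ℝ))) * (ψ e * (e:ℝ) ^ (-(1:ℝ)))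
        + ∑ e ∈ Ioc 0 (N / w), ∑ d ∈ Ioc w (N / e),
          (χ d * (d:ℝ) ^ (-(1:ℝ))) * (ψ e * (e:ℝ) ^ (-(1:ℝ))) := by
    rw [← hyp_sum (fun d e => (χ d * (d:ℝ) ^ (-(1:ℝ))) * (ψ e * (e:ℝ) ^ (-(1:ℝ)))) N w u1]
    unfold PS
    exact Finset.sum_congr rfl fun n _ => cv_weighted χ ψ 1 n
  have hfirst : ∑ d ∈ Ioc 0 w, ∑ e ∈ Ioc 0 (N / d),
        (χ d * (d:ℝ) ^ (-(1:ℝ))) * (ψ e * (e:ℝ) ^ (-(1:ℝ)))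
      = ∑ d ∈ Ioc 0 w, (χ d * (d:ℝ) ^ (-(1:ℝ))) * (PS ψ 1 (N/d) - Lv ψ 1) + PS χ 1 w * Lv ψ 1 := by
    unfold PS
    rw [Finset.sum_mul, ← Finset.sum_add_distrib]
    refine Finset.sum_congr rfl fun d hd => ?_
    rw [← Finset.mul_sum]; ring
  have hM0 : 0 < M := by linarith
  have k1 : |∑ d ∈ Ioc 0 w, (χ d * (d:ℝ) ^ (-(1:ℝ))) * (PS ψ 1 (N/d) - Lv ψ 1)| ≤ 4 * M * q := by
    have hin : ∀ d ∈ Ioc 0 w, |(χ d * (d:ℝ) ^ (-(1:ℝ))) * (PS ψ 1 (N/d) - Lv ψ 1)| ≤ 4 * M / N := by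
      intro d hd
      rw [Finset.mem_Ioc] at hd
      have hd0 : (0:ℝ) < d := by exact_mod_cast hd.1
      have hdw : (d:ℝ) ≤ w := by exact_mod_cast hd.2
      have hdN : 1 ≤ (N:ℝ) / d := by
        rw [le_div_iff₀ hd0]
        have : √(N:ℝ) ≤ N := by nlinarith [Real.one_le_sqrt.2 hN1]
        linarith
      obtain ⟨f1, f2, f3⟩ := floor_half hdN
      rw [Nat.floor_div_natCast, Nat.floor_natCast] at f1 f2 f3
      have hf0 : (0:ℝ) < ((N/d:ℕ):ℝ) := by exact_mod_cast f1
      have ht := h'.tail one_pos f1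
      rw [Real.rpow_neg_one] at ht
      have hi : (((N/d:ℕ):ℝ))⁻¹ ≤ 2 * d / N := by
        rw [inv_eq_one_div, div_le_div_iff₀ hf0 hN0]
        rw [div_le_iff₀ hd0] at f3
        linarith
      rw [abs_mul, abs_mul, Real.rpow_neg_one, abs_of_nonneg (show (0:ℝ) ≤ (d:ℝ)⁻¹ by positivity)]
      calc _ ≤ 1 * (d:ℝ)⁻¹ * (2 * M * (2 * d / N)) := by
            gcongr
            · exact hχ d
            · exact ht.trans (by gcongr)
        _ = 4 * M / N := by field_simp; ring
    refine (Finset.abs_sum_le_sum_abs _ _).trans ((Finset.sum_le_sum hin).trans ?_)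
    rw [Finset.sum_const, Nat.card_Ioc, nsmul_eq_mul, Nat.sub_zero]
    calc (w:ℝ) * (4 * M / N) ≤ √N * (4 * M / N) := by gcongr
      _ = 4 * M * (√(N:ℝ))⁻¹ := by
        rw [← hss]; field_simp; 
        rw [Real.sqrt_sq hs0.le]
      _ ≤ _ := by gcongr
  have k2 : |PS χ 1 w * Lv ψ 1 - Lv χ 1 * Lv ψ 1| ≤ 12 * M ^ 2 * q := by
    rw [← sub_mul, abs_mul]
    have ht := h.tail one_pos u1
    rw [Real.rpow_neg_one] at ht
    calc _ ≤ (2 * M * (2 * q)) * (3 * M) := by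
          gcongr
          · refine ht.trans ?_
            gcongr; linarith
          · exact Lv_one_crude h' hM hψ
      _ = _ := by ring
  have k3 : |∑ e ∈ Ioc 0 (N / w), ∑ d ∈ Ioc w (N / e),
          (χ d * (d:ℝ) ^ (-(1:ℝ))) * (ψ e * (e:ℝ) ^ (-(1:ℝ)))| ≤ 16 * M * q := by
    have hin : ∀ e ∈ Ioc 0 (N/w), |∑ d ∈ Ioc w (N / e),
          (χ d * (d:ℝ) ^ (-(1:ℝ))) * (ψ e * (e:ℝ) ^ (-(1:ℝ)))|
        ≤ 4 * M * (√(N:ℝ))⁻¹ * (e:ℝ) ^ (-(1/2:ℝ)) := by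
      intro e he
      have he1 : (1:ℝ) ≤ e := by exact_mod_cast (Finset.mem_Ioc.1 he).1
      rw [← Finset.sum_mul, abs_mul]
      gcongr
      · rcases le_total w (N/e) with hle | hle
        · refine (h.abel zero_le_one u1 hle).trans ?_
          rw [Real.rpow_neg_one]
          calc 2 * M * (w:ℝ)⁻¹ ≤ 2 * M * (2 * (√(N:ℝ))⁻¹) := by gcongr
            _ = _ := by ring
        · rw [Finset.Ioc_eq_empty_of_le hle]; simp only [sum_empty, abs_zero]; positivity
      · rw [abs_mul, abs_of_nonneg (show (0:ℝ) ≤ (e:ℝ) ^ (-(1:ℝ)) by positivity)]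
        calc _ ≤ 1 * (e:ℝ) ^ (-(1/2:ℝ)) := by
              gcongr
              · exact hψ e
              · norm_num
          _ = _ := one_mul _
    refine (Finset.abs_sum_le_sum_abs _ _).trans ((Finset.sum_le_sum hin).trans ?_)
    rw [← Finset.mul_sum]
    have hz : ∑ e ∈ Ioc 0 (N/w), (e:ℝ) ^ (-(1/2:ℝ)) ≤ 4 * (N:ℝ) ^ (1/4:ℝ) := by
      refine (ZS_le (by norm_num) (by norm_num) (N/w)).trans ?_
      norm_num only
      calc ((N/w:ℕ):ℝ) ^ (1/2:ℝ) / (1/2) ≤ (2*√N) ^ (1/2:ℝ) / (1/2) := by gcongr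
        _ = 2 * (2 ^ (1/2:ℝ) * (N:ℝ) ^ (1/4:ℝ)) := by
          rw [Real.mul_rpow (by norm_num) hs0.le, Real.sqrt_eq_rpow, ← Real.rpow_mul hN0.le]
          norm_num; ring
        _ ≤ 2 * (2 ^ (1:ℝ) * (N:ℝ) ^ (1/4:ℝ)) := by gcongr <;> norm_num
        _ = _ := by rw [Real.rpow_one]; ring
    calc _ ≤ 4 * M * (√(N:ℝ))⁻¹ * (4 * (N:ℝ) ^ (1/4:ℝ)) := by gcongr
      _ = 16 * M * ((√(N:ℝ))⁻¹ * (N:ℝ) ^ (1/4:ℝ)) := by ring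
      _ = _ := by
        rw [Real.sqrt_eq_rpow, ← Real.rpow_neg hN0.le, ← Real.rpow_add hN0, hq]; norm_num
  rw [key, hfirst]
  have b1 := abs_le.1 k1
  have b2 := abs_le.1 k2
  have b3 := abs_le.1 k3
  have hMM : M * q ≤ M ^ 2 * q := by gcongr; nlinarith
  rw [abs_le]
  constructor <;> linarith

lemma Lv_le_sum_rr {χ : ℕ → ℝ} {M : ℝ} (h : BP χ M) (hχ : ∀ n, |χ n| ≤ 1) (x u : ℕ) (hu : 1 ≤ u) :
    |∑ n ∈ Ioc 0 x, rr χ n - x * Lv χ 1| ≤ u + 4 * M * x / u := by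
  have hu0 : (0:ℝ) < u := by exact_mod_cast hu
  have hM := h.nonneg
  have key : ∑ n ∈ Ioc 0 x, rr χ n = ∑ d ∈ Ioc 0 u, ∑ e ∈ Ioc 0 (x / d), χ d
        + ∑ e ∈ Ioc 0 (x / u), ∑ d ∈ Ioc u (x / e), χ d := hyp_sum (fun d _ => χ d) x u hu
  have k1 : |∑ d ∈ Ioc 0 u, ∑ e ∈ Ioc 0 (x / d), χ d - x * PS χ 1 u| ≤ u := by
    unfold PS
    rw [Finset.mul_sum, ← Finset.sum_sub_distrib]
    have : ∀ d ∈ Ioc 0 u, |∑ e ∈ Ioc 0 (x / d), χ d - x * (χ d * (d:ℝ) ^ (-(1:ℝ)))| ≤ 1 := by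
      intro d hd
      have hd0 : 0 < d := (Finset.mem_Ioc.1 hd).1
      rw [Finset.sum_const, Nat.card_Ioc, nsmul_eq_mul, Nat.sub_zero, Real.rpow_neg_one]
      have e : ((x/d:ℕ):ℝ) * χ d - x * (χ d * (d:ℝ)⁻¹) = χ d * (((x/d:ℕ):ℝ) - x / d) := by ring
      rw [e, abs_mul]
      have h1 : ((x/d:ℕ):ℝ) ≤ (x:ℝ)/d := Nat.cast_div_le
      have h2 : (x:ℝ)/d ≤ ((x/d:ℕ):ℝ) + 1 := by
        have := Nat.lt_floor_add_one ((x:ℝ)/d)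
        rw [Nat.floor_div_natCast, Nat.floor_natCast] at this
        exact this.le
      calc _ ≤ (1:ℝ) * 1 := by
            gcongr
            · exact hχ d
            · rw [abs_le]; constructor <;> linarith
        _ = 1 := one_mul 1
    refine (Finset.abs_sum_le_sum_abs _ _).trans ((Finset.sum_le_sum this).trans ?_)
    simp
  have k2 : |∑ e ∈ Ioc 0 (x / u), ∑ d ∈ Ioc u (x / e), χ d| ≤ 2 * M * x / u := by
    refine (Finset.abs_sum_le_sum_abs _ _).trans ((Finset.sum_le_sum
      (fun e _ => h.Ioc_bound _ _)).trans ?_)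
    rw [Finset.sum_const, Nat.card_Ioc, nsmul_eq_mul, Nat.sub_zero]
    calc _ ≤ (x:ℝ) / u * (2 * M) := by gcongr; exact Nat.cast_div_le
      _ = _ := by ring
  have k3 : |x * PS χ 1 u - x * Lv χ 1| ≤ 2 * M * x / u := by
    rw [← mul_sub, abs_mul, abs_of_nonneg (show (0:ℝ) ≤ x by positivity)]
    have := h.tail one_pos hu
    rw [Real.rpow_neg_one] at this
    calc _ ≤ (x:ℝ) * (2 * M * (u:ℝ)⁻¹) := by gcongr
      _ = _ := by ring
  have b1 := abs_le.1 k1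
  have b2 := abs_le.1 k2
  have b3 := abs_le.1 k3
  have e : 4 * M * x / u = 2 * M * x / u + 2 * M * x / u := by ring
  rw [key, e, abs_le]
  constructor <;> linarith

lemma periodic_BP (F : ℕ → ℝ) (N : ℕ) (hN : 0 < N) (hper : ∀ n, F (n + N) = F n)
    (hsum : ∑ n ∈ range N, F n = 0) (hF : ∀ n, |F n| ≤ 1) : BP F N := by
  have hblock : ∀ K, ∑ n ∈ Ioc K (K + N), F n = 0 := by
    intro K
    induction K with
    | zero =>
      have e : Ioc 0 (0 + N) = (range N).image (fun n => n + 1) := by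
        ext x; simp only [mem_Ioc, mem_image, mem_range]
        constructor
        · intro h; exact ⟨x - 1, by omega, by omega⟩
        · rintro ⟨a, h1, h2⟩; omega
      rw [e, Finset.sum_image (by intro a _ b _ h; simpa using h)]
      have h1 := Finset.sum_range_succ' F N
      have h2 := Finset.sum_range_succ F N
      have h3 := hper 0
      rw [zero_add] at h3
      linarith
    | succ K ih =>
      have h1 := Finset.sum_Ioc_consecutive F (show K ≤ K + 1 by omega) (show K + 1 ≤ K + 1 + N by omega)
      have h2 := sum_Ioc_succ F (show K ≤ K + N by omega)
      have h3 : ∑ n ∈ Ioc K (K+1), F n = F (K+1) := by simp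
      have h4 := hper (K+1)
      have e : K + 1 + N = K + N + 1 := by ring
      rw [e] at h1 h4 ⊢
      linarith
  intro K
  induction K using Nat.strong_induction_on with
  | _ K ih =>
    rcases lt_or_ge K N with h | h
    · refine (Finset.abs_sum_le_sum_abs _ _).trans ((Finset.sum_le_sum (fun n _ => hF n)).trans ?_)
      simp only [sum_const, Nat.card_Ioc, nsmul_eq_mul, mul_one, Nat.sub_zero]
      exact_mod_cast h.le
    · have h1 := Finset.sum_Ioc_consecutive F (Nat.zero_le (K - N)) (show K - N ≤ K by omega)
      have h2 := hblock (K - N)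
      rw [Nat.sub_add_cancel h] at h2
      rw [← h1, h2, add_zero]
      exact ih (K - N) (by omega)

lemma sum_range_zmod (N : ℕ) [NeZero N] (G : ZMod N → ℝ) :
    ∑ n ∈ range N, G (n : ZMod N) = ∑ a : ZMod N, G a := by
  refine Finset.sum_bij' (fun n _ => (n : ZMod N)) (fun a _ => a.val) ?_ ?_ ?_ ?_ ?_
  · intros; simp
  · intro a _; simpa using ZMod.val_lt a
  · intro n hn; simpa using ZMod.val_cast_of_lt (by simpa using hn)
  · intro a _; simp
  · intros; rfl

/-- The quadratic character mod `p` as a real function. -/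
noncomputable def chi (p : ℕ) [Fact p.Prime] (n : ℕ) : ℝ := ((legendreSym p n : ℤ) : ℝ)

section
variable (p : ℕ) [Fact p.Prime]

lemma chi_one : chi p 1 = 1 := by simp [chi]

lemma chi_zero : chi p 0 = 0 := by simp [chi]

lemma chi_mul (m n : ℕ) : chi p (m * n) = chi p m * chi p n := by
  simp [chi, legendreSym.mul]

lemma chi_pow (m n : ℕ) : chi p (m ^ n) = chi p m ^ n := by
  induction n with
  | zero => simp [chi_one]
  | succ n ih => rw [pow_succ, chi_mul, ih, pow_succ]

lemma chi_trichotomy (n : ℕ) : chi p n = 0 ∨ chi p n = 1 ∨ chi p n = -1 := by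
  unfold chi
  by_cases h : ((n : ℤ) : ZMod p) = 0
  · left; rw [(legendreSym.eq_zero_iff p n).2 h]; simp
  · rcases legendreSym.eq_one_or_neg_one p h with h | h
    · right; left; rw [h]; simp
    · right; right; rw [h]; simp

lemma chi_abs (n : ℕ) : |chi p n| ≤ 1 := by
  rcases chi_trichotomy p n with h | h | h <;> rw [h] <;> norm_num

lemma chi_eq (n : ℕ) : chi p n = ((quadraticChar (ZMod p) (n : ZMod p) : ℤ) : ℝ) := by
  simp [chi, legendreSym]

lemma chi_periodic (n k : ℕ) : chi p (n + k * p) = chi p n := by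
  rw [chi_eq, chi_eq]; simp

lemma quad_sum_zero (hp : p ≠ 2) :
    ∑ a : ZMod p, ((quadraticChar (ZMod p) a : ℤ) : ℝ) = 0 := by
  have := quadraticChar_sum_zero (F := ZMod p) (by rw [ZMod.ringChar_zmod_n]; exact hp)
  exact_mod_cast this

lemma chi_BP (hp : p ≠ 2) : BP (chi p) p := by
  refine periodic_BP _ p (Fact.out : p.Prime).pos (fun n => by simpa using chi_periodic p n 1) ?_
    (chi_abs p)
  simp_rw [chi_eq]
  rw [sum_range_zmod p (fun a => ((quadraticChar (ZMod p) a : ℤ) : ℝ))]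
  exact quad_sum_zero p hp

lemma chi2_BP (q : ℕ) [Fact q.Prime] (hp : p ≠ 2) (hpq : p ≠ q) :
    BP (fun n => chi p n * chi q n) ((p * q : ℕ) : ℝ) := by
  have hp' := (Fact.out : p.Prime)
  have hq' := (Fact.out : q.Prime)
  have hco : p.Coprime q := (Nat.coprime_primes hp' hq').2 hpq
  have : NeZero (p * q) := ⟨(Nat.mul_pos hp'.pos hq'.pos).ne'⟩
  refine periodic_BP _ (p*q) (Nat.mul_pos hp'.pos hq'.pos) (fun n => ?_) ?_ (fun n => ?_)
  · rw [chi_periodic q n p, mul_comm p q, chi_periodic p n q]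
  · have e : ∀ n : ℕ, chi p n * chi q n = (fun a : ZMod (p*q) =>
      ((fun z : ZMod p × ZMod q => ((quadraticChar (ZMod p) z.1 : ℤ) : ℝ) *
        ((quadraticChar (ZMod q) z.2 : ℤ) : ℝ)) (ZMod.chineseRemainder hco a))) (n : ZMod (p*q)) := by
      intro n
      simp only [chi_eq, map_natCast, Prod.fst_natCast, Prod.snd_natCast]
    rw [Finset.sum_congr rfl (fun n _ => e n), sum_range_zmod (p*q) (fun a : ZMod (p*q) =>
      ((fun z : ZMod p × ZMod q => ((quadraticChar (ZMod p) z.1 : ℤ) : ℝ) *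
        ((quadraticChar (ZMod q) z.2 : ℤ) : ℝ)) (ZMod.chineseRemainder hco a)))]
    refine ((ZMod.chineseRemainder hco).toEquiv.sum_comp
      (fun z : ZMod p × ZMod q => ((quadraticChar (ZMod p) z.1 : ℤ) : ℝ) *
        ((quadraticChar (ZMod q) z.2 : ℤ) : ℝ))).trans ?_
    rw [Fintype.sum_prod_type]
    simp_rw [← Finset.mul_sum]
    rw [← Finset.sum_mul, quad_sum_zero p hp, zero_mul]
  · rw [abs_mul]
    calc _ ≤ (1:ℝ) * 1 := by gcongr; exacts [chi_abs p n, chi_abs q n]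
      _ = 1 := one_mul 1

/-- arithmetic function version -/
noncomputable def chiA : ArithmeticFunction ℝ := ⟨chi p, chi_zero p⟩

lemma chiA_apply (n : ℕ) : chiA p n = chi p n := rfl

lemma chiA_mult : (chiA p).IsMultiplicative :=
  ⟨chi_one p, fun {m n} _ => chi_mul p m n⟩

/-- `1 * χ` as an arithmetic function -/
noncomputable def rA : ArithmeticFunction ℝ := chiA p * (ArithmeticFunction.zeta : ArithmeticFunction ℝ)

lemma rA_mult : (rA p).IsMultiplicative :=
  (chiA_mult p).mul ArithmeticFunction.isMultiplicative_zeta.natCast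

lemma rr_eq (n : ℕ) : rr (chi p) n = rA p n := by
  unfold rr rA
  rw [ArithmeticFunction.mul_apply]
  refine Finset.sum_congr rfl fun z hz => ?_
  rw [Nat.mem_divisorsAntidiagonal] at hz
  have : z.2 ≠ 0 := by rintro h; rw [h] at hz; simp at hz; exact hz.2 hz.1.symm
  simp [chiA_apply, ArithmeticFunction.natCoe_apply, ArithmeticFunction.zeta_apply, this]

lemma rA_prime_pow {q : ℕ} (hq : q.Prime) (k : ℕ) :
    rA p (q ^ k) = ∑ i ∈ range (k+1), chi p q ^ i := by
  rw [← rr_eq]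
  unfold rr
  rw [Nat.sum_divisorsAntidiagonal (fun i _ => chi p i), Nat.sum_divisors_prime_pow hq]
  refine Finset.sum_congr rfl fun i _ => chi_pow p q i

lemma geom_neg_one (k : ℕ) : ∑ i ∈ range (k+1), (-1:ℝ) ^ i = if Even k then 1 else 0 := by
  rw [neg_one_geom_sum]
  by_cases h : Even k <;> simp [h, Nat.even_add_one]

lemma rA_prime_pow_nonneg {q : ℕ} (hq : q.Prime) (k : ℕ) : 0 ≤ rA p (q ^ k) := by
  rw [rA_prime_pow p hq]
  rcases chi_trichotomy p q with h | h | h <;> rw [h]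
  · exact Finset.sum_nonneg fun i _ => by positivity
  · exact Finset.sum_nonneg fun i _ => by positivity
  · rw [geom_neg_one]; split_ifs <;> norm_num
end

lemma mult_nonneg (f : ArithmeticFunction ℝ) (hf : f.IsMultiplicative)
    (h : ∀ q k : ℕ, q.Prime → 0 ≤ f (q ^ k)) (n : ℕ) : 0 ≤ f n := by
  rcases eq_or_ne n 0 with rfl | hn
  · simp
  · rw [ArithmeticFunction.IsMultiplicative.multiplicative_factorization f hf hn]
    exact Finset.prod_nonneg fun q hq => h q _ (Nat.prime_of_mem_primeFactors hq)

lemma rr_nonneg (p : ℕ) [Fact p.Prime] (n : ℕ) : 0 ≤ rr (chi p) n := by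
  rw [rr_eq]
  exact mult_nonneg _ (rA_mult p) (fun q k hq => rA_prime_pow_nonneg p hq k) n

lemma rr_one (p : ℕ) [Fact p.Prime] : rr (chi p) 1 = 1 := by
  simp [rr, chi_one]

/-- the product of two characters times ... -/
noncomputable def hh (p q : ℕ) [Fact p.Prime] [Fact q.Prime] (n : ℕ) : ℝ := chi q n * rr (chi p) n

lemma hh_eq_cv (p q : ℕ) [Fact p.Prime] [Fact q.Prime] (n : ℕ) :
    hh p q n = cv (fun n => chi p n * chi q n) (chi q) n := by
  unfold hh cv rr
  rw [Finset.mul_sum]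
  refine Finset.sum_congr rfl fun z hz => ?_
  rw [Nat.mem_divisorsAntidiagonal] at hz
  rw [← hz.1, chi_mul]; ring

/-- fourfold convolution -/
noncomputable def ff (p q : ℕ) [Fact p.Prime] [Fact q.Prime] (n : ℕ) : ℝ := cv (hh p q) (rr (chi p)) n

noncomputable def hA (p q : ℕ) [Fact p.Prime] [Fact q.Prime] : ArithmeticFunction ℝ :=
  (chiA q).pmul (rA p)

lemma ff_eq (p q : ℕ) [Fact p.Prime] [Fact q.Prime] (n : ℕ) : ff p q n = (hA p q * rA p) n := by
  unfold ff cv hh hA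
  rw [ArithmeticFunction.mul_apply]
  simp [rr_eq, chiA_apply]

lemma hA_eq (p q : ℕ) [Fact p.Prime] [Fact q.Prime] :
    hA p q = ((chiA p).pmul (chiA q)) * chiA q := by
  ext n
  have h1 := hh_eq_cv p q n
  unfold hh cv at h1
  unfold hA
  rw [ArithmeticFunction.mul_apply]
  simp only [ArithmeticFunction.pmul_apply, chiA_apply, ← rr_eq]
  exact h1

lemma ff_symm (p q : ℕ) [Fact p.Prime] [Fact q.Prime] : hA p q * rA p = hA q p * rA q := by
  rw [hA_eq, hA_eq]
  unfold rA
  rw [ArithmeticFunction.pmul_comm (chiA q) (chiA p)]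
  ring

lemma ff_prime_pow_aux (p q : ℕ) [Fact p.Prime] [Fact q.Prime] {l : ℕ} (hl : l.Prime) (k : ℕ)
    (h : 0 ≤ chi q l ∨ (chi p l = -1 ∧ chi q l = -1)) : 0 ≤ (hA p q * rA p) (l ^ k) := by
  rw [ArithmeticFunction.mul_apply]
  refine Finset.sum_nonneg fun z hz => ?_
  rw [Nat.mem_divisorsAntidiagonal] at hz
  obtain ⟨j, hj, e1⟩ := (Nat.dvd_prime_pow hl).1 (Dvd.intro _ hz.1)
  obtain ⟨i, hi, e2⟩ := (Nat.dvd_prime_pow hl).1 (Dvd.intro_left _ hz.1)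
  rw [e1, e2]
  refine mul_nonneg ?_ (rA_prime_pow_nonneg p hl i)
  simp only [hA, ArithmeticFunction.pmul_apply, chiA_apply, chi_pow]
  rcases h with h | ⟨h1, h2⟩
  · exact mul_nonneg (pow_nonneg h j) (rA_prime_pow_nonneg p hl j)
  · rw [rA_prime_pow p hl, h1, geom_neg_one, h2]
    by_cases hj : Even j
    · simp [hj]
    · simp [hj]

lemma ff_nonneg (p q : ℕ) [Fact p.Prime] [Fact q.Prime] (n : ℕ) : 0 ≤ ff p q n := by
  rw [ff_eq]
  refine mult_nonneg _ (((chiA_mult q).pmul (rA_mult p)).mul (rA_mult p)) ?_ n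
  intro l k hl
  rcases chi_trichotomy q l with h | h | h
  · exact ff_prime_pow_aux p q hl k (Or.inl h.ge)
  · exact ff_prime_pow_aux p q hl k (Or.inl (by rw [h]; norm_num))
  · rcases chi_trichotomy p l with h' | h' | h'
    · change 0 ≤ (hA p q * rA p) (l ^ k)
      rw [ff_symm]; exact ff_prime_pow_aux q p hl k (Or.inl h'.ge)
    · change 0 ≤ (hA p q * rA p) (l ^ k)
      rw [ff_symm]; exact ff_prime_pow_aux q p hl k (Or.inl (by rw [h']; norm_num))
    · exact ff_prime_pow_aux p q hl k (Or.inr ⟨h', h⟩)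

lemma ff_one (p q : ℕ) [Fact p.Prime] [Fact q.Prime] : ff p q 1 = 1 := by
  simp [ff, cv, hh, rr_one, chi_one]

lemma Lv_nonneg (p : ℕ) [Fact p.Prime] (hp : p ≠ 2) : 0 ≤ Lv (chi p) 1 := by
  have h := chi_BP p hp
  have key : ∀ u : ℕ, 1 ≤ u → -(Lv (chi p) 1) * u ≤ 1 + 4 * p := by
    intro u hu
    have h1 := Lv_le_sum_rr h (chi_abs p) (u*u) u hu
    have h2 : 0 ≤ ∑ n ∈ Ioc 0 (u*u), rr (chi p) n := Finset.sum_nonneg fun n _ => rr_nonneg p n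
    have h3 := (abs_le.1 h1).2
    have hu0 : (0:ℝ) < u := by exact_mod_cast hu
    have e : 4 * (p:ℝ) * ((u*u : ℕ):ℝ) / u = 4 * p * u := by push_cast; field_simp
    rw [e] at h3
    push_cast at h3
    have h4 : (-(Lv (chi p) 1) * u) * u ≤ (1 + 4 * p) * u := by nlinarith
    exact le_of_mul_le_mul_right h4 hu0
  by_contra hneg
  push Not at hneg
  obtain ⟨u, hu⟩ := exists_nat_gt ((1 + 4 * p) / (-(Lv (chi p) 1)))
  rw [div_lt_iff₀ (by linarith)] at hu
  have := key (u+1) (by omega)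
  push_cast at this
  nlinarith

noncomputable def dchi (p : ℕ) [Fact p.Prime] : DirichletCharacter ℂ p :=
  (quadraticChar (ZMod p)).ringHomComp (Int.castRingHom ℂ)

lemma dchi_apply (p : ℕ) [Fact p.Prime] (n : ℕ) : dchi p n = ((chi p n : ℝ) : ℂ) := by
  simp [dchi, chi_eq, MulChar.ringHomComp_apply]

lemma dchi_ne_one (p : ℕ) [Fact p.Prime] (hp : p ≠ 2) : dchi p ≠ 1 := by
  intro h
  have h1 := quadraticChar_exists_neg_one' (F := ZMod p) (by rw [ZMod.ringChar_zmod_n]; exact hp)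
  obtain ⟨a, ha⟩ := h1
  have h2 : dchi p a = (1 : DirichletCharacter ℂ p) a := by rw [h]
  rw [MulChar.one_apply_coe] at h2
  simp [dchi, MulChar.ringHomComp_apply, ha] at h2
  norm_num at h2

lemma Lv_eq_LFunction (p : ℕ) [Fact p.Prime] (hp : p ≠ 2) {σ : ℝ} (hσ : 1 < σ) :
    ((Lv (chi p) σ : ℝ) : ℂ) = DirichletCharacter.LFunction (dchi p) σ := by
  have : NeZero p := ⟨(Fact.out : p.Prime).ne_zero⟩
  rw [DirichletCharacter.LFunction_eq_LSeries _ (by simpa using hσ)]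
  have hs := DirichletCharacter.LSeriesSummable_of_one_lt_re (dchi p) (s := (σ:ℂ)) (by simpa using hσ)
  have h1 := hs.hasSum.tendsto_sum_nat
  have h2 := h1.comp (Filter.tendsto_add_atTop_nat 1)
  have h3 := ((Complex.continuous_ofReal.tendsto _).comp ((chi_BP p hp).tendsto (show 0 < σ by linarith)))
  refine tendsto_nhds_unique h3 (h2.congr fun N => ?_)
  simp only [Function.comp]
  unfold PS
  rw [Finset.sum_range_succ', LSeries.term_zero, add_zero, Complex.ofReal_sum]
  refine Finset.sum_bij' (fun k _ => k + 1) (fun n _ => n - 1) ?_ ?_ ?_ ?_ ?_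
  · intro k hk; simp only [mem_range, mem_Ioc] at *; omega
  · intro k hk; simp only [mem_range, mem_Ioc] at *; omega
  · intro k hk; simp
  · intro k hk; simp only [mem_Ioc] at *; omega
  · intro k hk
    rw [LSeries.term_of_ne_zero (Nat.succ_ne_zero k), dchi_apply, Complex.ofReal_mul,
      Complex.ofReal_cpow (by positivity), div_eq_mul_inv]
    congr 1
    push_cast
    rw [Complex.cpow_neg]

lemma Lv_ne_zero (p : ℕ) [Fact p.Prime] (hp : p ≠ 2) : Lv (chi p) 1 ≠ 0 := by
  have : NeZero p := ⟨(Fact.out : p.Prime).ne_zero⟩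
  have h0 := DirichletCharacter.LFunction_apply_one_ne_zero (dchi_ne_one p hp)
  have hc := (DirichletCharacter.differentiable_LFunction (dchi_ne_one p hp)).continuous
  have h1 : Filter.Tendsto (fun σ : ℝ => DirichletCharacter.LFunction (dchi p) σ)
      (nhdsWithin 1 (Set.Ioi 1)) (nhds (DirichletCharacter.LFunction (dchi p) 1)) := by
    have := (hc.comp Complex.continuous_ofReal).tendsto 1
    simp only [Function.comp_def, Complex.ofReal_one] at this
    exact this.mono_left nhdsWithin_le_nhds
  have h2 : Filter.Tendsto (fun σ : ℝ => ((Lv (chi p) σ : ℝ) : ℂ))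
      (nhdsWithin 1 (Set.Ioi 1)) (nhds ((Lv (chi p) 1 : ℝ) : ℂ)) := by
    have := ((chi_BP p hp).continuousOn (show (0:ℝ) < 1 by norm_num)) 1 (by simp)
    have h := this.mono Set.Ioi_subset_Ici_self
    exact (Complex.continuous_ofReal.tendsto _).comp h
  have h3 : Filter.Tendsto (fun σ : ℝ => ((Lv (chi p) σ : ℝ) : ℂ))
      (nhdsWithin 1 (Set.Ioi 1)) (nhds (DirichletCharacter.LFunction (dchi p) 1)) := by
    refine h1.congr' ?_
    filter_upwards [self_mem_nhdsWithin] with σ hσ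
    exact (Lv_eq_LFunction p hp hσ).symm
  have h4 := tendsto_nhds_unique h2 h3
  intro h
  rw [h] at h4
  exact h0 (by rw [← h4]; simp)

lemma Lv_pos (p : ℕ) [Fact p.Prime] (hp : p ≠ 2) : 0 < Lv (chi p) 1 :=
  lt_of_le_of_ne (Lv_nonneg p hp) (Lv_ne_zero p hp).symm

lemma BP.mono {χ : ℕ → ℝ} {M M' : ℝ} (h : BP χ M) (hM : M ≤ M') : BP χ M' :=
  fun N => (h N).trans hM

lemma one_le_sum_rr (p : ℕ) [Fact p.Prime] (β : ℝ) {N : ℕ} (hN : 1 ≤ N) :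
    1 ≤ ∑ n ∈ Ioc 0 N, rr (chi p) n * (n:ℝ) ^ (-β) := by
  have h := Finset.single_le_sum (f := fun n : ℕ => rr (chi p) n * (n:ℝ) ^ (-β)) (s := Ioc 0 N)
    (fun n _ => mul_nonneg (rr_nonneg p n) (by positivity)) (show 1 ∈ Ioc 0 N by simp; omega)
  simpa [rr_one] using h

lemma siegel_zero (p : ℕ) [Fact p.Prime] (hp : p ≠ 2) {η c : ℝ} (hη : 0 < η) (hη1 : η ≤ 1/1024)
    (hc : 1024 * η ≤ c) (hbig : 21 / η < (p:ℝ) ^ η) (hbad : Lv (chi p) 1 < (p:ℝ) ^ (-c)) :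
    ∃ β : ℝ, 1 - η < β ∧ β < 1 ∧ Lv (chi p) β = 0 := by
  have hp1 : 1 ≤ p := (Fact.out : p.Prime).one_le
  have hp1' : (1:ℝ) ≤ p := by exact_mod_cast hp1
  have hp0 : (0:ℝ) < p := by linarith
  have h := chi_BP p hp
  have hneg : Lv (chi p) (1-η) < 0 := by
    obtain ⟨Z, hZ, hZ'⟩ := sum_rr_weighted h hp1' (chi_abs p) (β := 1 - η) (by linarith) (by linarith)
    have h1 := hZ' ((p:ℝ)^5) (one_le_pow₀ hp1')
    rw [show 1 - (1 - η) = η by ring] at h1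
    have h2 : 1 ≤ ∑ n ∈ Ioc 0 ⌊(p:ℝ)^5⌋₊, rr (chi p) n * (n:ℝ) ^ (-(1-η)) :=
      one_le_sum_rr p _ (Nat.le_floor (by simpa using one_le_pow₀ hp1'))
    have h3 := (abs_le.1 h1).2
    have e1 : ((p:ℝ)^5) ^ η = (p:ℝ) ^ (5 * η) := by
      rw [← Real.rpow_natCast, ← Real.rpow_mul hp0.le]; norm_num
    have e2 : ((p:ℝ)^5) ^ (1/2 - (1-η)) = (p:ℝ) ^ (5 * η - 5/2) := by
      rw [← Real.rpow_natCast, ← Real.rpow_mul hp0.le]; congr 1; push_cast; ring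
    rw [e1, e2] at h3
    have b1 : Lv (chi p) 1 / η * (p:ℝ) ^ (5 * η) ≤ 1 / η * (p:ℝ) ^ (-η) := by
      have : Lv (chi p) 1 * (p:ℝ) ^ (5 * η) ≤ (p:ℝ) ^ (-η) := by
        calc _ ≤ (p:ℝ) ^ (-c) * (p:ℝ) ^ (5 * η) := by gcongr
          _ = (p:ℝ) ^ (-c + 5 * η) := by rw [Real.rpow_add hp0]
          _ ≤ _ := Real.rpow_le_rpow_of_exponent_le hp1' (by linarith)
      calc _ = 1 / η * (Lv (chi p) 1 * (p:ℝ) ^ (5 * η)) := by ring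
        _ ≤ _ := by gcongr
    have b2 : 20 * ((p:ℝ) / η) * (p:ℝ) ^ (5 * η - 5/2) ≤ 20 / η * (p:ℝ) ^ (-η) := by
      have : (p:ℝ) * (p:ℝ) ^ (5 * η - 5/2) ≤ (p:ℝ) ^ (-η) := by
        calc _ = (p:ℝ) ^ (1 + (5 * η - 5/2)) := by rw [Real.rpow_add hp0, Real.rpow_one]
          _ ≤ _ := Real.rpow_le_rpow_of_exponent_le hp1' (by linarith)
      calc _ = 20 / η * ((p:ℝ) * (p:ℝ) ^ (5 * η - 5/2)) := by ring
        _ ≤ _ := by gcongr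
    have b3 : 21 / η * (p:ℝ) ^ (-η) < 1 := by
      rw [Real.rpow_neg hp0.le, ← div_eq_mul_inv, div_lt_one (by positivity)]; exact hbig
    have b4 : 1 / η * (p:ℝ) ^ (-η) + 20 / η * (p:ℝ) ^ (-η) = 21 / η * (p:ℝ) ^ (-η) := by ring
    have b5 : 0 < Z * Lv (chi p) (1 - η) := by linarith
    by_contra hcon
    push Not at hcon
    nlinarith
  have hpos := Lv_pos p hp
  have hcont : ContinuousOn (Lv (chi p)) (Set.Icc (1-η) 1) :=
    (h.continuousOn (show (0:ℝ) < 1/2 by norm_num)).mono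
      (fun x hx => by simp only [Set.mem_Ici]; have := hx.1; linarith)
  obtain ⟨β, hβ, hβ'⟩ := intermediate_value_Ioo (show 1 - η ≤ 1 by linarith) hcont ⟨hneg, hpos⟩
  exact ⟨β, hβ.1, hβ.2, hβ'⟩

lemma rr_le (p : ℕ) [Fact p.Prime] (n : ℕ) : rr (chi p) n ≤ n := by
  unfold rr
  calc _ ≤ ∑ z ∈ n.divisorsAntidiagonal, (1:ℝ) :=
        Finset.sum_le_sum fun z _ => (abs_le.1 (chi_abs p z.1)).2
    _ = (n.divisors.card : ℝ) := by
        rw [Nat.sum_divisorsAntidiagonal (fun _ _ => (1:ℝ)), Finset.sum_const, nsmul_eq_mul, mul_one]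
    _ ≤ n := by exact_mod_cast Nat.card_divisors_le_self n

lemma hh_abs_le (p q : ℕ) [Fact p.Prime] [Fact q.Prime] (n : ℕ) : |hh p q n| ≤ n := by
  unfold hh
  rw [abs_mul, abs_of_nonneg (rr_nonneg p n)]
  calc _ ≤ 1 * (n:ℝ) := mul_le_mul (chi_abs q n) (rr_le p n) (rr_nonneg p n) zero_le_one
    _ = n := one_mul _

lemma siegel_ineq (p q : ℕ) [Fact p.Prime] [Fact q.Prime] (hp : p ≠ 2) (hq : q ≠ 2) (hpq : p ≠ q)
    {β : ℝ} (hβ0 : 1 - 1/1024 ≤ β) (hβ1 : β < 1) (hz : Lv (chi p) β = 0) :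
    1 ≤ Lv (chi p) 1 / (1-β) * ((p * q : ℕ) : ℝ) ^ (256 * (1-β)) *
        ((5 + Real.log ((p * q : ℕ) : ℝ)) * Lv (chi q) 1)
      + (57 * (Lv (chi p) 1 / (1-β)) + 26 * (20 * (p / (1-β)))) / ((p * q : ℕ) : ℝ) := by
  have hp1 : 1 ≤ p := (Fact.out : p.Prime).one_le
  have hq1 : 1 ≤ q := (Fact.out : q.Prime).one_le
  have hp1' : (1:ℝ) ≤ p := by exact_mod_cast hp1
  have hη : 0 < 1 - β := by linarith
  set η := 1 - β with hηd
  set A := Lv (chi p) 1 / η with hA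
  set C := 20 * ((p:ℝ) / η) with hC
  have hA0 : 0 ≤ A := div_nonneg (Lv_nonneg p hp) hη.le
  have hC0 : 0 ≤ C := by positivity
  obtain ⟨Z, hZ, hR⟩ := sum_rr_weighted (chi_BP p hp) hp1' (chi_abs p) (β := β) (by linarith) hβ1
  rw [hz, mul_zero, ← hηd] at hR
  simp only [add_zero] at hR
  set m : ℕ := p * q with hm
  have hm1 : 1 ≤ m := Nat.mul_pos hp1 hq1
  have hm1' : (1:ℝ) ≤ m := by exact_mod_cast hm1
  have hm0 : (0:ℝ) < m := by linarith
  set u : ℕ := m ^ 16 with hu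
  set x : ℕ := m ^ 256 with hx
  have hu1 : 1 ≤ u := Nat.one_le_pow _ _ hm1
  have hux : u ≤ x := Nat.pow_le_pow_right hm1 (by norm_num)
  have hu1' : (1:ℝ) ≤ u := by exact_mod_cast hu1
  have hu0 : (0:ℝ) < u := by linarith
  have hx1' : (1:ℝ) ≤ x := by exact_mod_cast (hu1.trans hux)
  have hx0 : (0:ℝ) < x := by linarith
  -- BP facts
  have B12 := chi2_BP p q hp hpq
  have B2 : BP (chi q) (m:ℝ) := (chi_BP q hq).mono (by
    rw [hm]; exact_mod_cast Nat.le_mul_of_pos_left q hp1)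
  have a12 : ∀ n, |(fun n => chi p n * chi q n) n| ≤ 1 := fun n => by
    simp only [abs_mul]
    calc _ ≤ (1:ℝ) * 1 := by gcongr; exacts [chi_abs p n, chi_abs q n]
      _ = 1 := one_mul 1
  have hhcv : hh p q = cv (fun n => chi p n * chi q n) (chi q) := funext (hh_eq_cv p q)
  -- lower bound
  have hlow : 1 ≤ ∑ n ∈ Ioc 0 x, ff p q n * (n:ℝ) ^ (-β) := by
    have h := Finset.single_le_sum (f := fun n : ℕ => ff p q n * (n:ℝ) ^ (-β)) (s := Ioc 0 x)
      (fun n _ => mul_nonneg (ff_nonneg p q n) (by positivity))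
      (show 1 ∈ Ioc 0 x by simp; omega)
    simpa [ff_one] using h
  have hsplit : ∑ n ∈ Ioc 0 x, ff p q n * (n:ℝ) ^ (-β) =
      ∑ d ∈ Ioc 0 u, hh p q d * (d:ℝ) ^ (-β) * ∑ e ∈ Ioc 0 (x / d), rr (chi p) e * (e:ℝ) ^ (-β) +
      ∑ e ∈ Ioc 0 (x / u), rr (chi p) e * (e:ℝ) ^ (-β) * ∑ d ∈ Ioc u (x / e), hh p q d * (d:ℝ) ^ (-β) := by
    have h := hyp_sum (fun d e => (hh p q d * (d:ℝ) ^ (-β)) * (rr (chi p) e * (e:ℝ) ^ (-β))) x u hu1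
    have e1 : ∑ n ∈ Ioc 0 x, ff p q n * (n:ℝ) ^ (-β) = ∑ n ∈ Ioc 0 x, ∑ z ∈ n.divisorsAntidiagonal,
        (hh p q z.1 * (z.1:ℝ) ^ (-β)) * (rr (chi p) z.2 * (z.2:ℝ) ^ (-β)) := by
      refine Finset.sum_congr rfl fun n _ => ?_
      unfold ff cv
      rw [Finset.sum_mul]
      refine Finset.sum_congr rfl fun z hz => ?_
      rw [Nat.mem_divisorsAntidiagonal] at hz
      rw [← hz.1, Nat.cast_mul, Real.mul_rpow (by positivity) (by positivity)]
      ring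
    rw [e1, h]
    congr 1
    · refine Finset.sum_congr rfl fun d _ => ?_
      rw [← Finset.mul_sum]
    · refine Finset.sum_congr rfl fun d _ => ?_
      rw [← Finset.sum_mul, mul_comm]
  have eu : (u:ℝ) ^ (-(1/4:ℝ)) = (m:ℝ) ^ (-(4:ℝ)) := by
    rw [hu, Nat.cast_pow, ← Real.rpow_natCast, ← Real.rpow_mul hm0.le]; norm_num
  have ex : (x:ℝ) ^ η = (m:ℝ) ^ (256 * η) := by
    rw [hx, Nat.cast_pow, ← Real.rpow_natCast, ← Real.rpow_mul hm0.le]; norm_num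
  have ex4 : (x:ℝ) ^ η ≤ (m:ℝ) ^ (1/4:ℝ) := by
    rw [ex]; exact Real.rpow_le_rpow_of_exponent_le hm1' (by linarith)
  have hxη1 : 1 ≤ (x:ℝ) ^ η := Real.one_le_rpow hx1' hη.le
  -- second sum
  have hsecond : |∑ e ∈ Ioc 0 (x / u), rr (chi p) e * (e:ℝ) ^ (-β) *
      ∑ d ∈ Ioc u (x / e), hh p q d * (d:ℝ) ^ (-β)| ≤ 25 * (A + C) / m := by
    have hin : ∀ e ∈ Ioc 0 (x/u), |∑ d ∈ Ioc u (x / e), hh p q d * (d:ℝ) ^ (-β)| ≤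
        25 * m * (m:ℝ) ^ (-(4:ℝ)) := by
      intro e he
      rw [mem_Ioc] at he
      have hue : u ≤ x / e := by
        rw [Nat.le_div_iff_mul_le he.1, mul_comm]
        exact (Nat.le_div_iff_mul_le hu1).1 he.2
      have h := abel_bound (hh p q) (5 * m) (1/2) β 4 (by positivity) (by linarith) (by linarith)
        (by norm_num) (by push_cast; linarith) (fun N hN => by
          rw [hhcv]; exact cv_partial B12 B2 a12 (chi_abs q) N hN) u (x/e) hu1 hue
      refine h.trans ?_
      calc (1 + ((4:ℕ):ℝ)) * (5 * m) * (u:ℝ) ^ (1/2 - β) = 25 * m * (u:ℝ) ^ (1/2 - β) := by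
            push_cast; ring
        _ ≤ 25 * m * (u:ℝ) ^ (-(1/4:ℝ)) := by
            gcongr ?_ * ?_
            exact Real.rpow_le_rpow_of_exponent_le hu1' (by linarith)
        _ = _ := by rw [eu]
    have hRu : ∑ e ∈ Ioc 0 (x / u), rr (chi p) e * (e:ℝ) ^ (-β) ≤ (A + C) * (x:ℝ) ^ η := by
      have h := hR ((x:ℝ)/u) (by rw [le_div_iff₀ hu0]; exact_mod_cast (by simpa using hux))
      rw [Nat.floor_div_natCast, Nat.floor_natCast] at h
      have h2 := (abs_le.1 h).2
      have hle1 : ((x:ℝ)/u) ^ η ≤ (x:ℝ) ^ η :=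
        Real.rpow_le_rpow (by positivity) (div_le_self hx0.le hu1') hη.le
      have hle2 : ((x:ℝ)/u) ^ (1/2-β) ≤ (x:ℝ) ^ η := by
        refine le_trans ?_ hxη1
        exact Real.rpow_le_one_of_one_le_of_nonpos (by rw [le_div_iff₀ hu0]; exact_mod_cast (by simpa using hux)) (by linarith)
      have k1 := mul_le_mul_of_nonneg_left hle1 hA0
      have k2 := mul_le_mul_of_nonneg_left hle2 hC0
      linarith
    calc _ ≤ ∑ e ∈ Ioc 0 (x / u), rr (chi p) e * (e:ℝ) ^ (-β) * (25 * m * (m:ℝ) ^ (-(4:ℝ))) := by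
          refine (Finset.abs_sum_le_sum_abs _ _).trans (Finset.sum_le_sum fun e he => ?_)
          rw [abs_mul, abs_of_nonneg (mul_nonneg (rr_nonneg p e) (by positivity))]
          exact mul_le_mul_of_nonneg_left (hin e he) (mul_nonneg (rr_nonneg p e) (by positivity))
      _ = (∑ e ∈ Ioc 0 (x / u), rr (chi p) e * (e:ℝ) ^ (-β)) * (25 * m * (m:ℝ) ^ (-(4:ℝ))) := by
          rw [Finset.sum_mul]
      _ ≤ ((A + C) * (m:ℝ) ^ (1/4:ℝ)) * (25 * m * (m:ℝ) ^ (-(4:ℝ))) := by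
          gcongr
          exact hRu.trans (by gcongr)
      _ = 25 * (A + C) * ((m:ℝ) ^ (1/4:ℝ) * m * (m:ℝ) ^ (-(4:ℝ))) := by ring
      _ = 25 * (A + C) * (m:ℝ) ^ (1/4 + 1 + (-(4:ℝ))) := by
          rw [Real.rpow_add hm0, Real.rpow_add hm0, Real.rpow_one]
      _ ≤ 25 * (A + C) * (m:ℝ) ^ (-(1:ℝ)) := by
          gcongr ?_ * ?_
          exact Real.rpow_le_rpow_of_exponent_le hm1' (by norm_num)
      _ = _ := by rw [Real.rpow_neg_one, div_eq_mul_inv]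
  -- first sum
  have hfirst : |∑ d ∈ Ioc 0 u, hh p q d * (d:ℝ) ^ (-β) *
      ∑ e ∈ Ioc 0 (x / d), rr (chi p) e * (e:ℝ) ^ (-β) - A * (x:ℝ) ^ η * PS (hh p q) 1 u| ≤ C / m := by
    unfold PS
    rw [Finset.mul_sum, ← Finset.sum_sub_distrib]
    have hin : ∀ d ∈ Ioc 0 u, |hh p q d * (d:ℝ) ^ (-β) *
        ∑ e ∈ Ioc 0 (x / d), rr (chi p) e * (e:ℝ) ^ (-β) -
        A * (x:ℝ) ^ η * (hh p q d * (d:ℝ) ^ (-(1:ℝ)))| ≤ u * (C * (m:ℝ) ^ (-(60:ℝ))) := by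
      intro d hd
      rw [mem_Ioc] at hd
      have hd0 : (0:ℝ) < d := by exact_mod_cast hd.1
      have hd1 : (1:ℝ) ≤ d := by exact_mod_cast hd.1
      have hdu : (d:ℝ) ≤ u := by exact_mod_cast hd.2
      have hdx : (d:ℝ) ≤ x := by exact_mod_cast hd.2.trans hux
      have h := hR ((x:ℝ)/d) (by rw [le_div_iff₀ hd0]; linarith)
      rw [Nat.floor_div_natCast, Nat.floor_natCast] at h
      have e1 : (d:ℝ) ^ (-(1:ℝ)) * (x:ℝ) ^ η = (d:ℝ) ^ (-β) * ((x:ℝ)/d) ^ η := by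
        rw [Real.div_rpow hx0.le hd0.le, show -(1:ℝ) = -β - η by rw [hηd]; ring, Real.rpow_sub hd0]
        ring
      have e2 : hh p q d * (d:ℝ) ^ (-β) * ∑ e ∈ Ioc 0 (x / d), rr (chi p) e * (e:ℝ) ^ (-β) -
          A * (x:ℝ) ^ η * (hh p q d * (d:ℝ) ^ (-(1:ℝ))) = (hh p q d * (d:ℝ) ^ (-β)) *
          (∑ e ∈ Ioc 0 (x / d), rr (chi p) e * (e:ℝ) ^ (-β) - A * ((x:ℝ)/d) ^ η) := by
        linear_combination (- A * hh p q d) * e1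
      rw [e2, abs_mul]
      refine mul_le_mul ?_ (h.trans ?_) (abs_nonneg _) hu0.le
      · rw [abs_mul, abs_of_nonneg (show 0 ≤ (d:ℝ) ^ (-β) by positivity)]
        calc _ ≤ (d:ℝ) * 1 := mul_le_mul (hh_abs_le p q d)
              (Real.rpow_le_one_of_one_le_of_nonpos hd1 (by linarith)) (by positivity) hd0.le
          _ ≤ u := by linarith
      · gcongr ?_ * ?_
        have hxu : (m:ℝ) ^ 240 ≤ (x:ℝ)/d := by
          rw [le_div_iff₀ hd0]
          calc (m:ℝ) ^ 240 * d ≤ (m:ℝ)^240 * u := by gcongr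
            _ = (x:ℝ) := by rw [hu, hx]; push_cast; rw [← pow_add]
        calc ((x:ℝ)/d) ^ (1/2 - β) ≤ ((x:ℝ)/d) ^ (-(1/4:ℝ)) :=
              Real.rpow_le_rpow_of_exponent_le (by rw [le_div_iff₀ hd0]; linarith) (by linarith)
          _ ≤ ((m:ℝ)^240) ^ (-(1/4:ℝ)) :=
              Real.rpow_le_rpow_of_nonpos (by positivity) hxu (by norm_num)
          _ = (m:ℝ) ^ (-(60:ℝ)) := by
              rw [← Real.rpow_natCast, ← Real.rpow_mul hm0.le]; norm_num
    calc _ ≤ ∑ d ∈ Ioc 0 u, (u:ℝ) * (C * (m:ℝ) ^ (-(60:ℝ))) :=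
          (Finset.abs_sum_le_sum_abs _ _).trans (Finset.sum_le_sum hin)
      _ = C * ((u:ℝ) * u * (m:ℝ) ^ (-(60:ℝ))) := by
          rw [Finset.sum_const, nsmul_eq_mul, Nat.card_Ioc, Nat.sub_zero]; ring
      _ = C * (m:ℝ) ^ ((16:ℝ) + 16 + -(60:ℝ)) := by
          rw [Real.rpow_add hm0, Real.rpow_add hm0, hu]; push_cast
          rw [← Real.rpow_natCast]; norm_num
      _ ≤ C * (m:ℝ) ^ (-(1:ℝ)) := by
          gcongr ?_ * ?_
          exact Real.rpow_le_rpow_of_exponent_le hm1' (by norm_num)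
      _ = _ := by rw [Real.rpow_neg_one, div_eq_mul_inv]
  have hPS := cv_one B12 B2 hm1' a12 (chi_abs q) u hu1
  rw [← hhcv, eu] at hPS
  have hlog := Lv_one_log B12 hm1' a12
  have hL2 := Lv_nonneg q hq
  have hPS2 : PS (hh p q) 1 u ≤ (5 + Real.log m) * Lv (chi q) 1 + 32 * (m:ℝ)^2 * (m:ℝ) ^ (-(4:ℝ)) := by
    have h1 := (abs_le.1 hPS).2
    have h2 := mul_le_mul_of_nonneg_right ((le_abs_self _).trans hlog) hL2
    linarith
  have hmain : A * (x:ℝ) ^ η * PS (hh p q) 1 u ≤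
      A * (m:ℝ) ^ (256 * η) * ((5 + Real.log m) * Lv (chi q) 1) + 32 * A / m := by
    have h1 : A * (x:ℝ) ^ η * (32 * (m:ℝ)^2 * (m:ℝ) ^ (-(4:ℝ))) ≤ 32 * A / m := by
      calc _ ≤ A * (m:ℝ) ^ (1/4:ℝ) * (32 * (m:ℝ)^2 * (m:ℝ) ^ (-(4:ℝ))) := by gcongr
        _ = 32 * A * (m:ℝ) ^ (1/4 + 2 + (-(4:ℝ))) := by
            rw [Real.rpow_add hm0, Real.rpow_add hm0, Real.rpow_two]; ring
        _ ≤ 32 * A * (m:ℝ) ^ (-(1:ℝ)) := by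
            gcongr ?_ * ?_
            exact Real.rpow_le_rpow_of_exponent_le hm1' (by norm_num)
        _ = _ := by rw [Real.rpow_neg_one, div_eq_mul_inv]
    have h2 := mul_le_mul_of_nonneg_left hPS2 (show 0 ≤ A * (x:ℝ) ^ η by positivity)
    rw [mul_add] at h2
    rw [ex] at h1 h2 ⊢
    linarith
  rw [hsplit] at hlow
  have f1 := (abs_le.1 hfirst).2
  have f2 := (abs_le.1 hsecond).2
  have e : (57 * A + 26 * C) / m = 25 * (A + C) / m + C / m + 32 * A / m := by ring
  rw [e]
  linarith

lemma log_mul_rpow_neg_tendsto {a : ℝ} (ha : 0 < a) :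
    Filter.Tendsto (fun t : ℝ => Real.log t * t ^ (-a)) Filter.atTop (nhds 0) := by
  have h := (isLittleO_log_rpow_atTop ha).tendsto_div_nhds_zero
  refine h.congr' ?_
  filter_upwards [Filter.eventually_gt_atTop 0] with t ht
  rw [Real.rpow_neg ht.le, div_eq_mul_inv]

theorem siegel {c : ℝ} (hc : 0 < c) (hc1 : c ≤ 1) :
    ∃ p₀ : ℕ, ∀ (p : ℕ) (_ : Fact p.Prime), p₀ < p → (p:ℝ) ^ (-c) ≤ Lv (chi p) 1 := by
  by_contra hcon
  push Not at hcon
  set η := c / 1024 with hη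
  have hη0 : 0 < η := by positivity
  have hev : ∀ᶠ n : ℕ in Filter.atTop, 21 / η < (n:ℝ) ^ η :=
    ((tendsto_rpow_atTop hη0).comp tendsto_natCast_atTop_atTop).eventually_gt_atTop _
  obtain ⟨N1, hN1⟩ := Filter.eventually_atTop.1 hev
  obtain ⟨p, hpF, hpN, hpbad⟩ := hcon (max N1 2)
  have hp2 : p ≠ 2 := by have := le_max_right N1 2; omega
  have hpN1 : N1 ≤ p := by have := le_max_left N1 2; omega
  obtain ⟨β, hβ0, hβ1, hz⟩ := siegel_zero p hp2 hη0 (by linarith) (by linarith) (hN1 p hpN1) hpbad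
  have hp0 : (0:ℝ) < p := by exact_mod_cast hpF.out.pos
  set A := Lv (chi p) 1 / (1-β) with hA
  have hA0 : 0 ≤ A := div_nonneg (Lv_nonneg p hp2) (by linarith)
  set K := 57 * A + 26 * (20 * (p / (1-β))) with hK
  have hlim : Filter.Tendsto (fun t : ℝ => A * (p:ℝ) ^ (c/4) *
      ((5 + Real.log p) * t ^ (-(3*c/4)) + Real.log t * t ^ (-(3*c/4))) + K / p * t ^ (-(1:ℝ)))
      Filter.atTop (nhds (A * (p:ℝ) ^ (c/4) * ((5 + Real.log p) * 0 + 0) + K / p * 0)) := by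
    have t1 := tendsto_rpow_neg_atTop (show 0 < 3*c/4 by positivity)
    have t2 := log_mul_rpow_neg_tendsto (show 0 < 3*c/4 by positivity)
    have t3 := tendsto_rpow_neg_atTop (show (0:ℝ) < 1 by positivity)
    exact (((t1.const_mul _).add t2).const_mul _).add (t3.const_mul _)
  simp only [mul_zero, add_zero] at hlim
  have hev2 := (hlim.comp tendsto_natCast_atTop_atTop).eventually_lt_const zero_lt_one
  obtain ⟨N2, hN2⟩ := Filter.eventually_atTop.1 hev2
  obtain ⟨q, hqF, hqN, hqbad⟩ := hcon (max N2 p)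
  have hq1 : N2 ≤ q := by have := le_max_left N2 p; omega
  have hq2 : p < q := by have := le_max_right N2 p; omega
  have h1 := hN2 q hq1
  simp only [Function.comp] at h1
  have hq0 : (0:ℝ) < q := by exact_mod_cast hqF.out.pos
  have h2 := siegel_ineq p q hp2 (by have := hpF.out.two_le; omega) hq2.ne (by linarith) hβ1 hz
  rw [← hA, ← hK] at h2
  have hL := Lv_nonneg q (by have := hpF.out.two_le; omega)
  have hm1 : (1:ℝ) ≤ ((p*q:ℕ):ℝ) := by exact_mod_cast Nat.mul_pos hpF.out.pos hqF.out.pos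
  have hlogp : 0 ≤ Real.log p := Real.log_natCast_nonneg p
  have hlogq : 0 ≤ Real.log q := Real.log_natCast_nonneg q
  have elog : Real.log ((p*q:ℕ):ℝ) = Real.log p + Real.log q := by
    push_cast; exact Real.log_mul hp0.ne' hq0.ne'
  have h3 : ((p * q : ℕ) : ℝ) ^ (256 * (1-β)) ≤ (p:ℝ) ^ (c/4) * (q:ℝ) ^ (c/4) := by
    rw [← Real.mul_rpow hp0.le hq0.le, ← Nat.cast_mul]
    exact Real.rpow_le_rpow_of_exponent_le hm1 (by linarith)
  have h4 : A * ((p * q : ℕ) : ℝ) ^ (256 * (1-β)) *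
        ((5 + Real.log ((p * q : ℕ) : ℝ)) * Lv (chi q) 1) ≤
      A * ((p:ℝ) ^ (c/4) * (q:ℝ) ^ (c/4)) * ((5 + (Real.log p + Real.log q)) * (q:ℝ) ^ (-c)) := by
    rw [elog]
    gcongr
  have h5 : (q:ℝ) ^ (-(3*c/4)) = (q:ℝ) ^ (c/4) * (q:ℝ) ^ (-c) := by
    rw [← Real.rpow_add hq0]; congr 1; ring
  have h6 : K / ((p*q:ℕ):ℝ) = K / p * (q:ℝ) ^ (-(1:ℝ)) := by
    rw [Real.rpow_neg_one]; push_cast; field_simp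
  rw [h5] at h1
  rw [h6] at h2
  have h7 : A * ((p:ℝ) ^ (c/4) * (q:ℝ) ^ (c/4)) * ((5 + (Real.log p + Real.log q)) * (q:ℝ) ^ (-c)) =
     A * (p:ℝ) ^ (c/4) * ((5 + Real.log p) * ((q:ℝ) ^ (c/4) * (q:ℝ) ^ (-c)) +
       Real.log q * ((q:ℝ) ^ (c/4) * (q:ℝ) ^ (-c))) := by ring
  linarith

lemma inv_sin_bound {p a : ℕ} (ha : 0 < a) (hap : a < p) :
    2 / ((p:ℝ) * ((a:ℝ)⁻¹ + ((p - a : ℕ):ℝ)⁻¹)) ≤ Real.sin (Real.pi * a / p) := by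
  have hp0 : (0:ℝ) < p := by exact_mod_cast (ha.trans hap)
  have ha0 : (0:ℝ) < a := by exact_mod_cast ha
  have hb0 : (0:ℝ) < ((p - a : ℕ):ℝ) := by exact_mod_cast Nat.sub_pos_of_lt hap
  have hb : ((p - a : ℕ):ℝ) = p - a := by rw [Nat.cast_sub hap.le]
  have hpi := Real.pi_pos
  rcases le_total (2 * a) p with h | h
  · have h' : 2 * (a:ℝ) ≤ p := by exact_mod_cast h
    have h1 := Real.mul_le_sin (x := Real.pi * a / p) (by positivity) (by
      rw [div_le_div_iff₀ hp0 two_pos]; nlinarith)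
    refine le_trans ?_ h1
    calc _ ≤ 2 / ((p:ℝ) * ((a:ℝ)⁻¹ + 0)) := by gcongr; positivity
      _ = 2 / Real.pi * (Real.pi * a / p) := by field_simp; simp
  · have h' : (p:ℝ) ≤ 2 * a := by exact_mod_cast h
    have h1 := Real.mul_le_sin (x := Real.pi * ((p - a : ℕ):ℝ) / p) (by positivity) (by
      rw [div_le_div_iff₀ hp0 two_pos, hb]; nlinarith)
    have e : Real.sin (Real.pi * a / p) = Real.sin (Real.pi * ((p - a : ℕ):ℝ) / p) := by
      rw [← Real.sin_pi_sub, hb]; congr 1; field_simp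
    rw [e]
    refine le_trans ?_ h1
    calc _ ≤ 2 / ((p:ℝ) * (0 + ((p - a : ℕ):ℝ)⁻¹)) := by gcongr; positivity
      _ = 2 / Real.pi * (Real.pi * ((p - a : ℕ):ℝ) / p) := by field_simp; simp

lemma geom_bound {p a : ℕ} [NeZero p] (ha : 0 < a) (hap : a < p) (N : ℕ) :
    ‖∑ n ∈ Ioc 0 N, ZMod.stdAddChar ((a:ZMod p) * (n : ZMod p))‖ ≤
      (p:ℝ) / 2 * ((a:ℝ)⁻¹ + ((p - a : ℕ):ℝ)⁻¹) := by
  have hp0 : (0:ℝ) < p := by exact_mod_cast (ha.trans hap)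
  have ha0 : (0:ℝ) < a := by exact_mod_cast ha
  have hb0 : (0:ℝ) < ((p - a : ℕ):ℝ) := by exact_mod_cast Nat.sub_pos_of_lt hap
  set z : ℂ := ZMod.stdAddChar (a : ZMod p) with hz
  have hz' : z = Complex.exp (Complex.I * ((2 * Real.pi * a / p : ℝ) : ℂ)) := by
    rw [hz, ZMod.stdAddChar_apply, ZMod.toCircle_natCast]
    congr 1; push_cast; ring
  have hzn : ‖z‖ = 1 := by rw [hz', mul_comm, Complex.norm_exp_ofReal_mul_I]
  have hs := inv_sin_bound ha hap
  have hspos : 0 < Real.sin (Real.pi * a / p) := lt_of_lt_of_le (by positivity) hs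
  have hz1 : ‖z - 1‖ = 2 * Real.sin (Real.pi * a / p) := by
    rw [hz', Complex.norm_exp_I_mul_ofReal_sub_one, Real.norm_eq_abs,
      show 2 * Real.pi * a / p / 2 = Real.pi * a / p by ring, abs_of_pos (by positivity)]
  have hne : z ≠ 1 := by
    intro h; rw [h] at hz1; simp at hz1; linarith
  have e : ∑ n ∈ Ioc 0 N, ZMod.stdAddChar ((a:ZMod p) * (n : ZMod p)) = z * ((z ^ N - 1) / (z - 1)) := by
    rw [← geom_sum_eq hne, Finset.mul_sum]
    symm
    refine Finset.sum_bij' (fun k _ => k + 1) (fun n _ => n - 1) ?_ ?_ ?_ ?_ ?_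
    · intro k hk; simp only [mem_range, mem_Ioc] at *; omega
    · intro k hk; simp only [mem_range, mem_Ioc] at *; omega
    · intro k hk; simp
    · intro k hk; simp only [mem_Ioc] at *; omega
    · intro k hk
      rw [← pow_succ', hz, ← AddChar.map_nsmul_eq_pow]
      congr 1; simp [mul_comm]
  rw [e, norm_mul, hzn, one_mul, norm_div, hz1, div_le_iff₀ (by positivity)]
  have h1 : ‖z ^ N - 1‖ ≤ 2 := by
    refine (norm_sub_le _ _).trans ?_
    rw [norm_pow, hzn]; norm_num
  refine h1.trans ?_
  rw [div_le_iff₀ (by positivity)] at hs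
  linarith

lemma polya_vinogradov (p : ℕ) [Fact p.Prime] (hp : p ≠ 2) :
    BP (chi p) (Real.sqrt p * (1 + Real.log p)) := by
  have : NeZero p := ⟨(Fact.out : p.Prime).ne_zero⟩
  have hp0 : (0:ℝ) < p := by exact_mod_cast (Fact.out : p.Prime).pos
  intro N
  have hquad : (dchi p).IsQuadratic := (quadraticChar_isQuadratic (ZMod p)).comp _
  set g := gaussSum (dchi p) (ZMod.stdAddChar (N := p)) with hg
  have hgn : ‖g‖ = Real.sqrt p := by
    have h1 := gaussSum_sq (dchi_ne_one p hp) hquad (ZMod.isPrimitive_stdAddChar p)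
    rw [← hg, ZMod.card] at h1
    have h2 : ‖g‖ ^ 2 = p := by
      rw [← norm_pow, h1, norm_mul]
      have : ‖dchi p (-1)‖ = 1 := by
        have := (dchi p).unit_norm_eq_one (-1)
        simpa using this
      rw [this, one_mul]; simp
    rw [← h2, Real.sqrt_sq (norm_nonneg _)]
  have hshift : ∀ n : ℕ, (chi p n : ℂ) * g = ∑ a : ZMod p, dchi p a * ZMod.stdAddChar (a * (n : ZMod p)) := by
    intro n
    by_cases hn : (n : ZMod p) = 0
    · rw [← dchi_apply, hn]
      simp only [mul_zero, AddChar.map_zero_eq_one, mul_one]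
      rw [MulChar.sum_eq_zero_of_ne_one (dchi_ne_one p hp), MulChar.map_nonunit _ (by simp), zero_mul]
    · have h1 := gaussSum_mulShift_eq (dchi p) (ZMod.stdAddChar (N := p)) (Units.mk0 _ hn)
      rw [hquad.inv, Units.val_mk0, dchi_apply] at h1
      rw [← h1, gaussSum]
      simp only [AddChar.mulShift_apply, mul_comm]
  have hsum : (((∑ n ∈ Ioc 0 N, chi p n : ℝ)) : ℂ) * g =
      ∑ a : ZMod p, dchi p a * ∑ n ∈ Ioc 0 N, ZMod.stdAddChar (a * (n : ZMod p)) := by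
    push_cast
    rw [Finset.sum_mul, Finset.sum_congr rfl (fun n _ => hshift n), Finset.sum_comm]
    simp only [Finset.mul_sum]
  have hbound : ‖∑ a : ZMod p, dchi p a * ∑ n ∈ Ioc 0 N, ZMod.stdAddChar (a * (n : ZMod p))‖ ≤
      p * (1 + Real.log p) := by
    calc _ ≤ ∑ a : ZMod p, ‖dchi p a * ∑ n ∈ Ioc 0 N, ZMod.stdAddChar (a * (n : ZMod p))‖ := norm_sum_le _ _
      _ = ∑ a ∈ range p, ‖dchi p a * ∑ n ∈ Ioc 0 N, ZMod.stdAddChar ((a : ZMod p) * (n : ZMod p))‖ :=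
          (sum_range_zmod p (fun a => ‖dchi p a * ∑ n ∈ Ioc 0 N, ZMod.stdAddChar (a * (n : ZMod p))‖)).symm
      _ = ∑ a ∈ Ioc 0 (p-1), ‖dchi p a * ∑ n ∈ Ioc 0 N, ZMod.stdAddChar ((a : ZMod p) * (n : ZMod p))‖ := by
          symm
          refine Finset.sum_subset ?_ ?_
          · intro a ha; simp only [mem_range, mem_Ioc] at *; omega
          · intro a ha hb
            have : a = 0 := by simp only [mem_range, mem_Ioc] at *; omega
            rw [this, dchi_apply, chi_zero]; simp
      _ ≤ ∑ a ∈ Ioc 0 (p-1), (p:ℝ) / 2 * ((a:ℝ)⁻¹ + ((p - a : ℕ):ℝ)⁻¹) := by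
          refine Finset.sum_le_sum fun a ha => ?_
          rw [mem_Ioc] at ha
          rw [norm_mul]
          have h1 := geom_bound ha.1 (show a < p by omega) N
          calc _ ≤ 1 * ‖∑ n ∈ Ioc 0 N, ZMod.stdAddChar ((a:ZMod p) * (n : ZMod p))‖ := by
                gcongr; exact (dchi p).norm_le_one _
            _ ≤ _ := by rw [one_mul]; exact h1
      _ = (p:ℝ) / 2 * (∑ a ∈ Ioc 0 (p-1), (a:ℝ)⁻¹ + ∑ a ∈ Ioc 0 (p-1), ((p - a : ℕ):ℝ)⁻¹) := by
          rw [← Finset.mul_sum, Finset.sum_add_distrib]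
      _ = (p:ℝ) * (∑ a ∈ Ioc 0 (p-1), (a:ℝ)⁻¹) := by
          have : ∑ a ∈ Ioc 0 (p-1), ((p - a : ℕ):ℝ)⁻¹ = ∑ a ∈ Ioc 0 (p-1), (a:ℝ)⁻¹ := by
            refine Finset.sum_bij' (fun k _ => p - k) (fun n _ => p - n) ?_ ?_ ?_ ?_ ?_
            · intro k hk; simp only [mem_Ioc] at *; omega
            · intro k hk; simp only [mem_Ioc] at *; omega
            · intro k hk; simp only [mem_Ioc] at *; omega
            · intro k hk; simp only [mem_Ioc] at *; omega
            · intro k hk; rfl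
          rw [this]; ring
      _ ≤ (p:ℝ) * (1 + Real.log p) := by
          gcongr
          refine (sum_inv_le (p-1)).trans ?_
          gcongr
          · have := (Fact.out : p.Prime).two_le
            exact_mod_cast (show 0 < p - 1 by omega)
          · exact Nat.sub_le p 1
  rw [← hsum, norm_mul, hgn, Complex.norm_real, Real.norm_eq_abs] at hbound
  have hs : 0 < Real.sqrt p := Real.sqrt_pos.2 hp0
  have e : (p:ℝ) * (1 + Real.log p) = (Real.sqrt p * (1 + Real.log p)) * Real.sqrt p := by
    nth_rewrite 1 [← Real.mul_self_sqrt hp0.le]; ring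
  rw [e] at hbound
  exact le_of_mul_le_mul_right hbound hs

/-- all prime factors split -/
def Good (p : ℕ) [Fact p.Prime] (g : ℕ) : Prop := ∀ q : ℕ, q.Prime → q ∣ g → chi p q = 1

lemma chi_eq_zero_iff (p : ℕ) [Fact p.Prime] (n : ℕ) : chi p n = 0 ↔ p ∣ n := by
  unfold chi
  rw [Int.cast_eq_zero, legendreSym.eq_zero_iff, Int.cast_natCast, ZMod.natCast_eq_zero_iff]

lemma rr_structure (p : ℕ) [Fact p.Prime] (n : ℕ) : 0 < n → n < p → rr (chi p) n ≠ 0 →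
    ∃ g m : ℕ, n = g * m ^ 2 ∧ Good p g ∧ rr (chi p) n ≤ g.divisors.card := by
  induction n using Nat.recOnPosPrimePosCoprime with
  | zero => intro h; omega
  | one => intro _ _ _; exact ⟨1, 1, by norm_num, fun q hq h => absurd (Nat.dvd_one.1 h) hq.one_lt.ne',
      by simp [rr_one]⟩
  | prime_pow q k hq hk =>
    intro _ hlt hne
    rw [rr_eq, rA_prime_pow p hq] at hne ⊢
    have hqp : q < p := lt_of_le_of_lt (Nat.le_self_pow hk.ne' q) hlt
    rcases chi_trichotomy p q with h | h | h
    · rw [chi_eq_zero_iff] at h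
      exact absurd (Nat.le_of_dvd hq.pos h) (by omega)
    · refine ⟨q^k, 1, by norm_num, fun l hl hd => ?_, ?_⟩
      · rw [(Nat.prime_dvd_prime_iff_eq hl hq).1 (hl.dvd_of_dvd_pow hd)]; exact h
      · rw [h, Nat.divisors_prime_pow hq]; simp
    · rw [h, geom_neg_one] at hne ⊢
      have he : Even k := by
        by_contra hcon
        simp [hcon] at hne
      obtain ⟨j, hj⟩ := he
      refine ⟨1, q^j, by rw [hj]; ring, fun q hq h => absurd (Nat.dvd_one.1 h) hq.one_lt.ne', ?_⟩
      split_ifs <;> simp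
  | coprime a b ha hb hab iha ihb =>
    intro _ hlt hne
    have e : rr (chi p) (a * b) = rr (chi p) a * rr (chi p) b := by
      rw [rr_eq, rr_eq, rr_eq, (rA_mult p).map_mul_of_coprime hab]
    rw [e] at hne ⊢
    obtain ⟨h1, h2⟩ := mul_ne_zero_iff.1 hne
    have la : a ≤ a * b := Nat.le_mul_of_pos_right a (by omega)
    have lb : b ≤ a * b := Nat.le_mul_of_pos_left b (by omega)
    obtain ⟨g, m, e1, G1, r1⟩ := iha (by omega) (by omega) h1
    obtain ⟨g', m', e2, G2, r2⟩ := ihb (by omega) (by omega) h2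
    have hcop : g.Coprime g' := Nat.Coprime.coprime_dvd_left (Dvd.intro _ e1.symm)
      (Nat.Coprime.coprime_dvd_right (Dvd.intro _ e2.symm) hab)
    refine ⟨g * g', m * m', ?_, ?_, ?_⟩
    · conv_lhs => rw [e1, e2]
      ring
    · intro q hq hd
      rcases (Nat.Prime.dvd_mul hq).1 hd with h | h
      · exact G1 q hq h
      · exact G2 q hq h
    · rw [hcop.card_divisors_mul]; push_cast
      exact mul_le_mul r1 r2 (rr_nonneg p b) (by positivity)

lemma divisor_sum_bound (Y : ℕ) (hY : 1 ≤ Y) :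
    ∑ g ∈ Ioc 0 Y, (g.divisors.card : ℝ) * (g:ℝ) ^ (-(1/2:ℝ)) ≤
      2 * (Y:ℝ) ^ (1/2:ℝ) * (1 + Real.log Y) := by
  have h1 := hyp_sum (fun d e => (d:ℝ) ^ (-(1/2:ℝ)) * (e:ℝ) ^ (-(1/2:ℝ))) Y Y hY
  have e1 : ∑ g ∈ Ioc 0 Y, (g.divisors.card : ℝ) * (g:ℝ) ^ (-(1/2:ℝ)) =
      ∑ n ∈ Ioc 0 Y, ∑ z ∈ n.divisorsAntidiagonal, (z.1:ℝ) ^ (-(1/2:ℝ)) * (z.2:ℝ) ^ (-(1/2:ℝ)) := by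
    refine Finset.sum_congr rfl fun n _ => ?_
    have : ∀ z ∈ n.divisorsAntidiagonal, (z.1:ℝ) ^ (-(1/2:ℝ)) * (z.2:ℝ) ^ (-(1/2:ℝ)) =
        (fun _ _ => (n:ℝ) ^ (-(1/2:ℝ))) z.1 z.2 := by
      intro z hz
      rw [Nat.mem_divisorsAntidiagonal] at hz
      rw [← Real.mul_rpow (by positivity) (by positivity), ← Nat.cast_mul, hz.1]
    rw [Finset.sum_congr rfl this, Nat.sum_divisorsAntidiagonal (fun _ _ => (n:ℝ) ^ (-(1/2:ℝ))),
      Finset.sum_const, nsmul_eq_mul]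
  rw [e1, h1, Nat.div_self hY]
  have e2 : ∑ e ∈ Ioc 0 1, ∑ d ∈ Ioc Y (Y / e), (d:ℝ) ^ (-(1/2:ℝ)) * (e:ℝ) ^ (-(1/2:ℝ)) = 0 := by
    simp
  rw [e2, add_zero]
  calc _ ≤ ∑ d ∈ Ioc 0 Y, 2 * (Y:ℝ) ^ (1/2:ℝ) * (d:ℝ)⁻¹ := by
        refine Finset.sum_le_sum fun d hd => ?_
        rw [mem_Ioc] at hd
        have hd0 : (0:ℝ) < d := by exact_mod_cast hd.1
        rw [← Finset.mul_sum]
        have h2 := ZS_le (β := 1/2) (by norm_num) (by norm_num) (Y / d)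
        unfold ZS at h2
        have h3 : (((Y/d : ℕ)):ℝ) ^ (1 - 1/2:ℝ) ≤ ((Y:ℝ)/d) ^ (1/2:ℝ) := by
          rw [show (1 - 1/2:ℝ) = 1/2 by norm_num]
          exact Real.rpow_le_rpow (by positivity) Nat.cast_div_le (by norm_num)
        have h4 : ∑ e ∈ Ioc 0 (Y/d), (e:ℝ) ^ (-(1/2:ℝ)) ≤ 2 * ((Y:ℝ)/d) ^ (1/2:ℝ) := by
          refine h2.trans ?_
          rw [div_le_iff₀ (by norm_num)]; linarith
        calc _ ≤ (d:ℝ) ^ (-(1/2:ℝ)) * (2 * ((Y:ℝ)/d) ^ (1/2:ℝ)) := by gcongr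
          _ = 2 * (Y:ℝ) ^ (1/2:ℝ) * (d:ℝ)⁻¹ := by
            rw [Real.div_rpow (by positivity) hd0.le, Real.rpow_neg hd0.le]
            have : (d:ℝ)⁻¹ = ((d:ℝ) ^ (1/2:ℝ))⁻¹ * ((d:ℝ) ^ (1/2:ℝ))⁻¹ := by
              rw [← mul_inv, ← Real.rpow_add hd0]; norm_num
            rw [this]; ring
    _ ≤ _ := by
        rw [← Finset.mul_sum]
        gcongr
        exact sum_inv_le Y

lemma sum_rr_le_of_no_good (p : ℕ) [Fact p.Prime] (x Y : ℕ) (hY : 1 ≤ Y) (hx : x < p)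
    (hno : ∀ g : ℕ, 0 < g → g ≤ x → Good p g → g ≤ Y) :
    ∑ n ∈ Ioc 0 x, rr (chi p) n ≤ (x:ℝ) ^ (1/2:ℝ) * (2 * (Y:ℝ) ^ (1/2:ℝ) * (1 + Real.log Y)) := by
  classical
  set T := ((Ioc 0 Y) ×ˢ (Ioc 0 x)).filter (fun z => z.1 * z.2 ^ 2 ≤ x) with hT
  have h1 : ∑ n ∈ Ioc 0 x, rr (chi p) n ≤
      ∑ n ∈ Ioc 0 x, ∑ z ∈ T.filter (fun z => z.1 * z.2 ^ 2 = n), (z.1.divisors.card : ℝ) := by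
    refine Finset.sum_le_sum fun n hn => ?_
    rw [mem_Ioc] at hn
    by_cases h0 : rr (chi p) n = 0
    · rw [h0]; exact Finset.sum_nonneg fun _ _ => by positivity
    · obtain ⟨g, m, e, G, r⟩ := rr_structure p n hn.1 (by omega) h0
      have hg : 0 < g := Nat.pos_of_ne_zero (by rintro rfl; simp at e; omega)
      have hm : 0 < m := Nat.pos_of_ne_zero (by rintro rfl; simp at e; omega)
      have hgn : g ≤ n := by rw [e]; exact Nat.le_mul_of_pos_right g (by positivity)
      have hmn : m ≤ n := by rw [e]; nlinarith [Nat.mul_pos hg hm]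
      refine r.trans (Finset.single_le_sum (f := fun z : ℕ × ℕ => (z.1.divisors.card : ℝ))
        (fun _ _ => by positivity) (a := (g, m)) ?_)
      simp only [hT, mem_filter, mem_product, mem_Ioc]
      exact ⟨⟨⟨⟨hg, hno g hg (by omega) G⟩, hm, by omega⟩, by omega⟩, e.symm⟩
  have h2 : ∑ n ∈ Ioc 0 x, ∑ z ∈ T.filter (fun z => z.1 * z.2 ^ 2 = n), (z.1.divisors.card : ℝ) =
      ∑ z ∈ T, (z.1.divisors.card : ℝ) := by
    refine Finset.sum_fiberwise_of_maps_to (fun z hz => ?_) _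
    simp only [hT, mem_filter, mem_product, mem_Ioc] at hz ⊢
    exact ⟨Nat.mul_pos hz.1.1.1 (pow_pos hz.1.2.1 2), hz.2⟩
  have h3 : ∑ z ∈ T, (z.1.divisors.card : ℝ) = ∑ g ∈ Ioc 0 Y,
      ∑ m ∈ (Ioc 0 x).filter (fun m => g * m ^ 2 ≤ x), (g.divisors.card : ℝ) := by
    rw [hT, Finset.sum_filter, Finset.sum_product]
    refine Finset.sum_congr rfl fun g _ => ?_
    rw [Finset.sum_filter]
  have h4 : ∀ g ∈ Ioc 0 Y, ∑ m ∈ (Ioc 0 x).filter (fun m => g * m ^ 2 ≤ x), (g.divisors.card : ℝ) ≤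
      (x:ℝ) ^ (1/2:ℝ) * ((g.divisors.card : ℝ) * (g:ℝ) ^ (-(1/2:ℝ))) := by
    intro g hg
    rw [mem_Ioc] at hg
    have hg0 : (0:ℝ) < g := by exact_mod_cast hg.1
    rw [Finset.sum_const, nsmul_eq_mul]
    have hc : ((Ioc 0 x).filter (fun m => g * m ^ 2 ≤ x)).card ≤ (x/g).sqrt := by
      calc _ ≤ (Ioc 0 (x/g).sqrt).card := by
            refine Finset.card_le_card fun m hm => ?_
            simp only [mem_filter, mem_Ioc] at hm ⊢
            refine ⟨hm.1.1, ?_⟩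
            rw [Nat.le_sqrt', Nat.le_div_iff_mul_le hg.1, mul_comm]; exact hm.2
        _ = _ := by simp
    have hc2 : (((x/g).sqrt : ℕ):ℝ) ≤ (x:ℝ) ^ (1/2:ℝ) * (g:ℝ) ^ (-(1/2:ℝ)) := by
      rw [Real.rpow_neg hg0.le, ← div_eq_mul_inv, ← Real.div_rpow (by positivity) hg0.le,
        ← Real.sqrt_eq_rpow]
      refine Real.nat_sqrt_le_real_sqrt.trans (Real.sqrt_le_sqrt Nat.cast_div_le)
    have hc' : ((((Ioc 0 x).filter (fun m => g * m ^ 2 ≤ x)).card : ℕ):ℝ) ≤ (((x/g).sqrt : ℕ):ℝ) := by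
      exact_mod_cast hc
    calc _ ≤ ((x:ℝ) ^ (1/2:ℝ) * (g:ℝ) ^ (-(1/2:ℝ))) * (g.divisors.card : ℝ) := by
          gcongr; exact hc'.trans hc2
      _ = _ := by ring
  calc _ ≤ _ := h1
    _ = _ := h2
    _ = _ := h3
    _ ≤ _ := Finset.sum_le_sum h4
    _ = (x:ℝ) ^ (1/2:ℝ) * ∑ g ∈ Ioc 0 Y, (g.divisors.card : ℝ) * (g:ℝ) ^ (-(1/2:ℝ)) := by
        rw [Finset.mul_sum]
    _ ≤ _ := by gcongr; exact divisor_sum_bound Y hY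

theorem window {δ : ℝ} (hδ : 0 < δ) (hδ1 : δ ≤ 1/20) :
    ∃ p₀ : ℕ, ∀ (p : ℕ) (_ : Fact p.Prime), p₀ < p →
      ∃ n : ℕ, (p:ℝ) ^ (1/2 - δ) ≤ n ∧ (n:ℝ) ≤ (p:ℝ) ^ (1/2 + δ) ∧ Good p n := by
  obtain ⟨P1, hP1⟩ := siegel (c := δ/4) (by positivity) (by linarith)
  have hlim : Filter.Tendsto (fun t : ℝ => 13 * (t ^ (-(δ/4)) + Real.log t * t ^ (-(δ/4))))
      Filter.atTop (nhds (13 * (0 + 0))) :=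
    ((tendsto_rpow_neg_atTop (show 0 < δ/4 by positivity)).add
      (log_mul_rpow_neg_tendsto (show 0 < δ/4 by positivity))).const_mul _
  simp only [add_zero, mul_zero] at hlim
  have hev := (hlim.comp tendsto_natCast_atTop_atTop).eventually_lt_const zero_lt_one
  obtain ⟨P2, hP2⟩ := Filter.eventually_atTop.1 hev
  refine ⟨max (max P1 P2) 2, fun p hpF hp => ?_⟩
  have hp1 : P1 < p := lt_of_le_of_lt ((le_max_left _ _).trans (le_max_left _ _)) hp
  have hp2 : P2 ≤ p := (lt_of_le_of_lt ((le_max_right _ _).trans (le_max_left _ _)) hp).le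
  have hp3 : 2 < p := lt_of_le_of_lt (le_max_right _ _) hp
  have h13 := hP2 p hp2
  simp only [Function.comp] at h13
  have hL := hP1 p hpF hp1
  have hpr1 : (1:ℝ) ≤ p := by exact_mod_cast hpF.out.one_le
  have hpr1' : (1:ℝ) < p := by exact_mod_cast hpF.out.one_lt
  have hp0 : (0:ℝ) < p := by linarith
  by_contra hcon
  push Not at hcon
  set P := (p:ℝ) with hP
  obtain ⟨y1, y2, y3⟩ := floor_half (Real.one_le_rpow hpr1 (show 0 ≤ 1/2 - δ by linarith))
  obtain ⟨x1, x2, x3⟩ := floor_half (Real.one_le_rpow hpr1 (show 0 ≤ 1/2 + δ by linarith))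
  obtain ⟨u1, u2, u3⟩ := floor_half (Real.one_le_rpow hpr1 (show 0 ≤ 1/2 + δ/2 by linarith))
  set Y := ⌊P ^ (1/2 - δ)⌋₊
  set x := ⌊P ^ (1/2 + δ)⌋₊
  set u := ⌊P ^ (1/2 + δ/2)⌋₊
  have hx0 : (0:ℝ) < x := by exact_mod_cast x1
  have hu0 : (0:ℝ) < u := by exact_mod_cast u1
  have hY0 : (0:ℝ) < Y := by exact_mod_cast y1
  have hxp : x < p := by
    have : (x:ℝ) < p := by
      refine lt_of_le_of_lt x2 ?_
      calc P ^ (1/2 + δ) < P ^ (1:ℝ) := Real.rpow_lt_rpow_of_exponent_lt hpr1' (by linarith)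
        _ = p := Real.rpow_one _
    exact_mod_cast this
  have hsum := sum_rr_le_of_no_good p x Y y1 hxp (fun g hg hgx hG => by
    by_contra hgY
    push Not at hgY
    have h1 : P ^ (1/2 - δ) ≤ g := ((Nat.floor_lt (by positivity)).1 hgY).le
    exact hcon g h1 (le_trans (by exact_mod_cast hgx) x2) hG)
  have hLv := (abs_le.1 (Lv_le_sum_rr (polya_vinogradov p (by omega)) (chi_abs p) x u u1)).1
  have hlogp : 0 ≤ Real.log P := Real.log_nonneg hpr1
  have hlogY : Real.log Y ≤ Real.log P := by
    refine Real.log_le_log hY0 (y2.trans ?_)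
    calc P ^ (1/2 - δ) ≤ P ^ (1:ℝ) := Real.rpow_le_rpow_of_exponent_le hpr1 (by linarith)
      _ = P := Real.rpow_one _
  set l := 1 + Real.log P with hl
  have hl1 : 1 ≤ l := by linarith
  set w := P ^ (-(δ/2)) with hw
  have hw0 : 0 < w := by positivity
  -- three bounds
  have b1 : (x:ℝ) ^ (1/2:ℝ) * (2 * (Y:ℝ) ^ (1/2:ℝ) * (1 + Real.log Y)) ≤ x * (3 * w * l) := by
    have hYx : (Y:ℝ) ^ (1/2:ℝ) ≤ 3/2 * w * (x:ℝ) ^ (1/2:ℝ) := by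
      have k1 : (Y:ℝ) ≤ 9/4 * (w * w) * x := by
        have : P ^ (1/2 - δ) ≤ (w * w) * P ^ (1/2 + δ) := by
          rw [hw, ← Real.rpow_add hp0, ← Real.rpow_add hp0]
          exact Real.rpow_le_rpow_of_exponent_le hpr1 (by linarith)
        have k2 : (w * w) * P ^ (1/2 + δ) ≤ (w * w) * (2 * x) := by gcongr
        have k3 : 0 < w * w * x := by positivity
        linarith
      rw [← Real.sqrt_eq_rpow, ← Real.sqrt_eq_rpow]
      refine Real.sqrt_le_iff.2 ⟨by positivity, k1.trans (le_of_eq ?_)⟩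
      rw [mul_pow, Real.sq_sqrt hx0.le]; ring
    have e : (x:ℝ) ^ (1/2:ℝ) * (x:ℝ) ^ (1/2:ℝ) = x := by
      rw [← Real.rpow_add hx0]; norm_num
    have hl0 : 0 ≤ Real.log Y := Real.log_natCast_nonneg _
    calc _ ≤ (x:ℝ) ^ (1/2:ℝ) * (2 * (3/2 * w * (x:ℝ) ^ (1/2:ℝ)) * l) := by
          gcongr; linarith
      _ = ((x:ℝ) ^ (1/2:ℝ) * (x:ℝ) ^ (1/2:ℝ)) * (3 * w * l) := by ring
      _ = _ := by rw [e]
  have b2 : (u:ℝ) ≤ x * (2 * w * l) := by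
    calc (u:ℝ) ≤ P ^ (1/2 + δ/2) := u2
      _ = P ^ (1/2 + δ) * w := by rw [hw, ← Real.rpow_add hp0]; congr 1; ring
      _ ≤ 2 * x * w := by gcongr
      _ = x * (2 * w * 1) := by ring
      _ ≤ _ := by gcongr
  have b3 : 4 * (Real.sqrt P * l) * x / u ≤ x * (8 * w * l) := by
    rw [div_le_iff₀ hu0]
    have : Real.sqrt P ≤ 2 * w * u := by
      calc Real.sqrt P = w * P ^ (1/2 + δ/2) := by
            rw [hw, ← Real.rpow_add hp0, Real.sqrt_eq_rpow]; congr 1; ring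
        _ ≤ w * (2 * u) := by gcongr
        _ = _ := by ring
    calc 4 * (Real.sqrt P * l) * x ≤ 4 * ((2 * w * u) * l) * x := by gcongr
      _ = _ := by ring
  have h1 : (x:ℝ) * Lv (chi p) 1 ≤ x * (13 * w * l) := by linarith
  have h2 := le_of_mul_le_mul_left h1 hx0
  have h3 : P ^ (-(δ/4)) * 1 ≤ P ^ (-(δ/4)) * (13 * (P ^ (-(δ/4)) * l)) := by
    have e : w = P ^ (-(δ/4)) * P ^ (-(δ/4)) := by
      rw [hw, ← Real.rpow_add hp0]; congr 1; ring
    rw [e] at h2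
    linarith
  have h4 := le_of_mul_le_mul_left h3 (by positivity)
  have h5 : 13 * (P ^ (-(δ/4)) + Real.log P * P ^ (-(δ/4))) = 13 * (P ^ (-(δ/4)) * l) := by
    rw [hl]; ring
  linarith

/-- the prime discriminant attached to p -/
def dsc (p : ℕ) : ℤ := if p % 4 = 1 then (p:ℤ) else -(p:ℤ)

lemma recip (p q : ℕ) [Fact p.Prime] [Fact q.Prime] (hp : p ≠ 2) (hq : q ≠ 2) :
    legendreSym q (dsc p) = legendreSym p q := by
  have hp' : p % 4 = 1 ∨ p % 4 = 3 := by
    have := (Fact.out : p.Prime).mod_two_eq_one_iff_ne_two.2 hp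
    omega
  have hq' : q % 4 = 1 ∨ q % 4 = 3 := by
    have := (Fact.out : q.Prime).mod_two_eq_one_iff_ne_two.2 hq
    omega
  unfold dsc
  rcases hp' with h | h
  · rw [if_pos h, legendreSym.quadratic_reciprocity_one_mod_four h hq]
  · rw [if_neg (by omega), show -(p:ℤ) = (-1) * (p:ℤ) by ring, legendreSym.mul,
      legendreSym.at_neg_one hq]
    rcases hq' with h2 | h2
    · rw [ZMod.χ₄_nat_one_mod_four h2, one_mul,
        legendreSym.quadratic_reciprocity_one_mod_four h2 hp]
    · rw [ZMod.χ₄_nat_three_mod_four h2, legendreSym.quadratic_reciprocity_three_mod_four h h2]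
      ring

lemma sq_lift {q : ℕ} (hq : q.Prime) (hq2 : q ≠ 2) (D : ℤ) (hD : ¬ (q:ℤ) ∣ D)
    (h : ∃ b : ℤ, (q:ℤ) ∣ b ^ 2 - D) (k : ℕ) (hk : 0 < k) : ∃ b : ℤ, ((q:ℤ) ^ k) ∣ b ^ 2 - D := by
  have hqp : Prime (q:ℤ) := Nat.prime_iff_prime_int.1 hq
  induction k, hk using Nat.le_induction with
  | base => simpa using h
  | succ k hk ih =>
    obtain ⟨b, t, ht⟩ := ih
    have hk' : 1 ≤ k := hk
    have hqb : ¬ (q:ℤ) ∣ 2 * b := by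
      intro hd
      rcases hqp.dvd_or_dvd hd with h2 | h2
      · have : q ∣ 2 := by exact_mod_cast h2
        exact hq2 ((Nat.prime_dvd_prime_iff_eq hq Nat.prime_two).1 this)
      · apply hD
        have h3 : (q:ℤ) ∣ b ^ 2 - D := by rw [ht]; exact (dvd_pow_self _ (by omega)).mul_right _
        have h4 : (q:ℤ) ∣ b ^ 2 := dvd_pow h2 two_ne_zero
        simpa using dvd_sub h4 h3
    have hcop : IsCoprime (q:ℤ) (2 * b) := (Prime.coprime_iff_not_dvd hqp).2 hqb
    obtain ⟨r, s, hrs⟩ := hcop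
    refine ⟨b + (q:ℤ)^k * (-(t * s)), ?_⟩
    obtain ⟨j, hj⟩ : ∃ j, k = j + 1 := ⟨k - 1, by omega⟩
    refine ⟨t * r + (q:ℤ)^j * (t*s)^2, ?_⟩
    have e : (q:ℤ)^k = (q:ℤ)^j * q := by rw [hj, pow_succ]
    rw [pow_succ (q:ℤ) k, e]
    rw [e] at ht
    linear_combination ht + (q:ℤ)^j * q * t * (- hrs)

lemma sq_exists (D : ℤ) (n : ℕ) (hn : 0 < n) (h : ∀ q : ℕ, q.Prime → q ∣ n → q ≠ 2 ∧ ¬ (q:ℤ) ∣ D ∧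
    ∃ b : ℤ, (q:ℤ) ∣ b ^ 2 - D) : ∃ b : ℤ, (n:ℤ) ∣ b ^ 2 - D := by
  induction n using Nat.recOnPosPrimePosCoprime with
  | zero => omega
  | one => exact ⟨0, by simp⟩
  | prime_pow q k hq hk =>
    obtain ⟨h1, h2, h3⟩ := h q hq (dvd_pow_self q hk.ne')
    push_cast
    exact sq_lift hq h1 D h2 h3 k hk
  | coprime a b ha hb hab iha ihb =>
    obtain ⟨x, hx⟩ := iha (by omega) (fun q hq hd => h q hq (hd.mul_right b))
    obtain ⟨y, hy⟩ := ihb (by omega) (fun q hq hd => h q hq (hd.mul_left a))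
    have hc : IsCoprime (a:ℤ) (b:ℤ) := Nat.isCoprime_iff_coprime.2 hab
    obtain ⟨r, s, hrs⟩ := id hc
    -- z = x * s b + y * r a
    refine ⟨x * (s * b) + y * (r * a), ?_⟩
    push_cast
    refine hc.mul_dvd ?_ ?_
    · have e : (x * (s * b) + y * (r * a)) = x + a * (r * (y - x)) := by
        linear_combination x * hrs
      rw [e]
      have : (x + a * (r * (y - x))) ^ 2 - D = (x^2 - D) + a * (2 * x * (r * (y - x)) + a * (r * (y - x))^2) := by ring
      rw [this]
      exact dvd_add hx (Dvd.intro _ rfl)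
    · have e : (x * (s * b) + y * (r * a)) = y + b * (s * (x - y)) := by
        linear_combination y * hrs
      rw [e]
      have : (y + b * (s * (x - y))) ^ 2 - D = (y^2 - D) + b * (2 * y * (s * (x - y)) + b * (s * (x - y))^2) := by ring
      rw [this]
      exact dvd_add hy (Dvd.intro _ rfl)

lemma two_lift (p : ℕ) (hp : p % 8 = 7) (k : ℕ) (hk : 3 ≤ k) :
    ∃ b t : ℤ, b ^ 2 + p = 2 ^ k * t ∧ b % 2 = 1 ∧ t % 2 = 1 := by
  have fix : ∀ j : ℕ, 3 ≤ j → ∀ b t : ℤ, b ^ 2 + p = 2 ^ j * t → b % 2 = 1 →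
      ∃ b' t' : ℤ, b' ^ 2 + p = 2 ^ j * t' ∧ b' % 2 = 1 ∧ t' % 2 ≠ t % 2 := by
    intro j hj b t h hb
    obtain ⟨i, rfl⟩ : ∃ i, j = i + 3 := ⟨j - 3, by omega⟩
    refine ⟨b + 2 ^ (i+2), t + b + 2 ^ (i+1), ?_, ?_, ?_⟩
    · have e0 : (2:ℤ) ^ (i+3) = 2^i * 8 := by rw [pow_add]; norm_num
      have e1 : (2:ℤ) ^ (i+2) = 2^i * 4 := by rw [pow_add]; norm_num
      have e2 : (2:ℤ) ^ (i+1) = 2^i * 2 := by rw [pow_add]; norm_num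
      rw [e0] at h
      rw [e0, e1, e2]
      linear_combination h
    · rw [pow_succ]; omega
    · rw [pow_succ]; omega
  have main : ∃ b t : ℤ, b ^ 2 + p = 2 ^ k * t ∧ b % 2 = 1 := by
    induction k, hk using Nat.le_induction with
    | base =>
      refine ⟨1, (p+1)/8, ?_, by norm_num⟩
      omega
    | succ j hj ih =>
      obtain ⟨b, t, h1, h2⟩ := ih
      have : ∃ b t : ℤ, b ^ 2 + p = 2 ^ j * t ∧ b % 2 = 1 ∧ t % 2 = 0 := by
        by_cases ht : t % 2 = 0
        · exact ⟨b, t, h1, h2, ht⟩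
        · obtain ⟨b', t', k1, k2, k3⟩ := fix j hj b t h1 h2
          exact ⟨b', t', k1, k2, by omega⟩
      obtain ⟨b, t, h1, h2, h3⟩ := this
      refine ⟨b, t / 2, ?_, h2⟩
      rw [h1, pow_succ, mul_assoc]
      congr 1
      omega
  obtain ⟨b, t, h1, h2⟩ := main
  by_cases ht : t % 2 = 1
  · exact ⟨b, t, h1, h2, ht⟩
  · obtain ⟨b', t', k1, k2, k3⟩ := fix k hk b t h1 h2
    exact ⟨b', t', k1, k2, by omega⟩

/-- The forms needed for the counting argument. -/
def FormData (p : ℕ) (B lo : ℝ) (n b c : ℕ) : Prop :=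
  0 < n ∧ c % 2 = 1 ∧ (b:ℤ)^2 - n * c = dsc p ∧ (n:ℝ) ≤ B ∧ (b:ℝ) ≤ B ∧ (c:ℝ) ≤ B ∧
    lo ≤ (n:ℝ) + b

lemma form_case1 (p : ℕ) (hp : p % 4 = 1) : ∃ n b c : ℕ,
    FormData p (9 * Real.sqrt p) (Real.sqrt p) n b c := by
  have hp1 : (1:ℝ) ≤ p := by exact_mod_cast (show 1 ≤ p by omega)
  have hs1 : 1 ≤ Real.sqrt p := Real.one_le_sqrt.2 hp1
  set r := p.sqrt with hr
  have r1 : r * r ≤ p := Nat.sqrt_le p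
  have r2 : p < (r+1) * (r+1) := Nat.sqrt_lt.1 (Nat.lt_succ_self _)
  have r3 : (r:ℝ) ≤ Real.sqrt p := Real.nat_sqrt_le_real_sqrt
  obtain ⟨k, hk1, hk2⟩ : ∃ k : ℕ, r + 1 ≤ 2 * k ∧ 2 * k ≤ r + 2 := ⟨(r+2)/2, by omega, by omega⟩
  have hbp : p < (2*k)*(2*k) := lt_of_lt_of_le r2 (Nat.mul_le_mul hk1 hk1)
  have hub : (2*k)*(2*k) ≤ (r+2)*(r+2) := Nat.mul_le_mul hk2 hk2
  have hb1 : ((2*k:ℕ):ℝ) ≤ r + 2 := by exact_mod_cast hk2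
  refine ⟨1, 2*k, (2*k)*(2*k) - p, one_pos, ?_, ?_, ?_, ?_, ?_, ?_⟩
  · have : (2*k)*(2*k) = 4 * (k*k) := by ring
    omega
  · rw [dsc, if_pos hp, Nat.cast_sub hbp.le]; push_cast; ring
  · push_cast; linarith
  · linarith
  · have : (2*k)*(2*k) - p ≤ 4 * r + 4 := by
      have : (r+2)*(r+2) = r*r + 4 * r + 4 := by ring
      omega
    have h2 : (((2*k)*(2*k) - p : ℕ):ℝ) ≤ 4 * r + 4 := by exact_mod_cast this
    linarith
  · have h3 : Real.sqrt p ≤ ((2*k:ℕ):ℝ) := by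
      rw [Real.sqrt_le_iff]
      refine ⟨by positivity, ?_⟩
      rw [sq]; exact_mod_cast hbp.le
    push_cast at *; linarith

lemma form_case3 (p : ℕ) [Fact p.Prime] (hp : p % 8 = 3) (δ : ℝ) (n : ℕ) (h1 : (p:ℝ) ^ (1/2 - δ) ≤ n)
    (h2 : (n:ℝ) ≤ (p:ℝ) ^ (1/2 + δ)) (hG : Good p n) : ∃ b c : ℕ,
    FormData p (9 * (p:ℝ) ^ (1/2 + δ)) ((p:ℝ) ^ (1/2 - δ)) n b c := by
  have hpp := (Fact.out : p.Prime)
  have hp0 : (0:ℝ) < p := by exact_mod_cast hpp.pos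
  have hp2 : p ≠ 2 := by omega
  have hn0' : (0:ℝ) < n := lt_of_lt_of_le (by positivity) h1
  have hn0 : 0 < n := by exact_mod_cast hn0'
  have hdsc : dsc p = -(p:ℤ) := by rw [dsc, if_neg (by omega)]
  have hG' : ∀ q : ℕ, q.Prime → q ∣ n → q ≠ 2 ∧ ¬ (q:ℤ) ∣ dsc p ∧
      ∃ b : ℤ, (q:ℤ) ∣ b ^ 2 - dsc p := by
    intro q hq hd
    have hc := hG q hq hd
    have hc' : legendreSym p q = 1 := by unfold chi at hc; exact_mod_cast hc
    have : Fact q.Prime := ⟨hq⟩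
    have hq2 : q ≠ 2 := by
      rintro rfl
      have h3 := legendreSym.at_two (p := p) hp2
      rw [ZMod.χ₈_nat_eq_if_mod_eight, if_neg (by omega), if_neg (by omega)] at h3
      rw [show ((2:ℕ):ℤ) = 2 by norm_num, h3] at hc'
      norm_num at hc'
    have hr := recip p q hp2 hq2
    rw [hc'] at hr
    have hnz : ((dsc p : ℤ) : ZMod q) ≠ 0 := by
      intro h0
      rw [(legendreSym.eq_zero_iff q _).2 h0] at hr
      norm_num at hr
    refine ⟨hq2, ?_, ?_⟩
    · rwa [← ZMod.intCast_zmod_eq_zero_iff_dvd] 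
    · obtain ⟨y, hy⟩ := (legendreSym.eq_one_iff q hnz).1 hr
      refine ⟨(y.val : ℤ), ?_⟩
      rw [← ZMod.intCast_zmod_eq_zero_iff_dvd]
      push_cast
      rw [ZMod.natCast_zmod_val, hy]; ring
  have hodd : n % 2 = 1 := by
    by_contra hcon
    exact (hG' 2 Nat.prime_two (by omega)).1 rfl
  obtain ⟨b, hb⟩ := sq_exists (dsc p) n hn0 hG'
  obtain ⟨B, hB0, hB1, hB2, hB3⟩ : ∃ B : ℤ, 0 ≤ B ∧ B ≤ 2 * n ∧ B % 2 = 0 ∧ (n:ℤ) ∣ B ^ 2 - dsc p := by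
    have hnz : (0:ℤ) < n := by exact_mod_cast hn0
    have e1 := Int.emod_nonneg b hnz.ne'
    have e2 := Int.emod_lt_of_pos b hnz
    have e3 := Int.emod_add_mul_ediv b n
    have d1 : (n:ℤ) ∣ (b % n) ^ 2 - dsc p := by
      have : (b % n) ^ 2 - dsc p = (b^2 - dsc p) - n * ((b/n) * (b + b % n)) := by
        linear_combination (b % n + b) * e3
      rw [this]; exact dvd_sub hb (Dvd.intro _ rfl)
    by_cases hpar : (b % n) % 2 = 0
    · exact ⟨b % n, e1, by omega, hpar, d1⟩
    · refine ⟨b % n + n, by omega, by omega, by omega, ?_⟩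
      have : (b % n + n) ^ 2 - dsc p = ((b % n)^2 - dsc p) + n * (2 * (b % n) + n) := by ring
      rw [this]; exact dvd_add d1 (Dvd.intro _ rfl)
  obtain ⟨B, rfl⟩ := Int.eq_ofNat_of_zero_le hB0
  obtain ⟨C, hC⟩ := hB3
  rw [hdsc] at hC
  have hCpos : 0 < C := by
    have hp' : (0:ℤ) < p := by exact_mod_cast hpp.pos
    have : 0 < (n:ℤ) * C := by rw [← hC]; nlinarith [sq_nonneg (B:ℤ)]
    exact pos_of_mul_pos_right this (by positivity)
  obtain ⟨C, rfl⟩ := Int.eq_ofNat_of_zero_le hCpos.le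
  have hCn : B ^ 2 + p = n * C := by
    have : ((B ^ 2 + p : ℕ):ℤ) = ((n * C : ℕ):ℤ) := by push_cast; linarith
    exact_mod_cast this
  have hB1' : B ≤ 2 * n := by exact_mod_cast hB1
  have hB1r : (B:ℝ) ≤ 2 * n := by exact_mod_cast hB1'
  have hX : 0 < (p:ℝ) ^ (1/2 + δ) := by positivity
  refine ⟨B, C, hn0, ?_, ?_, by linarith, by linarith, ?_, ?_⟩
  · obtain ⟨k, hk⟩ : ∃ k, B = 2 * k := ⟨B / 2, by omega⟩
    by_contra hcon
    obtain ⟨j, hj⟩ : ∃ j, C = 2 * j := ⟨C / 2, by omega⟩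
    rw [hk, hj] at hCn
    have e1 : (2*k)^2 = 2 * (2 * k^2) := by ring
    have e2 : n * (2 * j) = 2 * (n * j) := by ring
    rw [e1, e2] at hCn
    omega
  · rw [hdsc]
    have : ((B ^ 2 + p : ℕ):ℤ) = ((n * C : ℕ):ℤ) := by rw [hCn]
    push_cast at this; linarith
  · have hCr : (B:ℝ)^2 + p = n * C := by exact_mod_cast hCn
    have h3 : (p:ℝ) ≤ (p:ℝ) ^ (1/2 + δ) * n := by
      calc (p:ℝ) = (p:ℝ) ^ (1/2 + δ) * (p:ℝ) ^ (1/2 - δ) := by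
            rw [← Real.rpow_add hp0]; ring_nf; rw [Real.rpow_one]
        _ ≤ _ := by gcongr
    have h4 : (n:ℝ) * C ≤ n * (9 * (p:ℝ) ^ (1/2 + δ)) := by
      rw [← hCr]
      have h5 : (B:ℝ)^2 ≤ (2*n)^2 := by gcongr
      have h6 : (n:ℝ) * n ≤ n * (p:ℝ) ^ (1/2 + δ) := by gcongr
      nlinarith
    exact le_of_mul_le_mul_left h4 hn0'
  · have : (0:ℝ) ≤ B := by positivity
    linarith

lemma form_case7 (p : ℕ) (hp : p % 8 = 7) (hbig : 1000 < p) : ∃ n b c : ℕ,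
    FormData p (9 * Real.sqrt p) (Real.sqrt p / 4) n b c := by
  have hp0 : (0:ℝ) < p := by exact_mod_cast (show 0 < p by omega)
  have hs0 : 0 < Real.sqrt p := Real.sqrt_pos.2 hp0
  have hdsc : dsc p = -(p:ℤ) := by rw [dsc, if_neg (by omega)]
  set r := p.sqrt with hr
  have r0 : 8 ≤ r := by rw [hr, Nat.le_sqrt]; omega
  have r2 : p < (r+1) * (r+1) := Nat.sqrt_lt.1 (Nat.lt_succ_self _)
  have r3 : (r:ℝ) ≤ Real.sqrt p := Real.nat_sqrt_le_real_sqrt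
  set k := Nat.log 2 r with hk
  have hk3 : 3 ≤ k := (Nat.le_log_iff_pow_le (by norm_num) (by omega)).2 (by omega)
  have hn1 : 2 ^ k ≤ r := Nat.pow_log_le_self 2 (by omega)
  have hn2 : r < 2 ^ (k+1) := Nat.lt_pow_succ_log_self (by norm_num) r
  obtain ⟨b, t, h1, hb, ht⟩ := two_lift p hp k hk3
  have hnz : (0:ℤ) < 2 ^ k := by positivity
  have e1 := Int.emod_nonneg b hnz.ne'
  have e2 := Int.emod_lt_of_pos b hnz
  have e3 := Int.emod_add_mul_ediv b (2^k)
  obtain ⟨B, hB⟩ := Int.eq_ofNat_of_zero_le e1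
  rw [hB] at e2 e3
  set m := b / 2^k
  have hC : (B:ℤ)^2 + p = 2^k * (t - 2 * (m * B) - 2^k * (m * m)) := by
    rw [← e3] at h1
    linear_combination h1
  have hCpos : 0 < t - 2 * (m * B) - 2^k * (m * m) := by
    have hp' : (0:ℤ) < p := by exact_mod_cast (show 0 < p by omega)
    have : 0 < (2:ℤ)^k * (t - 2 * (m * B) - 2^k * (m * m)) := by rw [← hC]; nlinarith [sq_nonneg (B:ℤ)]
    exact pos_of_mul_pos_right this (by positivity)
  have hCodd : (t - 2 * (m * B) - 2^k * (m * m)) % 2 = 1 := by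
    obtain ⟨i, hi⟩ : ∃ i, k = i + 1 := ⟨k - 1, by omega⟩
    have : (2:ℤ)^k * (m * m) = 2 * (2^i * (m*m)) := by rw [hi, pow_succ]; ring
    rw [this]; omega
  obtain ⟨C, hCe⟩ := Int.eq_ofNat_of_zero_le hCpos.le
  rw [hCe] at hC hCodd
  have hn1r : ((2^k:ℕ):ℝ) ≤ Real.sqrt p := le_trans (by exact_mod_cast hn1) r3
  have hn2r : Real.sqrt p ≤ 2 * ((2^k:ℕ):ℝ) := by
    rw [Real.sqrt_le_iff]
    refine ⟨by positivity, ?_⟩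
    have : p ≤ (2 * 2^k)^2 := by
      have : r + 1 ≤ 2 * 2^k := by rw [pow_succ] at hn2; omega
      rw [sq]; exact r2.le.trans (Nat.mul_le_mul this this)
    exact_mod_cast this
  have hBn : B ≤ 2^k := by
    have : (B:ℤ) < ((2^k:ℕ):ℤ) := by push_cast; exact e2
    exact_mod_cast this.le
  have hBr : (B:ℝ) ≤ ((2^k:ℕ):ℝ) := by exact_mod_cast hBn
  have hCr : (B:ℝ)^2 + p = ((2^k:ℕ):ℝ) * C := by
    have : B^2 + p = 2^k * C := by exact_mod_cast hC
    exact_mod_cast this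
  have hnpos : (0:ℝ) < ((2^k:ℕ):ℝ) := by positivity
  refine ⟨2^k, B, C, by positivity, by omega, ?_, by linarith, by linarith, ?_, ?_⟩
  · rw [hdsc]; push_cast; linarith
  · have hsq := Real.mul_self_sqrt hp0.le
    have h4 : ((2^k:ℕ):ℝ) * C ≤ ((2^k:ℕ):ℝ) * (9 * Real.sqrt p) := by
      rw [← hCr]
      have h5 : (B:ℝ)^2 ≤ ((2^k:ℕ):ℝ)^2 := by gcongr
      have h6 : ((2^k:ℕ):ℝ)^2 ≤ ((2^k:ℕ):ℝ) * Real.sqrt p := by rw [sq]; gcongr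
      have h7 : Real.sqrt p * Real.sqrt p ≤ (2 * ((2^k:ℕ):ℝ)) * Real.sqrt p := by gcongr
      nlinarith
    exact le_of_mul_le_mul_left h4 hnpos
  · have : (0:ℝ) ≤ B := by positivity
    linarith

theorem forms {δ : ℝ} (hδ : 0 < δ) (hδ1 : δ ≤ 1/20) :
    ∃ p₀ : ℕ, ∀ (p : ℕ) (_ : Fact p.Prime), p₀ < p →
      ∃ n b c : ℕ, FormData p (9 * (p:ℝ) ^ (1/2 + δ)) ((p:ℝ) ^ (1/2 - δ) / 4) n b c := by
  obtain ⟨P, hP⟩ := window hδ hδ1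
  refine ⟨max P 1000, fun p hpF hp => ?_⟩
  have hp1 : P < p := lt_of_le_of_lt (le_max_left _ _) hp
  have hp2 : 1000 < p := lt_of_le_of_lt (le_max_right _ _) hp
  have hpr1 : (1:ℝ) ≤ p := by exact_mod_cast hpF.out.one_le
  have hup : Real.sqrt p ≤ (p:ℝ) ^ (1/2 + δ) := by
    rw [Real.sqrt_eq_rpow]; exact Real.rpow_le_rpow_of_exponent_le hpr1 (by linarith)
  have hlo : (p:ℝ) ^ (1/2 - δ) ≤ Real.sqrt p := by
    rw [Real.sqrt_eq_rpow]; exact Real.rpow_le_rpow_of_exponent_le hpr1 (by linarith)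
  have hlo0 : 0 < (p:ℝ) ^ (1/2 - δ) := by positivity
  have hodd := hpF.out.mod_two_eq_one_iff_ne_two.2 (by omega)
  have hmod : p % 4 = 1 ∨ p % 8 = 3 ∨ p % 8 = 7 := by omega
  rcases hmod with h | h | h
  · obtain ⟨n, b, c, h1, h2, h3, h4, h5, h6, h7⟩ := form_case1 p h
    exact ⟨n, b, c, h1, h2, h3, by linarith, by linarith, by linarith, by linarith⟩
  · obtain ⟨n, w1, w2, w3⟩ := hP p hpF hp1
    obtain ⟨b, c, h1, h2, h3, h4, h5, h6, h7⟩ := form_case3 p h δ n w1 w2 w3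
    exact ⟨n, b, c, h1, h2, h3, by linarith, by linarith, by linarith, by linarith⟩
  · obtain ⟨n, b, c, h1, h2, h3, h4, h5, h6, h7⟩ := form_case7 p h hp2
    exact ⟨n, b, c, h1, h2, h3, by linarith, by linarith, by linarith, by linarith⟩

/-- the values of the quadratic form at even arguments -/
def fv (n b c j : ℕ) : ℕ := 4 * n * j ^ 2 + 4 * b * j + c

lemma fv_prime {p n b c j q : ℕ} (hp : p.Prime) (hp2 : p ≠ 2) (hc : c % 2 = 1)
    (hD : (b:ℤ)^2 - n * c = dsc p) (hlt : fv n b c j < p) (hpos : 0 < fv n b c j)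
    (hq : q.Prime) (hqd : q ∣ fv n b c j) :
    q ≠ 2 ∧ ¬ (q:ℤ) ∣ dsc p ∧ ∃ x : ℤ, x ^ 2 ≡ (q:ℤ) [ZMOD (p:ℤ)] := by
  have := Fact.mk hp
  have := Fact.mk hq
  have h2 : q ≠ 2 := by
    rintro rfl
    have h3 : fv n b c j = 2 * (2 * n * j^2 + 2 * b * j) + c := by unfold fv; ring
    omega
  have hqp : q < p := lt_of_le_of_lt (Nat.le_of_dvd hpos hqd) hlt
  have h3 : ¬ (q:ℤ) ∣ dsc p := by
    intro h
    have h4 : (q:ℤ) ∣ p := by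
      unfold dsc at h
      split_ifs at h
      · exact h
      · simpa using h
    have h5 : q ∣ p := by exact_mod_cast h4
    exact hqp.ne ((Nat.prime_dvd_prime_iff_eq hq hp).1 h5)
  refine ⟨h2, h3, ?_⟩
  have hne : ((dsc p : ℤ) : ZMod q) ≠ 0 := by
    rw [Ne, ZMod.intCast_zmod_eq_zero_iff_dvd]; exact h3
  have hsq : legendreSym q (dsc p) = 1 := by
    rw [legendreSym.eq_one_iff q hne]
    refine ⟨((2 * j * n + b : ℤ) : ZMod q), ?_⟩
    have h4 : (2 * j * n + b : ℤ) * (2 * j * n + b) = dsc p + n * (fv n b c j : ℕ) := by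
      rw [← hD]; unfold fv; push_cast; ring
    have h5 : ((fv n b c j : ℕ) : ZMod q) = 0 := (ZMod.natCast_eq_zero_iff _ _).2 hqd
    have h6 := congrArg (Int.cast : ℤ → ZMod q) h4
    push_cast at h6
    rw [h5] at h6
    push_cast
    rw [h6]; ring
  rw [recip p q hp2 h2] at hsq
  have hne2 : (((q:ℤ)) : ZMod p) ≠ 0 := by
    rw [Ne, ZMod.intCast_zmod_eq_zero_iff_dvd]
    intro h
    have : p ∣ q := by exact_mod_cast h
    exact absurd (Nat.le_of_dvd hq.pos this) (by omega)
  rw [legendreSym.eq_one_iff p hne2] at hsq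
  obtain ⟨y, hy⟩ := hsq
  obtain ⟨x, rfl⟩ := ZMod.intCast_surjective y
  refine ⟨x, ?_⟩
  rw [← ZMod.intCast_eq_intCast_iff, hy]
  push_cast; ring

lemma card_cong (N d : ℕ) (hd : 0 < d) (a : ℕ) :
    #((Ioc 0 N).filter (fun j : ℕ => (d:ℤ) ∣ (j:ℤ) - a)) ≤ N / d + 1 := by
  calc _ ≤ #(range (N / d + 1)) := by
        apply Finset.card_le_card_of_injOn (fun j => j / d)
        · intro j hj
          simp only [coe_filter, Set.mem_setOf_eq, mem_Ioc] at hj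
          simp only [coe_range, Set.mem_Iio]
          have := Nat.div_le_div_right (c := d) hj.1.2
          omega
        · intro j hj k hk hjk
          simp only [coe_filter, Set.mem_setOf_eq, mem_Ioc] at hj hk hjk
          have h1 : (d:ℤ) ∣ (j:ℤ) - k := by
            have := dvd_sub hj.2 hk.2
            simpa using this
          have h2 : k ≡ j [MOD d] := (Nat.modEq_iff_dvd).2 h1
          have h3 := Nat.div_add_mod j d
          have h4 := Nat.div_add_mod k d
          unfold Nat.ModEq at h2
          rw [← h3, ← h4, hjk, h2]
    _ = _ := by simp

lemma fv_count {p n b c : ℕ} (hD : (b:ℤ)^2 - n * c = dsc p) {q k : ℕ} (hq : q.Prime)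
    (hk : 0 < k) (hq2 : q ≠ 2) (hqD : ¬ (q:ℤ) ∣ dsc p) (N : ℕ) :
    #{j ∈ Ioc 0 N | q ^ k ∣ fv n b c j} ≤ 2 * (N / q ^ k + 1) := by
  classical
  have hqp : Prime (q:ℤ) := Nat.prime_iff_prime_int.1 hq
  have hd : 0 < q ^ k := pow_pos hq.pos k
  by_cases hne : ({j ∈ Ioc 0 N | q ^ k ∣ fv n b c j}).Nonempty
  swap
  · rw [Finset.not_nonempty_iff_eq_empty] at hne
    rw [hne]; simp
  obtain ⟨j0, hj0⟩ := hne
  rw [mem_filter] at hj0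
  have key : ∀ j, q ^ k ∣ fv n b c j → ((q^k : ℕ):ℤ) ∣ (j:ℤ) - j0 ∨
      (¬ (q:ℤ) ∣ n ∧ ((q^k : ℕ):ℤ) ∣ (n:ℤ) * (j + j0) + b) := by
    intro j hj
    have h1 : ((q^k : ℕ):ℤ) ∣ (fv n b c j : ℕ) := by exact_mod_cast hj
    have h2 : ((q^k : ℕ):ℤ) ∣ (fv n b c j0 : ℕ) := by exact_mod_cast hj0.2
    have h3 : ((fv n b c j : ℕ):ℤ) - (fv n b c j0 : ℕ) = 2 * (2 * (((j:ℤ) - j0) * (n * (j + j0) + b))) := by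
      unfold fv; push_cast; ring
    have h4 := dvd_sub h1 h2
    rw [h3] at h4
    have hc2 : IsCoprime ((q^k : ℕ):ℤ) 2 := by
      push_cast
      apply IsCoprime.pow_left
      rw [Prime.coprime_iff_not_dvd hqp]
      intro h
      have : q ∣ 2 := by exact_mod_cast h
      exact hq2 ((Nat.prime_dvd_prime_iff_eq hq Nat.prime_two).1 this)
    have h5 := hc2.dvd_of_dvd_mul_left (hc2.dvd_of_dvd_mul_left h4)
    have hqk : (q:ℤ) ∣ ((q^k : ℕ):ℤ) := by push_cast; exact dvd_pow_self _ hk.ne'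
    by_cases hA : (q:ℤ) ∣ (n:ℤ) * (j + j0) + b
    · right
      have hB : ¬ (q:ℤ) ∣ (j:ℤ) - j0 := by
        intro hB
        apply hqD
        have h6 : (q:ℤ) ∣ 2 * j * n + b := by
          have : (2 * j * n + b : ℤ) = (n * (j + j0) + b) + n * (j - j0) := by ring
          rw [this]; exact dvd_add hA (hB.mul_left _)
        have h7 : dsc p = (2 * j * n + b : ℤ) * (2 * j * n + b) - n * (fv n b c j : ℕ) := by
          rw [← hD]; unfold fv; push_cast; ring
        rw [h7]
        exact dvd_sub (h6.mul_left _) ((hqk.trans h1).mul_left _)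
      constructor
      · intro hn
        apply hqD
        have h6 : (q:ℤ) ∣ b := by
          have := dvd_sub hA (hn.mul_right ((j:ℤ) + j0))
          simpa using this
        rw [← hD]
        exact dvd_sub (dvd_pow h6 two_ne_zero) (hn.mul_right _)
      · have : IsCoprime ((q^k : ℕ):ℤ) ((j:ℤ) - j0) := by
          push_cast
          exact IsCoprime.pow_left ((Prime.coprime_iff_not_dvd hqp).2 hB)
        exact this.dvd_of_dvd_mul_left h5
    · left
      have : IsCoprime ((q^k : ℕ):ℤ) ((n:ℤ) * (j + j0) + b) := by
        push_cast
        exact IsCoprime.pow_left ((Prime.coprime_iff_not_dvd hqp).2 hA)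
      exact this.dvd_of_dvd_mul_right h5
  have hex : ∃ j1 : ℕ, ∀ j, q ^ k ∣ fv n b c j → ((q^k : ℕ):ℤ) ∣ (j:ℤ) - j0 ∨
      ((q^k : ℕ):ℤ) ∣ (j:ℤ) - j1 := by
    by_cases h : ∃ j1 : ℕ, (¬ (q:ℤ) ∣ n ∧ ((q^k : ℕ):ℤ) ∣ (n:ℤ) * (j1 + j0) + b)
    · obtain ⟨j1, hn, h1⟩ := h
      refine ⟨j1, fun j hj => (key j hj).imp id ?_⟩
      rintro ⟨-, h2⟩
      have h3 := dvd_sub h2 h1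
      have e : ((n:ℤ) * (j + j0) + b) - (n * (j1 + j0) + b) = n * (j - j1) := by ring
      rw [e] at h3
      have : IsCoprime ((q^k : ℕ):ℤ) (n:ℤ) := by
        push_cast
        exact IsCoprime.pow_left ((Prime.coprime_iff_not_dvd hqp).2 hn)
      exact this.dvd_of_dvd_mul_left h3
    · exact ⟨0, fun j hj => (key j hj).imp id (fun h' => absurd ⟨j, h'⟩ h)⟩
  obtain ⟨j1, hj1⟩ := hex
  calc _ ≤ #((Ioc 0 N).filter (fun j : ℕ => ((q^k : ℕ):ℤ) ∣ (j:ℤ) - j0) ∪ (Ioc 0 N).filter (fun j : ℕ => ((q^k : ℕ):ℤ) ∣ (j:ℤ) - j1)) := by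
        apply card_le_card
        intro j hj
        rw [mem_filter] at hj
        rw [mem_union, mem_filter, mem_filter]
        exact (hj1 j hj.2).imp (fun h => ⟨hj.1, h⟩) (fun h => ⟨hj.1, h⟩)
    _ ≤ _ := card_union_le _ _
    _ ≤ (N / q^k + 1) + (N / q^k + 1) := add_le_add (card_cong N _ hd j0) (card_cong N _ hd j1)
    _ = _ := by ring

open ArithmeticFunction in
lemma sum_log_swap (f : ℕ → ℕ) (s D : Finset ℕ) 
    (h : ∀ j ∈ s, f j ≠ 0 ∧ ∀ d, d ∣ f j → vonMangoldt d ≠ 0 → d ∈ D) :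
    ∑ j ∈ s, Real.log (f j) = ∑ d ∈ D, vonMangoldt d * #{j ∈ s | d ∣ f j} := by
  have h1 : ∀ j ∈ s, Real.log (f j) = ∑ d ∈ D, if d ∣ f j then vonMangoldt d else 0 := by
    intro j hj
    obtain ⟨h0, hd⟩ := h j hj
    rw [← vonMangoldt_sum, ← Finset.sum_filter]
    symm
    apply Finset.sum_subset_zero_on_sdiff (s₁ := {d ∈ D | d ∣ f j})
    · intro d hd
      rw [mem_filter] at hd
      exact Nat.mem_divisors.2 ⟨hd.2, h0⟩
    · intro d hd'
      rw [mem_sdiff, mem_filter, Nat.mem_divisors] at hd'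
      by_contra hne
      exact hd'.2 ⟨hd d hd'.1.1 hne, hd'.1.1⟩
    · intros; rfl
  rw [Finset.sum_congr rfl h1, Finset.sum_comm]
  apply Finset.sum_congr rfl
  intro d _
  rw [← Finset.sum_filter, Finset.sum_const, nsmul_eq_mul, mul_comm]

open ArithmeticFunction in
lemma mertens (Q : ℕ) (hQ : 1 ≤ Q) :
    ∑ d ∈ Ioc 0 Q, vonMangoldt d / d ≤ Real.log Q + (Real.log 4 + 4) := by
  have hQ0 : (0:ℝ) < Q := by exact_mod_cast hQ
  have h1 := sum_log_swap (fun j => j) (Ioc 0 Q) (Ioc 0 Q) (by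
    intro j hj
    rw [mem_Ioc] at hj
    refine ⟨by omega, fun d hd _ => ?_⟩
    have := Nat.le_of_dvd hj.1 hd
    have := Nat.pos_of_dvd_of_pos hd hj.1
    rw [mem_Ioc]; omega)
  have h2 : ∑ j ∈ Ioc 0 Q, Real.log j ≤ Q * Real.log Q := by
    calc _ ≤ ∑ j ∈ Ioc 0 Q, Real.log Q := by
          apply Finset.sum_le_sum
          intro j hj
          rw [mem_Ioc] at hj
          apply Real.log_le_log
          · exact_mod_cast hj.1
          · exact_mod_cast hj.2
      _ = _ := by simp
  have h3 : ∑ d ∈ Ioc 0 Q, vonMangoldt d ≤ (Real.log 4 + 4) * Q := by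
    have := Chebyshev.psi_le_const_mul_self (x := Q) hQ0.le
    simpa [Chebyshev.psi] using this
  have h4 : Q * ∑ d ∈ Ioc 0 Q, vonMangoldt d / d ≤ Q * Real.log Q + (Real.log 4 + 4) * Q := by
    calc _ ≤ ∑ d ∈ Ioc 0 Q, (vonMangoldt d * #{j ∈ Ioc 0 Q | d ∣ j} + vonMangoldt d) := by
          rw [Finset.mul_sum]
          apply Finset.sum_le_sum
          intro d hd
          rw [mem_Ioc] at hd
          have hd0 : (0:ℝ) < d := by exact_mod_cast hd.1
          rw [Nat.Ioc_filter_dvd_card_eq_div]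
          have : (Q:ℝ) / d ≤ (Q / d : ℕ) + 1 := by
            rw [← Nat.floor_div_eq_div (K := ℝ)]
            exact (Nat.lt_floor_add_one _).le
          calc (Q:ℝ) * (vonMangoldt d / d) = vonMangoldt d * (Q / d) := by ring
            _ ≤ vonMangoldt d * ((Q / d : ℕ) + 1) := mul_le_mul_of_nonneg_left this vonMangoldt_nonneg
            _ = _ := by ring
      _ ≤ _ := by
          rw [Finset.sum_add_distrib, ← h1]
          exact add_le_add h2 h3
  have h5 : Q * ∑ d ∈ Ioc 0 Q, vonMangoldt d / d ≤ Q * (Real.log Q + (Real.log 4 + 4)) := by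
    linarith
  exact le_of_mul_le_mul_left h5 hQ0

open ArithmeticFunction in
/-- prime powers below `p` of primes in `T` -/
noncomputable def ppw (p : ℕ) (T : Finset ℕ) : Finset ℕ := by
  classical
  exact {d ∈ range p | IsPrimePow d ∧ d.minFac ∈ T}

open ArithmeticFunction in
lemma ppw_sum (p : ℕ) (hp : 1 ≤ p) (T : Finset ℕ) (hT : ∀ q ∈ T, q.Prime) :
    ∑ d ∈ ppw p T, vonMangoldt d ≤ #T * Real.log p := by
  classical
  have hm : ∀ d ∈ ppw p T, d.minFac ∈ T := by
    intro d hd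
    simp only [ppw, mem_filter] at hd
    exact hd.2.2
  rw [← Finset.sum_fiberwise_of_maps_to hm]
  rw [← nsmul_eq_mul]
  apply Finset.sum_le_card_nsmul
  intro q hq
  have hqp := hT q hq
  have hsub : {d ∈ ppw p T | d.minFac = q} ⊆ (Ioc 0 (Nat.log q p)).image (fun k => q ^ k) := by
    intro d hd
    simp only [ppw, mem_filter, mem_range] at hd
    obtain ⟨⟨h1, h2, _⟩, h3⟩ := hd
    obtain ⟨q', k, hq', hk, rfl⟩ := (isPrimePow_nat_iff d).1 h2
    rw [hq'.pow_minFac hk.ne'] at h3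
    subst h3
    rw [mem_image]
    refine ⟨k, ?_, rfl⟩
    rw [mem_Ioc]
    refine ⟨hk, ?_⟩
    apply Nat.le_log_of_pow_le hqp.one_lt
    omega
  calc _ ≤ ∑ d ∈ {d ∈ ppw p T | d.minFac = q}, Real.log q := by
        apply Finset.sum_le_sum
        intro d hd
        simp only [mem_filter] at hd
        rw [vonMangoldt_apply]
        split_ifs
        · rw [hd.2]
        · exact Real.log_natCast_nonneg q
    _ = #{d ∈ ppw p T | d.minFac = q} * Real.log q := by simp
    _ ≤ (Nat.log q p) * Real.log q := by
        apply mul_le_mul_of_nonneg_right _ (Real.log_natCast_nonneg q)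
        have := (card_le_card hsub).trans card_image_le
        rw [Nat.card_Ioc] at this
        exact_mod_cast this
    _ = Real.log ((q ^ (Nat.log q p) : ℕ) : ℝ) := by push_cast; rw [Real.log_pow]
    _ ≤ Real.log p := by
        apply Real.log_le_log
        · exact_mod_cast pow_pos hqp.pos _
        · exact_mod_cast Nat.pow_log_le_self q (by omega)

open ArithmeticFunction in
lemma ppw_sum_div (p : ℕ) (hp : 1 ≤ p) (T : Finset ℕ) (hT : ∀ q ∈ T, q.Prime) (Q : ℕ) (hQ : 1 ≤ Q) :
    ∑ d ∈ ppw p T, vonMangoldt d / d ≤ Real.log Q + (Real.log 4 + 4) + #T * Real.log p / Q := by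
  classical
  have hQ0 : (0:ℝ) < Q := by exact_mod_cast hQ
  rw [← Finset.sum_filter_add_sum_filter_not (ppw p T) (fun d => d ≤ Q)]
  apply add_le_add
  · refine le_trans ?_ (mertens Q hQ)
    apply Finset.sum_le_sum_of_subset_of_nonneg
    · intro d hd
      simp only [ppw, mem_filter] at hd
      rw [mem_Ioc]
      exact ⟨hd.1.2.1.pos, hd.2⟩
    · intros
      exact div_nonneg vonMangoldt_nonneg (by positivity)
  · calc _ ≤ ∑ d ∈ ppw p T with ¬ d ≤ Q, vonMangoldt d / Q := by
          apply Finset.sum_le_sum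
          intro d hd
          simp only [mem_filter, not_le] at hd
          apply div_le_div_of_nonneg_left vonMangoldt_nonneg hQ0
          exact_mod_cast hd.2.le
      _ ≤ ∑ d ∈ ppw p T, vonMangoldt d / Q := by
          apply Finset.sum_le_sum_of_subset_of_nonneg (filter_subset _ _)
          intros
          exact div_nonneg vonMangoldt_nonneg hQ0.le
      _ = (∑ d ∈ ppw p T, vonMangoldt d) / Q := by rw [Finset.sum_div]
      _ ≤ _ := by gcongr; exact ppw_sum p hp T hT

open ArithmeticFunction in
lemma count_main {p n b c N : ℕ} (hp : p.Prime) (hp2 : p ≠ 2) (hc : c % 2 = 1)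
    (hD : (b:ℤ)^2 - n * c = dsc p) (hlt : ∀ j ∈ Ioc 0 N, fv n b c j < p) (T : Finset ℕ)
    (hT : ∀ q ∈ T, q.Prime) (hmem : ∀ j ∈ Ioc 0 N, ∀ q : ℕ, q.Prime → q ∣ fv n b c j → q ∈ T)
    (Q : ℕ) (hQ : 1 ≤ Q) :
    ∑ j ∈ Ioc 0 N, Real.log (fv n b c j) ≤
      2 * N * (Real.log Q + (Real.log 4 + 4) + #T * Real.log p / Q) + 2 * (#T * Real.log p) := by
  classical
  have hpos : ∀ j, 0 < fv n b c j := by intro j; unfold fv; omega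
  rw [sum_log_swap (fv n b c) (Ioc 0 N) (ppw p T)]
  · calc _ ≤ ∑ d ∈ ppw p T, (2 * N * (vonMangoldt d / d) + 2 * vonMangoldt d) := by
          apply Finset.sum_le_sum
          intro d hd
          simp only [ppw, mem_filter] at hd
          have hle : (#{j ∈ Ioc 0 N | d ∣ fv n b c j} : ℝ) ≤ 2 * ((N:ℝ) / d + 1) := by
            by_cases hne : ({j ∈ Ioc 0 N | d ∣ fv n b c j}).Nonempty
            swap
            · rw [Finset.not_nonempty_iff_eq_empty] at hne
              rw [hne]; simp; positivity
            obtain ⟨j0, hj0⟩ := hne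
            rw [mem_filter] at hj0
            obtain ⟨q, k, hq, hk, rfl⟩ := (isPrimePow_nat_iff d).1 hd.2.1
            obtain ⟨a1, a2, -⟩ := fv_prime hp hp2 hc hD (hlt j0 hj0.1) (hpos j0) hq
              ((dvd_pow_self q hk.ne').trans hj0.2)
            have h1 := fv_count hD hq hk a1 a2 N
            have h2 : (#{j ∈ Ioc 0 N | q ^ k ∣ fv n b c j} : ℝ) ≤ 2 * ((N / q ^ k : ℕ) + 1) := by
              exact_mod_cast h1
            have h3 : ((N / q ^ k : ℕ) : ℝ) ≤ (N:ℝ) / (q ^ k : ℕ) := Nat.cast_div_le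
            linarith
          calc _ ≤ vonMangoldt d * (2 * ((N:ℝ) / d + 1)) :=
                mul_le_mul_of_nonneg_left hle vonMangoldt_nonneg
            _ = _ := by ring
      _ = 2 * N * ∑ d ∈ ppw p T, vonMangoldt d / d + 2 * ∑ d ∈ ppw p T, vonMangoldt d := by
          rw [Finset.sum_add_distrib, Finset.mul_sum, Finset.mul_sum]
      _ ≤ _ := by
          gcongr
          · exact ppw_sum_div p hp.one_lt.le T hT Q hQ
          · exact ppw_sum p hp.one_lt.le T hT
  · intro j hj
    refine ⟨(hpos j).ne', fun d hd hne => ?_⟩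
    have hpp := vonMangoldt_ne_zero_iff.1 hne
    simp only [ppw, mem_filter, mem_range]
    refine ⟨lt_of_le_of_lt (Nat.le_of_dvd (hpos j) hd) (hlt j hj), hpp, ?_⟩
    exact hmem j hj _ (Nat.minFac_prime hpp.one_lt.ne') ((Nat.minFac_dvd d).trans hd)

set_option maxHeartbeats 1000000 in
lemma final_ineq {ε : ℝ} (hε : 0 < ε) (hε' : ε ≤ 1 / 2) :
    ∃ p₀ : ℕ, ∀ p : ℕ, p.Prime → p₀ < p →
      ∀ T : Finset ℕ, (∀ q, q ∈ T ↔ q.Prime ∧ (q : ℝ) < (p : ℝ) ^ ((1 : ℝ) / 2 + ε) ∧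
          ∃ x : ℤ, x ^ 2 ≡ (q : ℤ) [ZMOD (p : ℤ)]) → (p:ℝ) ^ (ε / 25) < #T := by
  obtain ⟨P, hP⟩ := forms (δ := ε / 10) (by positivity) (by linarith)
  have ht1 : Filter.Tendsto (fun p : ℕ => (p:ℝ) ^ (ε / 50)) Filter.atTop Filter.atTop :=
    (tendsto_rpow_atTop (by positivity)).comp tendsto_natCast_atTop_atTop
  have ht2 : Filter.Tendsto (fun p : ℕ => Real.log (p:ℝ)) Filter.atTop Filter.atTop :=
    Real.tendsto_log_atTop.comp tendsto_natCast_atTop_atTop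
  obtain ⟨P2, hP2⟩ := Filter.eventually_atTop.1 ((ht1.eventually_ge_atTop 100).and
    (ht2.eventually_ge_atTop 1000))
  refine ⟨max P (max P2 2), fun p hp hpp T hT => ?_⟩
  have hpP : P < p := lt_of_le_of_lt (le_max_left _ _) hpp
  have hpP2 : P2 < p := lt_of_le_of_lt ((le_max_left _ _).trans (le_max_right _ _)) hpp
  have hp2 : 2 < p := lt_of_le_of_lt ((le_max_right _ _).trans (le_max_right _ _)) hpp
  obtain ⟨hX, hL⟩ := hP2 p hpP2.le
  obtain ⟨n, b, c, hn, hc, hD, hnB, hbB, hcB, hlo⟩ := hP p ⟨hp⟩ hpP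
  by_contra! hcard
  have hp0 : (0:ℝ) < p := by exact_mod_cast hp.pos
  have hp1 : (1:ℝ) ≤ p := by exact_mod_cast hp.one_lt.le
  set X : ℝ := (p:ℝ) ^ (ε / 50) with hXdef
  set L : ℝ := Real.log p with hLdef
  have hXk : ∀ k : ℕ, X ^ k = (p:ℝ) ^ (ε / 50 * k) := by
    intro k
    rw [hXdef, ← Real.rpow_natCast, ← Real.rpow_mul hp0.le]
  have hX2 : (p:ℝ) ^ (ε / 25) = X ^ 2 := by rw [hXk]; congr 1; push_cast; ring
  have hX5 : (p:ℝ) ^ (ε / 10) = X ^ 5 := by rw [hXk]; congr 1; push_cast; ring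
  rw [hX2] at hcard
  set N : ℕ := ⌊X ^ 5⌋₊ with hN
  obtain ⟨hN1, hN2, hN3⟩ := floor_half (y := X ^ 5) (one_le_pow₀ (by linarith))
  rw [← hN] at hN1 hN2 hN3
  set Y : ℝ := (p:ℝ) ^ ((1:ℝ)/2) with hY
  have hY0 : 0 < Y := Real.rpow_pos_of_pos hp0 _
  have hBe : 9 * (p:ℝ) ^ (1/2 + ε / 10) = 9 * (Y * X ^ 5) := by
    rw [Real.rpow_add hp0, hX5]
  have hBig : (p:ℝ) ^ ((1:ℝ)/2 + ε) = Y * X ^ 50 := by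
    rw [Real.rpow_add hp0, hXk]; congr 2; push_cast; ring
  have hBp : (p:ℝ) ^ ((1:ℝ)/2 + ε) ≤ p := by
    calc (p:ℝ) ^ ((1:ℝ)/2 + ε) ≤ (p:ℝ) ^ (1:ℝ) :=
          Real.rpow_le_rpow_of_exponent_le hp1 (by linarith)
      _ = p := Real.rpow_one _
  rw [hBe] at hnB hbB hcB
  have hub : ∀ j ∈ Ioc 0 N, (fv n b c j : ℝ) < (p:ℝ) ^ ((1:ℝ)/2 + ε) := by
    intro j hj
    rw [mem_Ioc] at hj
    have hj1 : (1:ℝ) ≤ j := by exact_mod_cast hj.1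
    have hj2 : (j:ℝ) ≤ X ^ 5 := le_trans (by exact_mod_cast hj.2) hN2
    have hX1 : (1:ℝ) ≤ X ^ 5 := hj1.trans hj2
    have hjj : (j:ℝ) ^ 2 ≤ (X ^ 5) ^ 2 := by gcongr
    have hj3 : (j:ℝ) ≤ (X ^ 5) ^ 2 := by nlinarith
    have h1 : (1:ℝ) ≤ (X ^ 5) ^ 2 := one_le_pow₀ hX1
    set B := 9 * (Y * X ^ 5) with hB
    have hB0 : 0 ≤ B := by positivity
    have : (fv n b c j : ℝ) ≤ 9 * B * (X^5)^2 := by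
      unfold fv
      push_cast
      have a1 : (n:ℝ) * j ^ 2 ≤ B * (X^5)^2 := by gcongr
      have a2 : (b:ℝ) * j ≤ B * (X^5)^2 := by gcongr
      have a3 : (c:ℝ) * 1 ≤ B * (X^5)^2 := by gcongr
      linarith
    refine this.trans_lt ?_
    rw [hBig, hB]
    have e1 : 9 * (9 * (Y * X ^ 5)) * (X^5)^2 = (Y * X ^ 15) * 81 := by ring
    have e2 : Y * X ^ 50 = (Y * X ^ 15) * X ^ 35 := by ring
    rw [e1, e2]
    apply mul_lt_mul_of_pos_left _ (by positivity)
    calc (81:ℝ) < X := by linarith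
      _ ≤ X ^ 35 := le_self_pow₀ (by linarith) (by norm_num)
  have hlt : ∀ j ∈ Ioc 0 N, fv n b c j < p := by
    intro j hj
    exact_mod_cast (hub j hj).trans_le hBp
  have hpos : ∀ j, 0 < fv n b c j := by intro j; unfold fv; omega
  have hTp : ∀ q ∈ T, q.Prime := fun q hq => ((hT q).1 hq).1
  have hmem : ∀ j ∈ Ioc 0 N, ∀ q : ℕ, q.Prime → q ∣ fv n b c j → q ∈ T := by
    intro j hj q hq hqd
    rw [hT]
    refine ⟨hq, ?_, (fv_prime hp hp2.ne' hc hD (hlt j hj) (hpos j) hq hqd).2.2⟩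
    refine lt_of_le_of_lt ?_ (hub j hj)
    exact_mod_cast Nat.le_of_dvd (hpos j) hqd
  set Q : ℕ := ⌈100 * X ^ 2⌉₊ with hQ
  have hX2' : (1:ℝ) ≤ X ^ 2 := one_le_pow₀ (by linarith)
  have hQlo : 100 * X ^ 2 ≤ Q := Nat.le_ceil _
  have hQhi : (Q:ℝ) ≤ 101 * X ^ 2 := by
    have := Nat.ceil_lt_add_one (a := 100 * X ^ 2) (by positivity)
    rw [← hQ] at this
    linarith
  have hQ0 : (0:ℝ) < Q := by linarith
  have hmain := count_main hp hp2.ne' hc hD hlt T hTp hmem Q (by exact_mod_cast hQ0)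
  rw [← hLdef] at hmain
  have hlower : (N:ℝ) * (0.45 * L) ≤ ∑ j ∈ Ioc 0 N, Real.log (fv n b c j) := by
    have : ∑ j ∈ Ioc 0 N, (0.45 * L) = (N:ℝ) * (0.45 * L) := by simp
    rw [← this]
    apply Finset.sum_le_sum
    intro j hj
    rw [mem_Ioc] at hj
    have hj1 : (1:ℝ) ≤ j := by exact_mod_cast hj.1
    have h1 : (p:ℝ) ^ (1/2 - ε / 10) ≤ fv n b c j := by
      unfold fv
      push_cast
      have a1 : (n:ℝ) * 1 ≤ n * j ^ 2 := by gcongr; exact one_le_pow₀ hj1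
      have a2 : (b:ℝ) * 1 ≤ b * j := by gcongr
      have a3 : (0:ℝ) ≤ c := by positivity
      linarith
    have h2 := Real.log_le_log (Real.rpow_pos_of_pos hp0 _) h1
    rw [Real.log_rpow hp0, ← hLdef] at h2
    have h3 : 0.45 * L ≤ (1 / 2 - ε / 10) * L := mul_le_mul_of_nonneg_right (by linarith) (by linarith)
    linarith
  have hlogQ : Real.log Q ≤ 100 + L / 50 := by
    have h1 := Real.log_le_log hQ0 hQhi
    rw [Real.log_mul (by norm_num) (by positivity), ← hX2, Real.log_rpow hp0, ← hLdef] at h1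
    have h2 : Real.log 101 ≤ 100 := by
      have := Real.log_le_sub_one_of_pos (x := 101) (by norm_num)
      linarith
    have h3 : ε / 25 * L ≤ 1 / 50 * L := mul_le_mul_of_nonneg_right (by linarith) (by linarith)
    linarith
  have hlog4 : Real.log 4 ≤ 3 := by
    have := Real.log_le_sub_one_of_pos (x := 4) (by norm_num)
    linarith
  have hT0 : (0:ℝ) ≤ #T := by positivity
  have hTQ : #T * L / Q ≤ L / 100 := by
    rw [div_le_iff₀ hQ0]
    have : 100 * (#T:ℝ) ≤ Q := by linarith
    have h3 : L * (100 * #T) ≤ L * Q := mul_le_mul_of_nonneg_left this (by linarith)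
    linarith
  have hTN : (#T:ℝ) ≤ N / 100 := by
    have : X ^ 5 = X ^ 2 * X ^ 3 := by ring
    have h3 : (1000000:ℝ) ≤ X ^ 3 := by
      calc (1000000:ℝ) = 100 ^ 3 := by norm_num
        _ ≤ X ^ 3 := by gcongr
    have h4 : X ^ 2 * 1000000 ≤ X ^ 2 * X ^ 3 := mul_le_mul_of_nonneg_left h3 (by positivity)
    linarith
  have hN0 : (1:ℝ) ≤ N := by exact_mod_cast hN1
  have hA : Real.log Q + (Real.log 4 + 4) + #T * L / Q ≤ 107 + 0.03 * L := by linarith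
  have hA2 : 2 * (N:ℝ) * (Real.log Q + (Real.log 4 + 4) + #T * L / Q) ≤ 2 * N * (107 + 0.03 * L) := by
    gcongr
  have hA3 : 2 * (#T * L) ≤ 2 * (N / 100 * L) := by gcongr
  have hfin : (N:ℝ) * (0.45 * L) ≤ N * (214 + 0.08 * L) := by linarith
  have := le_of_mul_le_mul_left hfin (by linarith)
  linarith

theorem main_thm (ε : ℝ) (hε : 0 < ε) (hε' : ε ≤ 1 / 2) :
    ∃ p₀ : ℕ, ∀ p : ℕ, p.Prime → p₀ < p →
      (p : ℝ) ^ (ε / 25) <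
        Nat.card {q : ℕ | q.Prime ∧ (q : ℝ) < (p : ℝ) ^ ((1 : ℝ) / 2 + ε) ∧
          ∃ x : ℤ, x ^ 2 ≡ (q : ℤ) [ZMOD (p : ℤ)]} := by
  obtain ⟨P, hP⟩ := final_ineq hε hε'
  refine ⟨P, fun p hp hpp => ?_⟩
  have hfin : Set.Finite {q : ℕ | q.Prime ∧ (q : ℝ) < (p : ℝ) ^ ((1 : ℝ) / 2 + ε) ∧
          ∃ x : ℤ, x ^ 2 ≡ (q : ℤ) [ZMOD (p : ℤ)]} := by
    apply (Set.finite_Iic ⌈(p : ℝ) ^ ((1 : ℝ) / 2 + ε)⌉₊).subset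
    rintro q ⟨_, h, _⟩
    have := h.le.trans (Nat.le_ceil _)
    exact_mod_cast this
  have := hP p hp hpp hfin.toFinset (fun q => by simp)
  rwa [Nat.card_coe_set_eq, Set.ncard_eq_toFinset_card _ hfin]

end

/-- For every ε with 0 < ε ≤ 1/2 there is a bound p₀(ε) such that for every prime
p > p₀(ε), the number of primes q < p^(1/2+ε) that are quadratic residues modulo p
exceeds p^(ε/25). -/
theorem many_small_prime_quadratic_residues (ε : ℝ) (hε : 0 < ε) (hε' : ε ≤ 1 / 2) :
    ∃ p₀ : ℕ, ∀ p : ℕ, p.Prime → p₀ < p →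
      (p : ℝ) ^ (ε / 25) <
        Nat.card {q : ℕ | q.Prime ∧ (q : ℝ) < (p : ℝ) ^ ((1 : ℝ) / 2 + ε) ∧
          ∃ x : ℤ, x ^ 2 ≡ (q : ℤ) [ZMOD (p : ℤ)]} := by
  exact main_thm ε hε hε'
end

section
/- Let p be a prime with p ≡ 1 (mod 3), and let L, M be integers with 4p = L² + 27M². Let q be a prime with q ∉ {2, 3, p}. Then q is a cubic residue modulo p if and only if there exists an integer x with M·(x³ − 9x) ≡ L·(x² − 1) (mod q). -/
theorem uniq_rep (p : ℤ) (hp : Prime p) (L M a b : ℤ) (h : 4 * p = L ^ 2 + 27 * M ^ 2)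
    (h' : 4 * p = a ^ 2 + 27 * b ^ 2) : (L = a ∨ L = -a) ∧ (M = b ∨ M = -b) := by
  have hp0 : p ≠ 0 := hp.ne_zero
  have key : ∀ c : ℤ, 4 * p = a ^ 2 + 27 * c ^ 2 → p ∣ L * c - a * M → L * c = a * M := by
    rintro c hc ⟨k, hk⟩
    have e : (L * a + 27 * M * c) ^ 2 + 27 * (p * k) ^ 2 = 16 * p ^ 2 := by
      rw [← hk]
      linear_combination (-4*p) * h - (L^2+27*M^2) * hc
    have hd : p ^ 2 ∣ (L * a + 27 * M * c) ^ 2 := ⟨16 - 27 * k ^ 2, by linear_combination e⟩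
    obtain ⟨j, hj⟩ := (Int.pow_dvd_pow_iff (by norm_num)).1 hd
    have e2 : j ^ 2 + 27 * k ^ 2 = 16 := by
      rw [hj] at e
      have : p ^ 2 * (j ^ 2 + 27 * k ^ 2 - 16) = 0 := by linear_combination e
      rcases mul_eq_zero.1 this with h0 | h0
      · exact absurd h0 (pow_ne_zero 2 hp0)
      · linarith
    have hk0 : k = 0 := by
      by_contra hne
      have : 1 ≤ k ^ 2 := by
        have := sq_pos_of_ne_zero hne
        omega
      nlinarith [sq_nonneg j]
    rw [hk0] at hk; linarith
  have fin : ∀ c : ℤ, 4 * p = a ^ 2 + 27 * c ^ 2 → L * c = a * M → L ^ 2 = a ^ 2 ∧ M ^ 2 = c ^ 2 := by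
    intro c hc e
    have : 4 * p * (c ^ 2 - M ^ 2) = 0 := by
      linear_combination (L * c + a * M) * e + c ^ 2 * h - M ^ 2 * hc
    rcases mul_eq_zero.1 this with h0 | h0
    · exact absurd h0 (mul_ne_zero (by norm_num) hp0)
    · constructor <;> linarith
  have hd : p ∣ (L * b - a * M) * (L * (-b) - a * M) :=
    ⟨-4 * (b ^ 2 - M ^ 2), by linear_combination b ^ 2 * h - M ^ 2 * h'⟩
  have : L ^ 2 = a ^ 2 ∧ M ^ 2 = b ^ 2 := by
    rcases hp.dvd_or_dvd hd with h1 | h1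
    · exact fin b h' (key b h' h1)
    · have h'' : 4 * p = a ^ 2 + 27 * (-b) ^ 2 := by linarith
      have := fin (-b) h'' (key (-b) h'' h1)
      simpa using this
  exact ⟨sq_eq_sq_iff_eq_or_eq_neg.1 this.1, sq_eq_sq_iff_eq_or_eq_neg.1 this.2⟩

theorem core {K : Type*} [Field K] (q : ℕ) [Fact q.Prime] [CharP K q] (h2 : (2 : K) ≠ 0)
    (h3 : (3 : K) ≠ 0) (w c G G' : K) (L m : ℤ) (hw : w ^ 2 + w + 1 = 0)
    (hG : G ≠ 0) (hG' : G' ≠ 0) (hc : c ^ 3 = 1)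
    (h1 : 2 * G ^ 2 = G' * (L + 3 * m * (2 * w + 1)))
    (h1' : 2 * G' ^ 2 = G * (L - 3 * m * (2 * w + 1)))
    (hF : (w ^ q = w ∧ c * G ^ q = G ∧ c ^ 2 * G' ^ q = G') ∨
      (w ^ q = w ^ 2 ∧ c ^ 2 * G ^ q = G' ∧ c * G' ^ q = G)) :
    c = 1 ↔ ∃ x : ℤ, m * (x ^ 3 - 9 * x) ≡ L * (x ^ 2 - 1) [ZMOD (q : ℤ)] := by
  have hq := Fact.out (p := q.Prime)
  obtain ⟨s, hs⟩ : ∃ s, s = 2 * w + 1 := ⟨_, rfl⟩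
  rw [← hs] at h1 h1'
  have hs2 : s ^ 2 = -3 := by rw [hs]; linear_combination 4 * hw
  have hs0 : s ≠ 0 := by
    rintro rfl
    apply h3; linear_combination hs2
  have hw3 : w ^ 3 = 1 := by linear_combination (w - 1) * hw
  have hcub : G ^ 3 * (L - 3 * m * s) = G' ^ 3 * (L + 3 * m * s) := by
    linear_combination (-G^2) * h1' + G'^2 * h1
  have hsq : (w ^ q = w → s ^ q = s) ∧ (w ^ q = w ^ 2 → s ^ q = - s) := by
    have : s ^ q = 2 * w ^ q + 1 := by
      have h2q : (2 : K) ^ q = 2 := by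
        have := map_natCast (frobenius K q) 2
        simpa [frobenius_def] using this
      rw [hs, add_pow_char, mul_pow, h2q, one_pow]
    rw [this]
    refine ⟨fun h => by rw [h, hs], fun h => ?_⟩
    rw [h, hs]; linear_combination 2 * hw
  -- translate the congruence
  have tr : ∀ x : ℤ, (m * (x ^ 3 - 9 * x) ≡ L * (x ^ 2 - 1) [ZMOD (q : ℤ)]) ↔
      ((x : K) + s) ^ 3 * (L - 3 * m * s) = (x - s) ^ 3 * (L + 3 * m * s) := by
    intro x
    rw [← CharP.intCast_eq_intCast K q]
    push_cast
    have hne : (6 : K) * s ≠ 0 := by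
      have : (6 : K) = 2 * 3 := by norm_num
      rw [this]; exact mul_ne_zero (mul_ne_zero h2 h3) hs0
    constructor
    · intro h
      linear_combination (-6 * s) * h + (2 * s * L - 6 * m * s * 3 * x) * hs2
    · intro h
      apply mul_left_cancel₀ hne
      linear_combination (-1) * h + (2 * s * L - 6 * m * s * 3 * x) * hs2
  constructor
  · rintro rfl
    simp only [one_pow, one_mul] at hF
    by_cases hGG : G = G'
    · refine ⟨1, (tr 1).2 ?_⟩
      have hL : (L - 3 * m * s : K) = L + 3 * m * s := by
        rw [hGG] at hcub
        exact mul_left_cancel₀ (pow_ne_zero 3 hG') hcub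
      rw [hL]; push_cast
      linear_combination 2 * s * (L + 3 * m * s) * hs2
    · have hne : G - G' ≠ 0 := sub_ne_zero.2 hGG
      obtain ⟨x, hx⟩ : ∃ x, x = s * (G + G') / (G - G') := ⟨_, rfl⟩
      have hxq : x ^ q = x := by
        rw [hx, div_pow, mul_pow, add_pow_char, sub_pow_char]
        rcases hF with ⟨a, b, c⟩ | ⟨a, b, c⟩
        · rw [hsq.1 a, b, c]
        · rw [hsq.2 a, b, c, div_eq_div_iff (sub_ne_zero.2 (Ne.symm hGG)) hne]; ring
      rw [← Subfield.mem_bot_iff_pow_eq_self, mem_bot_iff_intCast q] at hxq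
      obtain ⟨n, hn⟩ := hxq
      refine ⟨n, (tr n).2 ?_⟩
      have e1 : (n : K) + s = 2 * s * G / (G - G') := by
        rw [hn, hx]; field_simp; ring
      have e2 : (n : K) - s = 2 * s * G' / (G - G') := by
        rw [hn, hx]; field_simp; ring
      rw [e1, e2, div_pow, div_pow, mul_pow, mul_pow _ G']
      linear_combination ((2 * s) ^ 3 / (G - G') ^ 3) * hcub
  · rintro ⟨x, hx⟩
    rw [tr x] at hx
    have hxq : (x : K) ^ q = x := by
      rw [← frobenius_def, map_intCast]
    -- L ± 3ms nonzero
    have hP : (L + 3 * m * s : K) ≠ 0 := by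
      intro h; rw [h, mul_zero] at h1
      exact mul_ne_zero h2 (pow_ne_zero 2 hG) h1
    have hP' : (L - 3 * m * s : K) ≠ 0 := by
      intro h; rw [h, mul_zero] at h1'
      exact mul_ne_zero h2 (pow_ne_zero 2 hG') h1'
    have hxs : (x : K) - s ≠ 0 := by
      intro h
      rw [h, zero_pow (by norm_num), zero_mul] at hx
      have := eq_zero_of_pow_eq_zero ((mul_eq_zero.1 hx).resolve_right hP')
      exact mul_ne_zero h2 hs0 (by linear_combination this - h)
    have hxs' : (x : K) + s ≠ 0 := by
      intro h
      rw [h, zero_pow (by norm_num), zero_mul] at hx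
      exact (mul_ne_zero (pow_ne_zero 3 hxs) hP) hx.symm
    have e3 : (G * (x - s)) ^ 3 = (G' * (x + s)) ^ 3 := by
      apply mul_left_cancel₀ (mul_ne_zero hP hP')
      linear_combination (x - s) ^ 3 * (L + 3 * m * s) * hcub - G' ^ 3 * (L + 3 * m * s) * hx
    obtain ⟨t, ht, e⟩ : ∃ t : K, (t = 1 ∨ t = w ∨ t = w ^ 2) ∧ G * (x - s) = t * (G' * (x + s)) := by
      have : (G * (x - s) - 1 * (G' * (x + s))) * ((G * (x - s) - w * (G' * (x + s))) *
        (G * (x - s) - w ^ 2 * (G' * (x + s)))) = 0 := by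
        generalize G * (x - s) = u at *
        generalize G' * (x + s) = v at *
        linear_combination e3 + (-u^2*v + u*v^2*w) * hw + (- v^3) * hw3
      rcases mul_eq_zero.1 this with h | h
      · exact ⟨_, Or.inl rfl, sub_eq_zero.1 h⟩
      rcases mul_eq_zero.1 h with h | h
      · exact ⟨_, Or.inr (Or.inl rfl), sub_eq_zero.1 h⟩
      · exact ⟨_, Or.inr (Or.inr rfl), sub_eq_zero.1 h⟩
    have ht3 : t ^ 3 = 1 := by
      rcases ht with rfl | rfl | rfl
      · norm_num
      · exact hw3
      · linear_combination (w ^ 3 + 1) * hw3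
    have ht0 : t ≠ 0 := by rintro rfl; norm_num at ht3
    have hc0 : c ≠ 0 := by rintro rfl; norm_num at hc
    have eq := congrArg (· ^ q) e
    simp only [mul_pow, sub_pow_char, add_pow_char, hxq] at eq
    rcases hF with ⟨a, b, d⟩ | ⟨a, b, d⟩
    · have htq : t ^ q = t := by
        rcases ht with rfl | rfl | rfl
        · simp
        · exact a
        · rw [← pow_mul, mul_comm, pow_mul, a]
      rw [hsq.1 a, htq] at eq
      -- c * G^q = G
      have : (G * (x - s)) * c = (G * (x - s)) * 1 := by
        linear_combination  c ^ 2 * eq * 1 + (- c * (x-s)) * b + t * (x + s) * d - e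
      exact mul_left_cancel₀ (mul_ne_zero hG hxs) this
    · have htq : t ^ q = t ^ 2 := by
        rcases ht with rfl | rfl | rfl
        · simp
        · exact a
        · rw [← pow_mul, mul_comm, pow_mul, a]
      rw [hsq.2 a, htq] at eq
      -- G' (x+s) * c = t^2 * G (x-s) * c^2
      have e5 : G' * (x + s) = t ^ 2 * (G * (x - s)) * c := by
        linear_combination (c ^ 2) * eq - (x + s) * b + t ^ 2 * (x - s) * c * d
      have : (G * (x - s)) * c = (G * (x - s)) * 1 := by
        linear_combination  (-t) * e5 - e - (G * (x - s)) * c * ht3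
      exact mul_left_cancel₀ (mul_ne_zero hG hxs) this

abbrev Eis : Type := QuadraticAlgebra ℤ (-1) (-1)

theorem exists_hom {R : Type*} [CommRing R] (w : R) (hw : w ^ 2 + w + 1 = 0) :
    ∃ f : Eis →+* R, ∀ z : Eis, f z = (z.re : R) + z.im * w := by
  refine ⟨(QuadraticAlgebra.lift (R := ℤ) (a := -1) (b := -1)
    ⟨w, by simp; linear_combination hw⟩ : Eis →ₐ[ℤ] R).toRingHom, fun z => ?_⟩
  simp [QuadraticAlgebra.lift]

theorem exists_homC : ∃ f : Eis →+* ℂ, Function.Injective f := by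
  obtain ⟨w, hw⟩ := HasEnoughRootsOfUnity.exists_primitiveRoot ℂ 3
  have hw2 : w ^ 2 + w + 1 = 0 := by
    have h1 : w ≠ 1 := hw.ne_one (by norm_num)
    have h3 := hw.pow_eq_one
    apply mul_left_cancel₀ (sub_ne_zero.2 h1)
    linear_combination h3
  obtain ⟨f, hf⟩ := exists_hom w hw2
  refine ⟨f, (injective_iff_map_eq_zero f).2 fun z hz => ?_⟩
  rw [hf] at hz
  have h : ((z.re ^ 2 - z.re * z.im + z.im ^ 2 : ℤ) : ℂ) = 0 := by
    push_cast
    linear_combination (z.re - z.im * (1 + w)) * hz + z.im ^ 2 * hw2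
  have h' : z.re ^ 2 - z.re * z.im + z.im ^ 2 = 0 := by exact_mod_cast h
  have hi : z.im = 0 := by
    have : z.im ^ 2 ≤ 0 := by nlinarith [sq_nonneg (2 * z.re - z.im)]
    exact pow_eq_zero_iff (two_ne_zero) |>.1 (le_antisymm this (sq_nonneg _))
  have hr : z.re = 0 := by
    rw [hi] at h'
    exact pow_eq_zero_iff (two_ne_zero) |>.1 (by linarith)
  ext
  · simpa using hr
  · simpa using hi

instance : IsDomain Eis := by
  obtain ⟨f, hf⟩ := exists_homC
  exact hf.isDomain f

def om : Eis := ⟨0, 1⟩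

theorem om_eq : om ^ 2 + om + 1 = 0 := by
  ext <;> simp [om, sq, QuadraticAlgebra.re_one, QuadraticAlgebra.im_one]

theorem om_prim : IsPrimitiveRoot om 3 := by
  have h : orderOf om = 3 := by
    have : Fact (Nat.Prime 3) := ⟨Nat.prime_three⟩
    apply orderOf_eq_prime
    · linear_combination (om - 1) * om_eq
    · intro h
      have := congrArg QuadraticAlgebra.im h
      simp [om, QuadraticAlgebra.im_one] at this
  rw [← h]; exact IsPrimitiveRoot.orderOf om

/-- the conjugate Jacobi sum and the norm equation -/
theorem exists_char (p : ℕ) [Fact p.Prime] (hp3 : p % 3 = 1) :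
    ∃ (χ : MulChar (ZMod p) Eis) (a m : ℤ), χ ^ 3 = 1 ∧ χ ≠ 1 ∧
      jacobiSum χ χ = ⟨a, 3 * m⟩ ∧ jacobiSum (χ ^ 2) (χ ^ 2) = ⟨a - 3 * m, - 3 * m⟩ ∧
      4 * (p : ℤ) = (2 * a - 3 * m) ^ 2 + 27 * m ^ 2 := by
  have hcard : 3 ∣ Fintype.card (ZMod p) - 1 := by rw [ZMod.card]; omega
  obtain ⟨χ, hχ⟩ := MulChar.exists_mulChar_orderOf (ZMod p) hcard om_prim
  have h3 : χ ^ 3 = 1 := by rw [← hχ]; exact pow_orderOf_eq_one χ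
  have h1 : χ ≠ 1 := by rintro rfl; simp at hχ
  have h2 : χ * χ ≠ 1 := by
    intro h
    apply h1
    calc χ = χ * (χ * χ) := by rw [h, mul_one]
      _ = χ ^ 3 := by rw [pow_succ, sq, mul_assoc]
      _ = 1 := h3
  have hinv : χ⁻¹ = χ ^ 2 := by
    rw [inv_eq_iff_mul_eq_one, ← pow_succ', h3]
  obtain ⟨z, -, hz⟩ := exists_jacobiSum_eq_neg_one_add (by norm_num) h3 h3 hcard om_prim
  -- conjugation on Eis
  have hs : (-1 - om : Eis) ^ 2 + (-1 - om) + 1 = 0 := by linear_combination om_eq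
  obtain ⟨σ, hσ⟩ := exists_hom (-1 - om : Eis) hs
  have hσom : σ om = om ^ 2 := by
    have h : σ om = -1 - om := by
      rw [hσ om]
      have e1 : om.re = 0 := rfl
      have e2 : om.im = 1 := rfl
      rw [e1, e2]; push_cast; ring
    rw [h]; linear_combination -om_eq
  have hconj : χ ^ 2 = χ.ringHomComp σ := by
    apply MulChar.ext
    intro u
    have hk := MulChar.exists_apply_eq_pow h3 om_prim (a := (u : ZMod p)) u.ne_zero
    obtain ⟨k, -, hk⟩ := hk
    rw [MulChar.pow_apply_coe, MulChar.ringHomComp_apply, hk, map_pow, ← pow_mul, mul_comm k, pow_mul]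
    rw [hσom]
  have hJ : jacobiSum χ χ = ⟨-1 + 3 * z.im, 3 * (z.im - z.re)⟩ := by
    rw [hz]
    ext <;> simp [om, sq, QuadraticAlgebra.re_one, QuadraticAlgebra.im_one] <;> ring
  have hJ' : jacobiSum (χ ^ 2) (χ ^ 2) =
      ⟨-1 + 3 * z.im - 3 * (z.im - z.re), - 3 * (z.im - z.re)⟩ := by
    rw [hconj, jacobiSum_ringHomComp, hJ, hσ]
    ext <;> simp [om, QuadraticAlgebra.re_one, QuadraticAlgebra.im_one,
      QuadraticAlgebra.re_ofNat, QuadraticAlgebra.im_ofNat] <;> ring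
  refine ⟨χ, -1 + 3 * z.im, z.im - z.re, h3, h1, hJ, hJ', ?_⟩
  obtain ⟨f, hf⟩ := exists_homC
  have hne : ringChar ℂ ≠ ringChar (ZMod p) := by
    rw [ringChar.eq_zero, ZMod.ringChar_zmod_n]
    exact (Fact.out (p := p.Prime)).ne_zero.symm
  have key := jacobiSum_mul_jacobiSum_inv (χ := χ.ringHomComp f) (φ := χ.ringHomComp f) hne
    ((MulChar.ringHomComp_ne_one_iff hf).2 h1) ((MulChar.ringHomComp_ne_one_iff hf).2 h1)
    (by rw [← MulChar.ringHomComp_mul]; exact (MulChar.ringHomComp_ne_one_iff hf).2 h2)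
  rw [MulChar.ringHomComp_inv, hinv, jacobiSum_ringHomComp, jacobiSum_ringHomComp, ← map_mul,
    ZMod.card, ← map_natCast f] at key
  have key := congrArg QuadraticAlgebra.re (hf key)
  rw [hJ, hJ'] at key
  simp at key
  linear_combination -4 * key

theorem cube_iff (p : ℕ) [Fact p.Prime] {K : Type*} [Field K] (χ : MulChar (ZMod p) K)
    (h3 : χ ^ 3 = 1) (h1 : χ ≠ 1) (u : (ZMod p)ˣ) :
    χ u = 1 ↔ ∃ x : ZMod p, x ^ 3 = u := by
  constructor
  · intro h
    obtain ⟨g, hg⟩ := IsCyclic.exists_generator (α := (ZMod p)ˣ)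
    obtain ⟨k, hk⟩ := hg u
    have hg1 : χ g ≠ 1 := by
      intro hg1
      apply h1
      rw [MulChar.eq_one_iff]
      intro a
      obtain ⟨j, rfl⟩ := (mem_powers_iff_mem_zpowers).2 (hg a)
      simp [hg1]
    have hk' := (mem_powers_iff_mem_zpowers).2 (hg u)
    obtain ⟨j, rfl⟩ := hk'
    have hg3 : χ g ^ 3 = 1 := by
      rw [← MulChar.pow_apply_coe, h3, MulChar.one_apply_coe]
    have hord : orderOf (χ g) = 3 := by
      have : Fact (Nat.Prime 3) := ⟨Nat.prime_three⟩
      exact orderOf_eq_prime hg3 hg1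
    have hj : χ g ^ j = 1 := by simpa using h
    obtain ⟨i, rfl⟩ := hord ▸ orderOf_dvd_of_pow_eq_one hj
    refine ⟨(g : ZMod p) ^ i, ?_⟩
    push_cast
    rw [← pow_mul, mul_comm]
  · rintro ⟨x, hx⟩
    have hx0 : x ≠ 0 := by
      rintro rfl
      rw [zero_pow (by norm_num)] at hx
      exact u.ne_zero hx.symm
    rw [← hx, map_pow, ← MulChar.pow_apply' _ (by norm_num), h3, MulChar.one_apply hx0.isUnit]

theorem main_aux (K : Type*) [Field K] [IsAlgClosed K] (p : ℕ) [Fact p.Prime]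
    (hp3 : p % 3 = 1) (q : ℕ) [Fact q.Prime] [CharP K q] (hq2 : q ≠ 2)
    (hq3 : q ≠ 3) (hqp : q ≠ p) :
    ∃ L m : ℤ, 4 * (p : ℤ) = L ^ 2 + 27 * m ^ 2 ∧
    ((∃ x : ZMod p, x ^ 3 = (q : ZMod p)) ↔
      ∃ x : ℤ, m * (x ^ 3 - 9 * x) ≡ L * (x ^ 2 - 1) [ZMOD (q : ℤ)]) := by
  have hp := Fact.out (p := p.Prime)
  have hq := Fact.out (p := q.Prime)
  obtain ⟨χ₀, a, m, h3, h1, hJ, hJ', hN⟩ := exists_char p hp3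
  refine ⟨2 * a - 3 * m, m, hN, ?_⟩
  have hprime : ∀ l : ℕ, l.Prime → q ≠ l → (l : K) ≠ 0 := by
    intro l hl hne h
    rw [CharP.cast_eq_zero_iff K q] at h
    exact hne ((Nat.prime_dvd_prime_iff_eq hq hl).1 h)
  have k2 : (2 : K) ≠ 0 := by exact_mod_cast hprime 2 Nat.prime_two hq2
  have k3 : (3 : K) ≠ 0 := by exact_mod_cast hprime 3 Nat.prime_three hq3
  have kp : (p : K) ≠ 0 := hprime p hp hqp
  have : NeZero ((3 : ℕ) : K) := ⟨by exact_mod_cast k3⟩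
  have : NeZero ((p : ℕ) : K) := ⟨kp⟩
  obtain ⟨w, hw⟩ := HasEnoughRootsOfUnity.exists_primitiveRoot K 3
  obtain ⟨ζ, hζ⟩ := HasEnoughRootsOfUnity.exists_primitiveRoot K p
  have hw3 := hw.pow_eq_one
  have hw2 : w ^ 2 + w + 1 = 0 := by
    have h1 : w ≠ 1 := hw.ne_one (by norm_num)
    apply mul_left_cancel₀ (sub_ne_zero.2 h1)
    linear_combination hw3
  have : NeZero p := ⟨hp.ne_zero⟩
  obtain ⟨ψ, hψ⟩ : ∃ ψ : AddChar (ZMod p) K, ψ.IsPrimitive :=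
    ⟨_, AddChar.zmodChar_primitive_of_primitive_root p hζ⟩
  obtain ⟨f, hf⟩ := exists_hom w hw2
  obtain ⟨χ, hχ⟩ : ∃ χ, χ = χ₀.ringHomComp f := ⟨_, rfl⟩
  have hχ3 : χ ^ 3 = 1 := by
    rw [hχ, MulChar.ringHomComp_pow, h3, MulChar.ringHomComp_one]
  have hχ1 : χ ≠ 1 := by
    intro h
    obtain ⟨u, hu⟩ := MulChar.ne_one_iff.1 h1
    have hu3 : χ₀ u ^ 3 = 1 := by
      rw [← MulChar.pow_apply_coe, h3, MulChar.one_apply_coe]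
    have e : χ₀ u ^ 2 + χ₀ u + 1 = 0 := by
      apply mul_left_cancel₀ (sub_ne_zero.2 hu)
      linear_combination hu3
    have e' := congrArg f e
    have hfu : f (χ₀ u) = 1 := by
      rw [← MulChar.ringHomComp_apply, ← hχ, h, MulChar.one_apply_coe]
    simp only [map_add, map_pow, hfu, map_one, map_zero] at e'
    apply k3; linear_combination e'
  have hχ2 : χ ^ 2 ≠ 1 := by
    intro h
    apply hχ1
    rw [pow_succ, h, one_mul] at hχ3
    exact hχ3
  have hχ4 : χ ^ 2 * χ ^ 2 = χ := by
    rw [← pow_add, show 2 + 2 = 3 + 1 from rfl, pow_succ, hχ3, one_mul]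
  have hcop : IsUnit (q : ZMod p) := (ZMod.isUnit_iff_coprime q p).2 ((Nat.coprime_primes hq hp).2 hqp)
  obtain ⟨u, hu⟩ := hcop
  rw [← hu, ← cube_iff p χ hχ3 hχ1 u]
  have hcard : (Fintype.card (ZMod p) : K) ≠ 0 := by rwa [ZMod.card]
  have hG := gaussSum_ne_zero_of_nontrivial hcard hχ1 hψ
  have hG' := gaussSum_ne_zero_of_nontrivial hcard hχ2 hψ
  have e1 := jacobiSum_mul_nontrivial (χ := χ) (φ := χ) (by rwa [← sq]) ψ
  have e2 := jacobiSum_mul_nontrivial (χ := χ ^ 2) (φ := χ ^ 2) (by rwa [hχ4]) ψ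
  rw [← sq] at e1
  rw [hχ4] at e2
  have hJK : jacobiSum χ χ = a + 3 * m * w := by
    rw [hχ, jacobiSum_ringHomComp, hJ, hf]; push_cast; ring
  have hJK' : jacobiSum (χ ^ 2) (χ ^ 2) = (a - 3 * m) - 3 * m * w := by
    rw [hχ, MulChar.ringHomComp_pow, jacobiSum_ringHomComp, hJ', hf]; push_cast; ring
  rw [hJK] at e1
  rw [hJK'] at e2
  have frob : ∀ φ : MulChar (ZMod p) K, (φ ^ q) u * gaussSum φ ψ ^ q = gaussSum (φ ^ q) ψ := by
    intro φ
    rw [gaussSum_frob q, AddChar.pow_mulShift, ← hu, gaussSum_mulShift]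
  have hc3 : χ u ^ 3 = 1 := by
    rw [← MulChar.pow_apply_coe, hχ3, MulChar.one_apply_coe]
  refine core q k2 k3 w (χ u) (gaussSum χ ψ) (gaussSum (χ ^ 2) ψ) _ m hw2 hG hG' hc3
    ?_ ?_ ?_
  · push_cast; linear_combination (-2) * e1
  · push_cast; linear_combination (-2) * e2
  · have f1 := frob χ
    have f2 := frob (χ ^ 2)
    have hq0 : q % 3 = 1 ∨ q % 3 = 2 := by
      have : q % 3 ≠ 0 := fun h =>
        hq3 ((Nat.prime_dvd_prime_iff_eq Nat.prime_three hq).1 (Nat.dvd_of_mod_eq_zero h)).symm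
      omega
    have hχq : χ ^ q = χ ^ (q % 3) := pow_eq_pow_mod q hχ3
    have hwq : w ^ q = w ^ (q % 3) := pow_eq_pow_mod q hw3
    have hχq2 : (χ ^ 2) ^ q = χ ^ (2 * (q % 3)) := by
      rw [← pow_mul, mul_comm, pow_mul, hχq, ← pow_mul, mul_comm]
    rw [hχq] at f1
    rw [hχq2] at f2
    rcases hq0 with h | h
    · left
      rw [h] at f1 f2 hwq
      rw [pow_one] at f1 hwq
      rw [mul_one, MulChar.pow_apply_coe] at f2
      exact ⟨hwq, f1, f2⟩
    · right
      rw [h] at f1 f2 hwq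
      rw [show 2 * 2 = 2 + 2 from rfl, pow_add, hχ4] at f2
      rw [MulChar.pow_apply_coe] at f1
      exact ⟨hwq, f1, f2⟩

theorem cubic_residue_criterion (p : ℕ) (hp : p.Prime) (hp3 : p % 3 = 1)
    (L M : ℤ) (hLM : 4 * (p : ℤ) = L ^ 2 + 27 * M ^ 2)
    (q : ℕ) (hq : q.Prime) (hq2 : q ≠ 2) (hq3 : q ≠ 3) (hqp : q ≠ p) :
    (∃ x : ℤ, x ^ 3 ≡ (q : ℤ) [ZMOD (p : ℤ)]) ↔
      ∃ x : ℤ, M * (x ^ 3 - 9 * x) ≡ L * (x ^ 2 - 1) [ZMOD (q : ℤ)] := by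
  have : Fact p.Prime := ⟨hp⟩
  have : Fact q.Prime := ⟨hq⟩
  have : CharP (AlgebraicClosure (ZMod q)) q :=
    charP_of_injective_algebraMap (algebraMap (ZMod q) (AlgebraicClosure (ZMod q))).injective q
  obtain ⟨a, m, hN, key⟩ := main_aux (AlgebraicClosure (ZMod q)) p hp3 q hq2 hq3 hqp
  have hcube : (∃ x : ℤ, x ^ 3 ≡ (q : ℤ) [ZMOD (p : ℤ)]) ↔
      ∃ x : ZMod p, x ^ 3 = (q : ZMod p) := by
    simp only [← ZMod.intCast_eq_intCast_iff]
    push_cast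
    constructor
    · rintro ⟨x, hx⟩; exact ⟨x, hx⟩
    · rintro ⟨x, hx⟩
      obtain ⟨y, rfl⟩ := ZMod.intCast_surjective x
      exact ⟨y, hx⟩
  rw [hcube, key]
  -- sign changes
  have sgn : ∀ A B : ℤ, (∃ x : ℤ, A * (x ^ 3 - 9 * x) ≡ B * (x ^ 2 - 1) [ZMOD (q : ℤ)]) →
      ∃ x : ℤ, (-A) * (x ^ 3 - 9 * x) ≡ B * (x ^ 2 - 1) [ZMOD (q : ℤ)] := by
    rintro A B ⟨x, hx⟩
    refine ⟨-x, ?_⟩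
    convert hx using 1 <;> ring
  have neg : ∀ A B : ℤ, (∃ x : ℤ, A * (x ^ 3 - 9 * x) ≡ B * (x ^ 2 - 1) [ZMOD (q : ℤ)]) →
      ∃ x : ℤ, (-A) * (x ^ 3 - 9 * x) ≡ (-B) * (x ^ 2 - 1) [ZMOD (q : ℤ)] := by
    rintro A B ⟨x, hx⟩
    refine ⟨x, ?_⟩
    convert hx.neg using 1 <;> ring
  have neg' : ∀ A B : ℤ, (∃ x : ℤ, A * (x ^ 3 - 9 * x) ≡ B * (x ^ 2 - 1) [ZMOD (q : ℤ)]) →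
      ∃ x : ℤ, A * (x ^ 3 - 9 * x) ≡ (-B) * (x ^ 2 - 1) [ZMOD (q : ℤ)] := by
    intro A B h
    have := sgn _ _ (neg A B h)
    rwa [neg_neg] at this
  obtain ⟨h1, h2⟩ := uniq_rep p (Nat.prime_iff_prime_int.1 hp) L M a m hLM hN
  rcases h1 with rfl | rfl <;> rcases h2 with rfl | rfl
  · rfl
  · exact ⟨sgn _ _, fun h => by simpa only [neg_neg] using sgn _ _ h⟩
  · exact ⟨neg' _ _, fun h => by simpa only [neg_neg] using neg' _ _ h⟩
  · exact ⟨neg _ _, fun h => by simpa only [neg_neg] using neg _ _ h⟩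
end
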